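/- arXiv:1605.07953 — 4 statements merged into one kernel-verified Lean document; each statement's English description precedes it below -/
import Mathlib

section
/- Let A be an alphabet with #A = 2 and n ≥ 3. If ω is a de Bruijn sequence of order n − 2 in A, then the number of de Bruijn sequences of order n + 1 in A that have ω as an initial segment is at least 2^{2^{n−2}}. -/
/-- A word `w` of length `L` over the alphabet `A` is a (non-cyclic) de Bruijn word of
order `m`: every word of length `m` over `A` occurs exactly once as a consecutive
substring of `w`. (This is applied with `L = k^m + m - 1` where `k = #A`.) -/
def IsDeBruijnWord {A : Type*} (m L : ℕ) (w : Fin L → A) : Prop :=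
  ∀ v : Fin m → A, ∃! j : ℕ,
    j + m ≤ L ∧ ∀ (i : Fin m) (h : j + (i : ℕ) < L), w ⟨j + (i : ℕ), h⟩ = v i

structure BG (V A : Type*) where
  next : V → A → V
  sib : V → V
  bar : A → A
  bar_iff : ∀ a b, b ≠ a ↔ b = bar a
  sib_ne : ∀ v, sib v ≠ v
  sib_sib : ∀ v, sib (sib v) = v
  next_inj : ∀ v v' a a', next v a = next v' a' ↔ a' = a ∧ (v' = v ∨ v' = sib v)
  surj : ∀ w, ∃ v a, next v a = w
  conn : ∀ C : Set V, C.Nonempty → (∀ v ∈ C, ∀ a, next v a ∈ C) → ∀ v, v ∈ C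

namespace BG

variable {V A : Type*} (G : BG V A)

theorem bar_ne (a : A) : G.bar a ≠ a := (G.bar_iff a _).2 rfl

theorem bar_bar (a : A) : G.bar (G.bar a) = a :=
  ((G.bar_iff (G.bar a) a).1 (G.bar_ne a).symm).symm

theorem eq_or (a b : A) : b = a ∨ b = G.bar a := by
  by_cases h : b = a
  · exact Or.inl h
  · exact Or.inr ((G.bar_iff a b).1 h)

theorem next_sib (v : V) (a : A) : G.next (G.sib v) a = G.next v a :=
  ((G.next_inj v (G.sib v) a a).2 ⟨rfl, Or.inr rfl⟩).symm

/-! ### Trees -/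

def F (r : V) (f : V → A) (x y : V) : Prop := x ≠ r ∧ y = G.next x (f x)

def Desc (r : V) (f : V → A) : V → V → Prop := Relation.ReflTransGen (G.F r f)

def Tree (r : V) (f : V → A) : Prop := ∀ x, G.Desc r f x r

theorem flip_tree [DecidableEq V] {r : V} {f : V → A} (hT : G.Tree r f) {c : V} (hc : c ≠ r) {a : A}
    (h : ¬ G.Desc r f (G.next c a) c) : G.Tree r (Function.update f c a) := by
  have key : ∀ x, G.Desc r f x r → ¬ G.Desc r f x c →
      G.Desc r (Function.update f c a) x r := by
    intro x hx
    induction hx using Relation.ReflTransGen.head_induction_on with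
    | refl => intro _; exact Relation.ReflTransGen.refl
    | head hxy hy ih =>
      rename_i x y
      intro hn
      have hxc : x ≠ c := by
        rintro rfl
        exact hn Relation.ReflTransGen.refl
      refine Relation.ReflTransGen.head ⟨hxy.1, ?_⟩ (ih fun h' => hn (Relation.ReflTransGen.head hxy h'))
      rw [Function.update_of_ne hxc]; exact hxy.2
  intro x
  have hx := hT x
  induction hx using Relation.ReflTransGen.head_induction_on with
  | refl => exact Relation.ReflTransGen.refl
  | head hxy hy ih =>
    rename_i x y
    by_cases hxc : x = c
    · subst hxc
      refine Relation.ReflTransGen.head ⟨hc, rfl⟩ ?_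
      rw [Function.update_self]
      exact key _ (hT _) h
    · refine Relation.ReflTransGen.head ⟨hxy.1, ?_⟩ ih
      rw [Function.update_of_ne hxc]; exact hxy.2

theorem exists_depth {r : V} {f : V → A} (hT : G.Tree r f) :
    ∃ d : V → ℕ, ∀ x, x ≠ r → d x = d (G.next x (f x)) + 1 := by
  classical
  let g : V → V := fun x => G.next x (f x)
  have h : ∀ x, ∃ k, g^[k] x = r := by
    intro x
    have hx := hT x
    induction hx using Relation.ReflTransGen.head_induction_on with
    | refl => exact ⟨0, rfl⟩
    | head hxy hy ih =>
      obtain ⟨k, hk⟩ := ih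
      refine ⟨k+1, ?_⟩
      rw [Function.iterate_succ_apply]
      have := hxy.2
      simp only [g] at hk ⊢
      rw [← this]; exact hk
  refine ⟨fun x => Nat.find (h x), fun x hx => ?_⟩
  exact Nat.find_comp_succ (h x) (h (g x)) hx

theorem desc_depth {r : V} {f : V → A} {d : V → ℕ}
    (hd : ∀ x, x ≠ r → d x = d (G.next x (f x)) + 1) {x y : V} (h : G.Desc r f x y) :
    x = y ∨ d y < d x := by
  induction h using Relation.ReflTransGen.head_induction_on with
  | refl => exact Or.inl rfl
  | head hxy hy ih =>
    rename_i x z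
    right
    have h1 := hd x hxy.1
    rw [← hxy.2] at h1
    rcases ih with rfl | ih <;> omega

theorem exists_flip [DecidableEq V] {r : V} {f : V → A} (hT : G.Tree r f) {v : V} (hv : v ≠ r)
    (hv' : G.sib v ≠ r) :
    ∃ c, (c = v ∨ c = G.sib v) ∧ G.Tree r (Function.update f c (G.bar (f c))) := by
  obtain ⟨d, hd⟩ := G.exists_depth hT
  suffices h : ∃ c, (c = v ∨ c = G.sib v) ∧ ¬ G.Desc r f (G.next c (G.bar (f c))) c by
    obtain ⟨c, hc, h⟩ := h
    refine ⟨c, hc, G.flip_tree hT ?_ h⟩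
    rcases hc with rfl | rfl <;> assumption
  by_contra! hcon
  have h1 := hcon v (Or.inl rfl)
  have h2 := hcon (G.sib v) (Or.inr rfl)
  rw [G.next_sib] at h2
  have e1 := hd v hv
  have e2 := hd _ hv'
  rw [G.next_sib] at e2
  have hne := G.sib_ne v
  rcases G.eq_or (f v) (f (G.sib v)) with h | h
  · rw [h] at h2 e2
    have hru : Relator.RightUnique (G.F r f) := by
      rintro a b c ⟨_, rfl⟩ ⟨_, rfl⟩; rfl
    rcases Relation.ReflTransGen.total_of_right_unique hru h1 h2 with h | h
    · rcases G.desc_depth hd h with h | h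
      · exact hne h.symm
      · omega
    · rcases G.desc_depth hd h with h | h
      · exact hne h
      · omega
  · rw [h, G.bar_bar] at h2
    rw [h] at e2
    have a1 := G.desc_depth hd h1
    have a2 := G.desc_depth hd h2
    have b1 : d v ≤ d (G.next v (G.bar (f v))) := by
      rcases a1 with a | a
      · rw [a]
      · omega
    have b2 : d (G.sib v) ≤ d (G.next v (f v)) := by
      rcases a2 with a | a
      · rw [a]
      · omega
    omega

/-! ### Degrees -/

theorem filter_fst [Fintype V] [Fintype A] [DecidableEq V] [DecidableEq A] (v : V) (a : A) :
    (Finset.univ.filter fun e : V × A => e.1 = v) = {(v, a), (v, G.bar a)} := by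
  ext ⟨x, b⟩
  have := G.eq_or a b
  simp only [Finset.mem_filter, Finset.mem_univ, true_and, Finset.mem_insert,
    Finset.mem_singleton, Prod.mk.injEq]
  tauto

theorem filter_next [Fintype V] [Fintype A] [DecidableEq V] [DecidableEq A] (v : V) (a : A) :
    (Finset.univ.filter fun e : V × A => G.next e.1 e.2 = G.next v a) =
      {(v, a), (G.sib v, a)} := by
  ext ⟨x, b⟩
  have := G.next_inj v x a b
  simp only [Finset.mem_filter, Finset.mem_univ, true_and, Finset.mem_insert,
    Finset.mem_singleton, Prod.mk.injEq]
  rw [eq_comm, this]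
  tauto

theorem card_next [Fintype V] [Fintype A] [DecidableEq V] [DecidableEq A] (w : V) :
    (Finset.univ.filter fun e : V × A => G.next e.1 e.2 = w).card = 2 := by
  obtain ⟨v, a, rfl⟩ := G.surj w
  rw [filter_next, Finset.card_pair]
  intro h
  exact G.sib_ne v (Prod.mk.inj h).1.symm

/-! ### Existence of a tree -/

section exist
variable [Fintype V] [Fintype A] [DecidableEq V] [DecidableEq A]

def Allowed (q : ℕ → V) (b : ℕ → A) (k : ℕ) (v : V) (a : A) : Prop :=
  ∀ i < k, q i = v → a = G.bar (b i)

theorem exists_allowed [Nonempty A] {q : ℕ → V} {b : ℕ → A} {k : ℕ}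
    (hinj : ∀ i < k, ∀ j < k, q i = q j → i = j) (v : V) : ∃ a, G.Allowed q b k v a := by
  by_cases h : ∃ i < k, q i = v
  · obtain ⟨i, hi, rfl⟩ := h
    refine ⟨G.bar (b i), fun j hj h => ?_⟩
    rw [hinj j hj i hi h]
  · push Not at h
    exact ⟨Classical.arbitrary A, fun i hi h' => (h i hi h').elim⟩

theorem closed_empty [Nonempty A] {q : ℕ → V} {b : ℕ → A} {k : ℕ}
    (hstep : ∀ i, q (i+1) = G.next (q i) (b i))
    (hinj : ∀ i < k, ∀ j < k, q i = q j → i = j)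
    (hsib : ∀ i < k, ∀ j < k, q i ≠ G.sib (q j))
    (C : Set V) (h0 : q 0 ∉ C)
    (hC : ∀ v ∈ C, ∀ a, G.Allowed q b k v a → G.next v a ∈ C) : ∀ v, v ∉ C := by
  classical
  obtain ⟨a0⟩ := ‹Nonempty A›
  haveI : Nonempty A := ⟨a0⟩
  have huniv : (Finset.univ : Finset A) = {a0, G.bar a0} := by
    ext x; simpa using G.eq_or a0 x
  have hsum : ∀ g : A → ℕ, ∑ a, g a = g a0 + g (G.bar a0) := by
    intro g
    rw [huniv, Finset.sum_pair (G.bar_ne a0).symm]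
  let χ : V → ℕ := fun v => if v ∈ C then 1 else 0
  have hfull : ∀ v ∈ C, (∀ i < k, q i ≠ v) → ∀ a, G.next v a ∈ C := by
    intro v hv h a
    exact hC v hv a fun i hi h' => (h i hi h').elim
  have hle : ∀ v ∈ Finset.univ, χ v + χ (G.sib v) ≤ ∑ a, χ (G.next v a) := by
    intro v _
    by_cases h1 : v ∈ C
    · by_cases h2 : G.sib v ∈ C
      · have : ∀ a, G.next v a ∈ C := by
          by_cases h3 : ∃ i < k, q i = v
          · obtain ⟨i, hi, h3⟩ := h3
            intro a
            rw [← G.next_sib]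
            refine hfull _ h2 (fun j hj h4 => ?_) a
            rw [← h3] at h4
            exact hsib j hj i hi h4
          · push Not at h3
            exact hfull v h1 h3
        rw [hsum]
        simp [χ, this, h1, h2]
      · obtain ⟨a, ha⟩ := G.exists_allowed (b := b) hinj v
        have := hC v h1 a ha
        have h5 := Finset.single_le_sum (f := fun a => χ (G.next v a)) (fun _ _ => Nat.zero_le _)
          (Finset.mem_univ a)
        simp only [χ, this, h1, h2] at h5 ⊢
        simpa using h5
    · by_cases h2 : G.sib v ∈ C
      · obtain ⟨a, ha⟩ := G.exists_allowed (b := b) hinj (G.sib v)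
        have := hC _ h2 a ha
        rw [G.next_sib] at this
        have h5 := Finset.single_le_sum (f := fun a => χ (G.next v a)) (fun _ _ => Nat.zero_le _)
          (Finset.mem_univ a)
        simp only [χ, this, h1, h2] at h5 ⊢
        simpa using h5
      · simp [χ, h1, h2]
  have htot : ∑ v, (χ v + χ (G.sib v)) = ∑ v, ∑ a, χ (G.next v a) := by
    rw [Finset.sum_add_distrib]
    have e1 : ∑ v, χ (G.sib v) = ∑ v, χ v :=
      Function.Bijective.sum_comp (Function.Involutive.bijective G.sib_sib) χ
    rw [e1, ← Fintype.sum_prod_type' (f := fun v a => χ (G.next v a)),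
      ← Finset.sum_fiberwise (s := Finset.univ) (g := fun e : V × A => G.next e.1 e.2),
      ← Finset.sum_add_distrib]
    refine Finset.sum_congr rfl fun w _ => ?_
    rw [Finset.sum_congr rfl (g := fun _ => χ w)]
    · rw [Finset.sum_const, G.card_next]; simp; ring
    · intro e he
      rw [(Finset.mem_filter.1 he).2]
  have heq := (Finset.sum_eq_sum_iff_of_le hle).1 htot
  have hq : ∀ i < k, q i ∉ C := by
    intro i
    induction i with
    | zero => intro _; exact h0
    | succ i ih =>
      intro hi
      have h1 := ih (by omega)
      have h2 := heq (q i) (Finset.mem_univ _)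
      have h3 : G.sib (q i) ∉ C := by
        intro h3
        have : ∀ a, G.next (q i) a ∈ C := by
          intro a
          rw [← G.next_sib]
          exact hfull _ h3 (fun j hj => hsib j hj i (by omega)) a
        rw [hsum] at h2
        simp [χ, h1, h3, this] at h2
      have h4 : χ (q i) + χ (G.sib (q i)) = 0 := by simp [χ, h1, h3]
      rw [h4] at h2
      have h5 := (Finset.sum_eq_zero_iff.1 h2.symm) (b i) (Finset.mem_univ _)
      rw [← hstep] at h5
      simpa [χ] using h5
  intro v hv
  refine h0 (G.conn C ⟨v, hv⟩ (fun w hw a => ?_) _)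
  refine hfull w hw (fun i hi h => ?_) a
  rw [← h] at hw
  exact hq i hi hw

def R (q : ℕ → V) (b : ℕ → A) (k : ℕ) : ℕ → V → Prop
  | 0, v => v = q 0
  | d+1, v => ∃ a, G.Allowed q b k v a ∧ R q b k d (G.next v a)

theorem exists_tree [Nonempty A] {q : ℕ → V} {b : ℕ → A} {k : ℕ}
    (hstep : ∀ i, q (i+1) = G.next (q i) (b i))
    (hinj : ∀ i < k, ∀ j < k, q i = q j → i = j)
    (hsib : ∀ i < k, ∀ j < k, q i ≠ G.sib (q j)) :
    ∃ f, G.Tree (q 0) f ∧ ∀ v, G.Allowed q b k v (f v) := by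
  classical
  have hR : ∀ v, ∃ d, G.R q b k d v := by
    have := G.closed_empty hstep hinj hsib {v | ¬ ∃ d, G.R q b k d v}
      (by simp only [Set.mem_ofPred_eq, not_not]; exact ⟨0, rfl⟩)
      (by
        intro v hv a ha hd
        obtain ⟨d, hd⟩ := hd
        exact hv ⟨d+1, a, ha, hd⟩)
    intro v
    simpa using this v
  have hf : ∀ v, ∃ a, G.Allowed q b k v a ∧
      (v ≠ q 0 → Nat.find (hR (G.next v a)) < Nat.find (hR v)) := by
    intro v
    by_cases hv : v = q 0
    · obtain ⟨a, ha⟩ := G.exists_allowed (b := b) hinj v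
      exact ⟨a, ha, fun h => (h hv).elim⟩
    · have h1 := Nat.find_spec (hR v)
      rcases hn : Nat.find (hR v) with _ | d
      · rw [hn] at h1; exact (hv h1).elim
      · rw [hn] at h1
        obtain ⟨a, ha, hd⟩ := h1
        exact ⟨a, ha, fun _ => Nat.lt_succ_of_le (Nat.find_min' _ hd)⟩
  choose f hf1 hf2 using hf
  refine ⟨f, ?_, hf1⟩
  have : ∀ n, ∀ x, Nat.find (hR x) = n → G.Desc (q 0) f x (q 0) := by
    intro n
    induction n using Nat.strong_induction_on with
    | _ n ih =>
      intro x hx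
      by_cases hv : x = q 0
      · rw [hv]; exact Relation.ReflTransGen.refl
      · exact Relation.ReflTransGen.head ⟨hv, rfl⟩ (ih _ (hx ▸ hf2 x hv) _ rfl)
  exact fun x => this _ x rfl

end exist

/-! ### The walk -/

section walk
variable [DecidableEq V] [DecidableEq A]

def letter (f : V → A) (s : V × Finset (V × A)) : A :=
  if (s.1, G.bar (f s.1)) ∈ s.2 then f s.1 else G.bar (f s.1)

def st (r : V) (f : V → A) : ℕ → V × Finset (V × A)
  | 0 => (r, ∅)
  | t+1 => (G.next (st r f t).1 (G.letter f (st r f t)),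
      insert ((st r f t).1, G.letter f (st r f t)) (st r f t).2)

def vt (r : V) (f : V → A) (t : ℕ) : V := (G.st r f t).1
def ut (r : V) (f : V → A) (t : ℕ) : Finset (V × A) := (G.st r f t).2
def lt (r : V) (f : V → A) (t : ℕ) : A := G.letter f (G.st r f t)

theorem vt_zero (r : V) (f : V → A) : G.vt r f 0 = r := rfl
theorem ut_zero (r : V) (f : V → A) : G.ut r f 0 = ∅ := rfl
theorem vt_succ (r : V) (f : V → A) (t : ℕ) :
    G.vt r f (t+1) = G.next (G.vt r f t) (G.lt r f t) := rfl
theorem ut_succ (r : V) (f : V → A) (t : ℕ) :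
    G.ut r f (t+1) = insert (G.vt r f t, G.lt r f t) (G.ut r f t) := rfl
theorem lt_eq (r : V) (f : V → A) (t : ℕ) : G.lt r f t =
    if (G.vt r f t, G.bar (f (G.vt r f t))) ∈ G.ut r f t then f (G.vt r f t)
      else G.bar (f (G.vt r f t)) := rfl

theorem mem_ut (r : V) (f : V → A) (t : ℕ) (e : V × A) :
    e ∈ G.ut r f t ↔ ∃ s < t, e = (G.vt r f s, G.lt r f s) := by
  induction t with
  | zero => simp [ut_zero]
  | succ t ih =>
    rw [ut_succ, Finset.mem_insert, ih]
    constructor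
    · rintro (h | ⟨s, hs, h⟩)
      · exact ⟨t, by omega, h⟩
      · exact ⟨s, by omega, h⟩
    · rintro ⟨s, hs, h⟩
      by_cases hst : s = t
      · subst hst; exact Or.inl h
      · exact Or.inr ⟨s, by omega, h⟩

theorem lt_first {r : V} {f : V → A} {t : ℕ} (h : ∀ s < t, G.vt r f s ≠ G.vt r f t) :
    G.lt r f t = G.bar (f (G.vt r f t)) := by
  rw [lt_eq, if_neg]
  rw [mem_ut]
  rintro ⟨s, hs, h'⟩
  exact h s hs (Prod.mk.inj h').1.symm

theorem bar_mem (r : V) (f : V → A) (t : ℕ) (v : V) (h : (v, f v) ∈ G.ut r f t) :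
    (v, G.bar (f v)) ∈ G.ut r f t := by
  induction t with
  | zero => simp [ut_zero] at h
  | succ t ih =>
    rw [ut_succ, Finset.mem_insert] at h ⊢
    rcases h with h | h
    · obtain ⟨h1, h2⟩ := Prod.mk.inj h
      subst h1
      right
      by_contra hc
      rw [lt_eq, if_neg hc] at h2
      exact G.bar_ne _ h2.symm
    · exact Or.inr (ih h)

theorem balance (r : V) (f : V → A) (T : ℕ)
    (hT : ∀ t < T, (G.vt r f t, G.lt r f t) ∉ G.ut r f t) (v : V) :
    ((G.ut r f T).filter fun e => e.1 = v).card + (if v = G.vt r f T then 1 else 0) =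
    ((G.ut r f T).filter fun e => G.next e.1 e.2 = v).card + (if v = r then 1 else 0) := by
  induction T with
  | zero =>
    simp only [ut_zero, Finset.filter_empty, Finset.card_empty]
    rfl
  | succ T ih =>
    have ih := ih fun t ht => hT t (by omega)
    have hn := hT T (by omega)
    rw [ut_succ, Finset.filter_insert, Finset.filter_insert, ← vt_succ]
    have c1 : ∀ p : V × A → Prop, ∀ [DecidablePred p], (insert (G.vt r f T, G.lt r f T)
        ((G.ut r f T).filter p)).card = ((G.ut r f T).filter p).card + 1 := by
      intro p _
      exact Finset.card_insert_of_notMem fun h => hn (Finset.mem_filter.1 h).1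
    have e1 : (G.vt r f T = v) = (v = G.vt r f T) := propext eq_comm
    have e2 : (G.vt r f (T+1) = v) = (v = G.vt r f (T+1)) := propext eq_comm
    simp only [e1, e2]
    split_ifs at ih ⊢ <;> (try simp only [c1]) <;> omega

theorem euler [Fintype V] [Fintype A] {r : V} {f : V → A} (hT : G.Tree r f) :
    (∀ t < Fintype.card (V × A), (G.vt r f t, G.lt r f t) ∉ G.ut r f t) ∧
      G.ut r f (Fintype.card (V × A)) = Finset.univ := by
  classical
  have hcard : ∀ T, (∀ t < T, (G.vt r f t, G.lt r f t) ∉ G.ut r f t) →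
      (G.ut r f T).card = T := by
    intro T
    induction T with
    | zero => intro _; rfl
    | succ T ih =>
      intro h
      rw [ut_succ, Finset.card_insert_of_notMem (h T (by omega)), ih fun t ht => h t (by omega)]
  have hex : ∃ t, (G.vt r f t, G.lt r f t) ∈ G.ut r f t := by
    by_contra! h
    have h1 := hcard (Fintype.card (V × A) + 1) fun t _ => h t
    have h2 := Finset.card_le_univ (G.ut r f (Fintype.card (V × A) + 1))
    omega
  obtain ⟨T, hTm, hmin⟩ : ∃ T, (G.vt r f T, G.lt r f T) ∈ G.ut r f T ∧
      ∀ t < T, (G.vt r f t, G.lt r f t) ∉ G.ut r f t :=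
    ⟨Nat.find hex, Nat.find_spec hex, fun t ht => Nat.find_min hex ht⟩
  have hbal := G.balance r f T hmin
  have hout : ∀ v, (v, f v) ∈ G.ut r f T →
      ((G.ut r f T).filter fun e => e.1 = v).card = 2 := by
    intro v hv
    have h2 := G.bar_mem r f T v hv
    have : ((G.ut r f T).filter fun e => e.1 = v) = {(v, f v), (v, G.bar (f v))} := by
      rw [← G.filter_fst v (f v)]
      ext ⟨x, a⟩
      simp only [Finset.mem_filter, Finset.mem_univ, true_and, and_iff_right_iff_imp]
      rintro rfl
      rcases G.eq_or (f x) a with rfl | rfl <;> assumption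
    rw [this, Finset.card_pair]
    intro h
    exact G.bar_ne _ (Prod.mk.inj h).2.symm
  have hinle : ∀ v, ((G.ut r f T).filter fun e => G.next e.1 e.2 = v).card ≤ 2 := by
    intro v
    rw [← G.card_next v]
    exact Finset.card_le_card (Finset.filter_subset_filter _ (Finset.subset_univ _))
  have hin2 : ∀ v, ((G.ut r f T).filter fun e => G.next e.1 e.2 = v).card = 2 →
      ∀ x a, G.next x a = v → (x, a) ∈ G.ut r f T := by
    intro v hv x a hx
    have : ((G.ut r f T).filter fun e => G.next e.1 e.2 = v) =
        (Finset.univ.filter fun e : V × A => G.next e.1 e.2 = v) := by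
      apply Finset.eq_of_subset_of_card_le
        (Finset.filter_subset_filter _ (Finset.subset_univ _))
      rw [hv, G.card_next]
    have h : (x, a) ∈ ((G.ut r f T).filter fun e => G.next e.1 e.2 = v) := by
      rw [this]; simpa using hx
    exact (Finset.mem_filter.1 h).1
  have hfT : (G.vt r f T, f (G.vt r f T)) ∈ G.ut r f T := by
    have h := hTm
    rw [lt_eq] at h
    split_ifs at h with h1
    · exact h
    · exact (h1 h).elim
  have hvr : G.vt r f T = r ∧
      ((G.ut r f T).filter fun e => G.next e.1 e.2 = r).card = 2 := by
    have h1 := hbal (G.vt r f T)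
    have h2 := hout _ hfT
    have h3 := hinle (G.vt r f T)
    rw [h2, if_pos rfl] at h1
    by_cases h : G.vt r f T = r
    · rw [if_pos h] at h1
      refine ⟨h, ?_⟩
      rw [h] at h1
      omega
    · rw [if_neg h] at h1
      omega
  have hall : ∀ v, ((G.ut r f T).filter fun e => G.next e.1 e.2 = v).card = 2 := by
    intro v
    have hv := hT v
    induction hv using Relation.ReflTransGen.head_induction_on with
    | refl => exact hvr.2
    | head hxy hy ih =>
      rename_i x y
      have h1 := hin2 y ih x (f x) hxy.2.symm
      have h2 := hout x h1
      have h3 := hbal x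
      rw [hvr.1, if_neg hxy.1, h2] at h3
      omega
  have huniv : G.ut r f T = Finset.univ := by
    ext ⟨x, a⟩
    simp only [Finset.mem_univ, iff_true]
    exact hin2 _ (hall _) x a rfl
  have hTc := hcard T hmin
  rw [huniv, Finset.card_univ] at hTc
  rw [hTc]
  exact ⟨hmin, huniv⟩

theorem f_inj [Fintype V] [Fintype A] {r : V} {f f' : V → A} (hT : G.Tree r f)
    (h : ∀ t < Fintype.card (V × A), G.vt r f t = G.vt r f' t ∧ G.lt r f t = G.lt r f' t) :
    f = f' := by
  classical
  funext v
  have h1 : (v, f v) ∈ G.ut r f (Fintype.card (V × A)) := by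
    rw [(G.euler hT).2]; exact Finset.mem_univ _
  rw [mem_ut] at h1
  have hex : ∃ s, s < Fintype.card (V × A) ∧ G.vt r f s = v := by
    obtain ⟨s, hs, h1⟩ := h1
    exact ⟨s, hs, (Prod.mk.inj h1).1.symm⟩
  obtain ⟨hs, hv⟩ := Nat.find_spec hex
  have hmin : ∀ t < Nat.find hex, G.vt r f t ≠ v := fun t ht h2 =>
    Nat.find_min hex ht ⟨by omega, h2⟩
  generalize Nat.find hex = s at hs hv hmin
  have e1 : G.lt r f s = G.bar (f (G.vt r f s)) := G.lt_first (by rw [hv]; exact hmin)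
  have e2 : G.lt r f' s = G.bar (f' (G.vt r f' s)) := by
    apply G.lt_first
    intro t ht
    rw [← (h t (by omega)).1, ← (h s hs).1, hv]
    exact hmin t ht
  rw [← (h s hs).1, ← (h s hs).2, e1, hv] at e2
  have := congrArg G.bar e2
  rwa [G.bar_bar, G.bar_bar] at this

end walk

end BG

/-! ### Counting -/

theorem count_blocks {V A K : Type*} [Fintype V] [Fintype A] [Fintype K] (S : Set (V → A))
    (P : K → Set V) (hdisj : ∀ k k' v, v ∈ P k → v ∈ P k' → k = k')
    (hS : S.Nonempty)
    (hflip : ∀ f ∈ S, ∀ k, ∃ f' ∈ S, f' ≠ f ∧ ∀ v, v ∉ P k → f' v = f v) :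
    2 ^ Fintype.card K ≤ Nat.card S := by
  classical
  have key : ∀ (Q : Finset K), ∀ f ∈ S,
      2 ^ Q.card ≤ ({g | g ∈ S ∧ ∀ v, (∀ k ∈ Q, v ∉ P k) → g v = f v} : Set (V → A)).ncard := by
    intro Q
    induction Q using Finset.induction_on with
    | empty =>
      intro f hf
      simp only [Finset.card_empty, pow_zero]
      rw [Nat.one_le_iff_ne_zero, ← Nat.pos_iff_ne_zero, Set.ncard_pos (Set.toFinite _)]
      exact ⟨f, hf, fun _ _ => rfl⟩
    | insert k Q hk ih =>
      intro f hf
      obtain ⟨f', hf', hne, hoff⟩ := hflip f hf k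
      have h1 := ih f hf
      have h2 := ih f' hf'
      rw [Finset.card_insert_of_notMem hk, pow_succ, mul_two]
      refine (add_le_add h1 h2).trans ?_
      rw [← Set.ncard_union_eq ?_ (Set.toFinite _) (Set.toFinite _)]
      · refine Set.ncard_le_ncard ?_ (Set.toFinite _)
        rintro g (⟨hg, h⟩ | ⟨hg, h⟩)
        · exact ⟨hg, fun v hv => h v fun k' hk' => hv k' (Finset.mem_insert_of_mem hk')⟩
        · refine ⟨hg, fun v hv => ?_⟩
          rw [h v fun k' hk' => hv k' (Finset.mem_insert_of_mem hk')]
          exact hoff v (hv k (Finset.mem_insert_self _ _))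
      · rw [Set.disjoint_left]
        rintro g ⟨_, hg⟩ ⟨_, hg'⟩
        obtain ⟨v, hv⟩ := Function.ne_iff.1 hne
        have hvk : v ∈ P k := by
          by_contra h
          exact hv (hoff v h)
        have hvQ : ∀ k' ∈ Q, v ∉ P k' := by
          intro k' hk' h
          exact hk (hdisj k k' v hvk h ▸ hk')
        exact hv ((hg' v hvQ).symm.trans (hg v hvQ))
  obtain ⟨f, hf⟩ := hS
  have := key Finset.univ f hf
  rw [Finset.card_univ] at this
  refine this.trans ?_
  rw [Nat.card_coe_set_eq]
  exact Set.ncard_le_ncard (fun g hg => hg.1) (Set.toFinite _)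

/-! ### The concrete graph -/

def dbNext {A : Type*} {n : ℕ} (v : Fin n → A) (a : A) : Fin n → A := fun i =>
  if h : (i : ℕ) + 1 < n then v ⟨i + 1, h⟩ else a

def dbG (A : Type*) (n : ℕ) (bar : A → A) (hbar : ∀ a b, b ≠ a ↔ b = bar a) :
    BG (Fin (n+1) → A) A where
  next := dbNext
  sib v := Function.update v 0 (bar (v 0))
  bar := bar
  bar_iff := hbar
  sib_ne v h := by
    have := congrFun h 0
    rw [Function.update_self] at this
    exact (hbar _ _).2 rfl this
  sib_sib v := by
    have hb : ∀ a, bar (bar a) = a := fun a =>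
      ((hbar (bar a) a).1 (Ne.symm ((hbar a _).2 rfl))).symm
    simp [hb]
  next_inj v v' a a' := by
    constructor
    · intro h
      have h1 := congrFun h (Fin.last n)
      simp only [dbNext, Fin.val_last, lt_self_iff_false, dite_false] at h1
      refine ⟨h1.symm, ?_⟩
      have h2 : ∀ i : ℕ, ∀ hi : i + 1 < n + 1, v ⟨i+1, hi⟩ = v' ⟨i+1, hi⟩ := by
        intro i hi
        have := congrFun h ⟨i, by omega⟩
        simpa [dbNext, hi] using this
      have h3 : ∀ j : Fin (n+1), j ≠ 0 → v' j = v j := by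
        rintro ⟨j, hj⟩ hj0
        rcases j with _ | j
        · exact (hj0 rfl).elim
        · exact (h2 j hj).symm
      by_cases h0 : v' 0 = v 0
      · left
        funext j
        by_cases hj : j = 0
        · rw [hj, h0]
        · exact h3 j hj
      · right
        funext j
        by_cases hj : j = 0
        · rw [hj, Function.update_self]; exact (hbar _ _).1 h0
        · rw [Function.update_of_ne hj]; exact h3 j hj
    · rintro ⟨rfl, rfl | rfl⟩
      · rfl
      · funext i
        simp only [dbNext]
        split_ifs with h
        · rw [Function.update_of_ne]
          intro h'
          have := congrArg Fin.val h'
          simp at this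
        · rfl
  surj w := by
    refine ⟨fun i => w ⟨i - 1, by omega⟩, w (Fin.last n), ?_⟩
    funext i
    simp only [dbNext]
    split_ifs with h
    · rfl
    · congr 1
      ext
      simp only [Fin.val_last]; omega
  conn C hC hcl w := by
    have : ∀ k, k ≤ n + 1 → ∃ x ∈ C, ∀ i, ∀ h : i < k, ∀ h' : n + 1 - k + i < n + 1,
        ∀ h'' : i < n + 1, x ⟨n + 1 - k + i, h'⟩ = w ⟨i, h''⟩ := by
      intro k
      induction k with
      | zero =>
        intro _
        obtain ⟨x, hx⟩ := hC
        exact ⟨x, hx, fun i h => by omega⟩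
      | succ k ih =>
        intro hk
        obtain ⟨x, hx, h⟩ := ih (by omega)
        refine ⟨_, hcl x hx (w ⟨k, by omega⟩), ?_⟩
        intro i hi h' h''
        simp only [dbNext]
        split_ifs with h3
        · rw [← h i (by omega) (by omega)]
          congr 1
          ext
          simp only
          omega
        · congr 1
          ext
          simp only
          omega
    obtain ⟨x, hx, h⟩ := this (n+1) le_rfl
    have : x = w := by
      funext i
      have := h i i.2 (by omega) i.2
      simpa using this
    rwa [← this]

section word
variable {A : Type*} [DecidableEq A] {n : ℕ} {bar : A → A}
  (hbar : ∀ a b, b ≠ a ↔ b = bar a)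

def dbSeq (r : Fin (n+1) → A) (f : (Fin (n+1) → A) → A) (t : ℕ) : A :=
  (dbG A n bar hbar).vt r f t 0

theorem vt_sq (r : Fin (n+1) → A) (f : (Fin (n+1) → A) → A) (i : ℕ) (hi : i < n + 1) (t : ℕ) :
    (dbG A n bar hbar).vt r f t ⟨i, hi⟩ = dbSeq hbar r f (t + i) := by
  induction i generalizing t with
  | zero => rfl
  | succ i ih =>
    have h := ih (by omega) (t+1)
    rw [BG.vt_succ] at h
    simp only [dbG, dbNext] at h
    rw [dif_pos hi] at h
    rw [show t + (i+1) = t + 1 + i by omega]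
    exact h

theorem lt_sq (r : Fin (n+1) → A) (f : (Fin (n+1) → A) → A) (t : ℕ) :
    (dbG A n bar hbar).lt r f t = dbSeq hbar r f (t + (n + 1)) := by
  have h := vt_sq hbar r f n (by omega) (t+1)
  rw [BG.vt_succ] at h
  rw [show t + (n+1) = t + 1 + n by omega, ← h]
  simp [dbG, dbNext]

theorem sq_deBruijn [Fintype A] (hA : Fintype.card A = 2)
    (r : Fin (n+1) → A) (f : (Fin (n+1) → A) → A) (hT : (dbG A n bar hbar).Tree r f)
    (L : ℕ) (hL : L = 2 ^ (n+2) + (n + 2) - 1) :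
    IsDeBruijnWord (n+2) L (fun i : Fin L => dbSeq hbar r f i) := by
  set G := dbG A n bar hbar with hG
  obtain ⟨h1, h2⟩ := G.euler hT
  have hc : Fintype.card ((Fin (n+1) → A) × A) = 2 ^ (n+2) := by
    rw [Fintype.card_prod, Fintype.card_fun, hA, Fintype.card_fin]; ring
  rw [hc] at h1 h2
  intro v
  let e : (Fin (n+1) → A) × A := (fun i => v i.castSucc, v (Fin.last _))
  have hiff : ∀ j, j < 2 ^ (n+2) → ((∀ (i : Fin (n+2)) (h : j + (i : ℕ) < L),
      dbSeq hbar r f (j + i) = v i) ↔ e = (G.vt r f j, G.lt r f j)) := by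
    intro j hj
    constructor
    · intro h
      refine Prod.ext ?_ ?_
      · funext i
        have := h i.castSucc (by have := i.2; simp; omega)
        have h3 := vt_sq hbar r f i i.2 j
        simp only [Fin.val_castSucc] at this
        exact this.symm.trans h3.symm
      · have := h (Fin.last _) (by simp; omega)
        have h3 := lt_sq hbar r f j
        exact this.symm.trans h3.symm
    · intro h i hi
      obtain ⟨ha, hb⟩ := Prod.mk.inj h
      rcases Fin.eq_castSucc_or_eq_last i with ⟨i, rfl⟩ | rfl
      · have := congrFun ha i
        have h3 := vt_sq hbar r f i i.2 j
        exact h3.symm.trans this.symm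
      · have h3 := lt_sq hbar r f j
        exact h3.symm.trans hb.symm
  have he : e ∈ G.ut r f (2 ^ (n+2)) := by rw [h2]; exact Finset.mem_univ _
  rw [G.mem_ut] at he
  obtain ⟨j, hj, he⟩ := he
  refine ⟨j, ⟨by omega, (hiff j hj).2 he⟩, ?_⟩
  rintro j' ⟨hj', h⟩
  have hj'' : j' < 2 ^ (n+2) := by omega
  have he' := (hiff j' hj'').1 h
  rcases lt_trichotomy j' j with hl | hl | hl
  · refine (h1 j hj ?_).elim
    rw [G.mem_ut]
    exact ⟨j', hl, he.symm.trans he'⟩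
  · exact hl
  · refine (h1 j' hj'' ?_).elim
    rw [G.mem_ut]
    exact ⟨j, hl, he'.symm.trans he⟩

end word

theorem main_aux (A : Type*) [Fintype A] (hA : Fintype.card A = 2)
    (m : ℕ) (L M : ℕ) (hL : L = 2 ^ m + m - 1) (hM : M = 2 ^ (m + 3) + (m + 3) - 1)
    (ω : Fin L → A) (hω : IsDeBruijnWord m L ω) :
    2 ^ 2 ^ m ≤ Nat.card {w : Fin M → A // IsDeBruijnWord (m+3) M w ∧
        ∀ (i : ℕ) (h1 : i < L) (h2 : i < M), w ⟨i, h2⟩ = ω ⟨i, h1⟩} := by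
  classical
  have hbarx : ∀ a : A, ∃ b, ∀ c, c ≠ a ↔ c = b := by
    intro a
    have : (Finset.univ.erase a : Finset A).card = 1 := by
      rw [Finset.card_erase_of_mem (Finset.mem_univ a), Finset.card_univ, hA]
    obtain ⟨b, hb⟩ := Finset.card_eq_one.1 this
    refine ⟨b, fun c => ?_⟩
    have := Finset.ext_iff.1 hb c
    simpa using this
  choose bar hbar using hbarx
  haveI hne : Nonempty A := Fintype.card_pos_iff.1 (by omega)
  set G := dbG A (m+1) bar hbar with hG
  let o : ℕ → A := fun i => if h : i < L then ω ⟨i, h⟩ else Classical.arbitrary A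
  have ho : ∀ i (h : i < L), o i = ω ⟨i, h⟩ := fun i h => dif_pos h
  let q : ℕ → (Fin (m+2) → A) := fun i j => o (i + j)
  let b : ℕ → A := fun i => o (i + (m+2))
  let k := L - (m+2)
  let suf : (Fin (m+2) → A) → (Fin m → A) := fun v i => v ⟨i + 2, by omega⟩
  have hsuf : ∀ i < k, ∀ j < k, suf (q i) = suf (q j) → i = j := by
    intro i hi j hj h
    obtain ⟨p, _, hp⟩ := hω (suf (q i))
    have e1 := hp (i+2) ⟨by omega, fun s hs => by
      rw [← ho]
      show o (i + 2 + s) = o (i + (s + 2))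
      congr 1; omega⟩
    have e2 := hp (j+2) ⟨by omega, fun s hs => by
      rw [h, ← ho]
      show o (j + 2 + s) = o (j + (s + 2))
      congr 1; omega⟩
    omega
  have hstep : ∀ i, q (i+1) = G.next (q i) (b i) := by
    intro i
    funext j
    show o (i + 1 + j) = dbNext (q i) (b i) j
    simp only [dbNext]
    split_ifs with h
    · show _ = o (i + (j + 1))
      congr 1; omega
    · show _ = o (i + (m+2))
      congr 1; omega
  have hinj : ∀ i < k, ∀ j < k, q i = q j → i = j := fun i hi j hj h =>
    hsuf i hi j hj (by rw [h])
  have sib_of_ne : ∀ v, ∀ j, j ≠ 0 → G.sib v j = v j := by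
    intro v j hj
    exact Function.update_of_ne hj _ _
  have suf_sib : ∀ v, suf (G.sib v) = suf v := by
    intro v
    funext i
    refine sib_of_ne _ _ ?_
    intro h
    have := congrArg Fin.val h
    simp at this
  have hsib : ∀ i < k, ∀ j < k, q i ≠ G.sib (q j) := by
    intro i hi j hj h
    have := hsuf i hi j hj (by rw [h, suf_sib])
    subst this
    exact G.sib_ne _ h.symm
  let S : Set ((Fin (m+2) → A) → A) := {f | G.Tree (q 0) f ∧ ∀ v, G.Allowed q b k v (f v)}
  have hSne : S.Nonempty := G.exists_tree hstep hinj hsib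
  have hc : ∀ u : Fin m → A, ∃ c, ∀ i, (i < k ∨ i = 0) → suf (q i) = u → q i 1 ≠ c := by
    intro u
    by_cases h : ∃ i, (i < k ∨ i = 0) ∧ suf (q i) = u
    · obtain ⟨i, hi, h⟩ := h
      refine ⟨bar (q i 1), fun j hj h' => ?_⟩
      have : j = i := by
        by_cases hk : k = 0
        · omega
        · exact hsuf j (by omega) i (by omega) (h'.trans h.symm)
      rw [this]
      exact (G.bar_ne (q i 1)).symm
    · push Not at h
      exact ⟨Classical.arbitrary A, fun i hi h' => (h i hi h').elim⟩
  choose c hc using hc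
  let P : (Fin m → A) → Set (Fin (m+2) → A) := fun u => {v | suf v = u ∧ v 1 = c u}
  have hcount : 2 ^ Fintype.card (Fin m → A) ≤ Nat.card S := by
    refine count_blocks S P (fun k k' v h h' => h.1.symm.trans h'.1) hSne ?_
    rintro f ⟨hT, hal⟩ u
    have hPq : ∀ v ∈ P u, ∀ i, (i < k ∨ i = 0) → q i ≠ v := by
      rintro v ⟨h1, h2⟩ i hi rfl
      exact hc u i hi h1 h2
    obtain ⟨v, hv⟩ : ∃ v, v ∈ P u := by
      refine ⟨fun j => if h : 2 ≤ (j : ℕ) then u ⟨j - 2, by omega⟩ else c u, ?_, ?_⟩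
      · funext i
        simp [suf]
      · simp
    have hv' : G.sib v ∈ P u :=
      ⟨(suf_sib v).trans hv.1, (sib_of_ne v 1 (by simp)).trans hv.2⟩
    obtain ⟨x, hx, hTx⟩ := G.exists_flip hT (hPq v hv 0 (Or.inr rfl)).symm
      (hPq _ hv' 0 (Or.inr rfl)).symm
    have hxP : x ∈ P u := by rcases hx with rfl | rfl <;> assumption
    refine ⟨_, ⟨hTx, ?_⟩, ?_, ?_⟩
    · intro y
      by_cases hy : y = x
      · subst hy
        intro i hi h
        exact (hPq _ hxP i (Or.inl hi) h).elim
      · rw [Function.update_of_ne hy]; exact hal y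
    · intro h
      have := congrFun h x
      rw [Function.update_self] at this
      exact G.bar_ne _ this
    · intro y hy
      rw [Function.update_of_ne]
      rintro rfl
      exact hy hxP
  rw [Fintype.card_fun, hA, Fintype.card_fin] at hcount
  refine hcount.trans ?_
  have hpre : ∀ f ∈ S, ∀ t, t ≤ k → G.vt (q 0) f t = q t ∧ (t < k → G.lt (q 0) f t = b t) := by
    rintro f ⟨hT, hal⟩ t
    induction t using Nat.strong_induction_on with
    | _ t ih =>
      intro ht
      have h1 : G.vt (q 0) f t = q t := by
        rcases t with _ | t
        · rfl
        · rw [G.vt_succ, (ih t (by omega) (by omega)).1, (ih t (by omega) (by omega)).2 (by omega),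
            hstep]
      refine ⟨h1, fun htk => ?_⟩
      rw [G.lt_first, h1, hal (q t) t htk rfl, G.bar_bar]
      intro s hs
      rw [(ih s hs (by omega)).1, h1]
      intro h
      have := hinj s (by omega) t htk h
      omega
  have hprefix : ∀ f ∈ S, ∀ i < L, dbSeq hbar (q 0) f i = o i := by
    intro f hf i hi
    by_cases hik : i < m + 2
    · have := vt_sq hbar (q 0) f i hik 0
      rw [BG.vt_zero] at this
      rw [Nat.zero_add] at this
      rw [← this]
      show o (0 + i) = o i
      rw [Nat.zero_add]
    · have h1 := (hpre f hf (i - (m+2)) (by omega)).2 (by omega)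
      have h2 := lt_sq hbar (q 0) f (i - (m+2))
      have h3 : i - (m+2) + (m+2) = i := by omega
      rw [show i - (m+2) + (m+1+1) = i by omega] at h2
      rw [← h2]
      refine h1.trans ?_
      show o (i - (m+2) + (m+2)) = o i
      rw [h3]
  refine Nat.card_le_card_of_injective (fun f : S => ⟨fun i => dbSeq hbar (q 0) f.1 i,
    sq_deBruijn hbar hA (q 0) f.1 f.2.1 M hM, fun i h1 h2 =>
      (hprefix f.1 f.2 i h1).trans (ho i h1)⟩) ?_
  rintro ⟨f, hf⟩ ⟨f', hf'⟩ h
  have h := congrArg Subtype.val h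
  simp only at h
  have hs : ∀ i < M, dbSeq hbar (q 0) f i = dbSeq hbar (q 0) f' i := fun i hi => congrFun h ⟨i, hi⟩
  have hcd : Fintype.card ((Fin (m+2) → A) × A) = 2 ^ (m+3) := by
    rw [Fintype.card_prod, Fintype.card_fun, hA, Fintype.card_fin]; ring
  refine Subtype.ext (G.f_inj hf.1 ?_)
  intro t ht
  have ht' : t < 2 ^ (m+3) := by rw [← hcd]; exact ht
  constructor
  · funext i
    have a1 := vt_sq hbar (q 0) f i i.2 t
    have a2 := vt_sq hbar (q 0) f' i i.2 t
    exact a1.trans ((hs _ (by have := i.2; omega)).trans a2.symm)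
  · have a1 := lt_sq hbar (q 0) f t
    have a2 := lt_sq hbar (q 0) f' t
    exact a1.trans ((hs _ (by omega)).trans a2.symm)

/-- If `#A = 2`, `n ≥ 3` and `ω` is a de Bruijn sequence of order `n − 2` in `A`, then
the number of de Bruijn sequences of order `n + 1` in `A` that have `ω` as an initial
segment is at least `2^(2^(n−2))`. -/
theorem statement8 (A : Type*) [Fintype A] (hA : Fintype.card A = 2)
    (n : ℕ) (hn : 3 ≤ n)
    (ω : Fin (2 ^ (n - 2) + (n - 2) - 1) → A)
    (hω : IsDeBruijnWord (n - 2) (2 ^ (n - 2) + (n - 2) - 1) ω) :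
    2 ^ 2 ^ (n - 2) ≤
      Nat.card {w : Fin (2 ^ (n + 1) + (n + 1) - 1) → A //
        IsDeBruijnWord (n + 1) (2 ^ (n + 1) + (n + 1) - 1) w ∧
        ∀ (i : ℕ) (h1 : i < 2 ^ (n - 2) + (n - 2) - 1)
          (h2 : i < 2 ^ (n + 1) + (n + 1) - 1), w ⟨i, h2⟩ = ω ⟨i, h1⟩} := by
  obtain ⟨m, rfl⟩ : ∃ m, n = m + 2 := ⟨n - 2, by omega⟩
  exact main_aux A hA m _ _ rfl rfl ω hω
end

section
/- Let A be an alphabet with #A = 3 and n ≥ 2. If ω is a de Bruijn sequence of order n − 1 in A, then the number of de Bruijn sequences of order n + 1 in A that have ω as an initial segment is at least 4^{3^{n−1}}. -/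
/-- the rotor walk -/
def rotorState {V A : Type*} [DecidableEq V] (f : V → A → V) (σ : V → ℕ → A) (r : V) :
    ℕ → V × (V → ℕ)
  | 0 => (r, fun _ => 0)
  | t + 1 =>
    let s := rotorState f σ r t
    (f s.1 (σ s.1 (s.2 s.1)), Function.update s.2 s.1 (s.2 s.1 + 1))

theorem rotor_exists {V A : Type*} [DecidableEq V] (f : V → A → V) (σ : V → ℕ → A) (r : V) :
    ∃ (x : ℕ → V) (a : ℕ → A), x 0 = r ∧ (∀ t, x (t + 1) = f (x t) (a t)) ∧
      ∀ t, a t = σ (x t) (Nat.count (fun s => x s = x t) t) := by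
  have key : ∀ t v, (rotorState f σ r t).2 v =
      Nat.count (fun s => (rotorState f σ r s).1 = v) t := by
    intro t
    induction t with
    | zero => intro v; simp [rotorState]
    | succ t ih =>
      intro v
      rw [Nat.count_succ, ← ih v]
      simp only [rotorState]
      by_cases h : (rotorState f σ r t).1 = v
      · subst h; simp
      · rw [Function.update_of_ne (fun h' => h h'.symm)]; simp [h]
  refine ⟨fun t => (rotorState f σ r t).1,
    fun t => σ (rotorState f σ r t).1 ((rotorState f σ r t).2 (rotorState f σ r t).1),
    rfl, fun t => rfl, fun t => ?_⟩
  simp only [key]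

theorem count_ivt (p : ℕ → Prop) [DecidablePred p] (j T : ℕ) (h : j < Nat.count p T) :
    ∃ t < T, p t ∧ Nat.count p t = j := by
  induction T with
  | zero => simp at h
  | succ T ih =>
    rw [Nat.count_succ] at h
    by_cases hj : j < Nat.count p T
    · obtain ⟨t, ht, h'⟩ := ih hj
      exact ⟨t, by omega, h'⟩
    · by_cases hp : p T
      · simp [hp] at h
        exact ⟨T, by omega, hp, by omega⟩
      · simp [hp] at h; omega

theorem count_lt_of_lt (p : ℕ → Prop) [DecidablePred p] {s t : ℕ} (h : s < t) (hs : p s) :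
    Nat.count p s < Nat.count p t := by
  have h1 : Nat.count p (s + 1) ≤ Nat.count p t := Nat.count_monotone p h
  rw [Nat.count_succ] at h1
  simp [hs] at h1; omega

theorem sum_count {V : Type*} [Fintype V] [DecidableEq V] (x : ℕ → V) (t : ℕ) :
    ∑ v, Nat.count (fun s => x s = v) t = t := by
  induction t with
  | zero => simp
  | succ t ih => simp [Nat.count_succ, Finset.sum_add_distrib, ih]

theorem rotor_inj {V A : Type*} [DecidableEq V] (σ : V → ℕ → A)
    (hσ : ∀ v i j, i < 3 → j < 3 → σ v i = σ v j → i = j)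
    (x : ℕ → V) (a : ℕ → A)
    (ha : ∀ t, a t = σ (x t) (Nat.count (fun s => x s = x t) t)) (T : ℕ)
    (hT : ∀ v, Nat.count (fun s => x s = v) T ≤ 3) {s t : ℕ} (hs : s < T) (ht : t < T)
    (hx : x s = x t) (hat : a s = a t) : s = t := by
  have h1 := count_lt_of_lt (fun s => x s = x t) hs hx
  have h2 := count_lt_of_lt (fun s => x s = x t) ht rfl
  have h3 := hT (x t)
  rw [ha s, ha t, hx] at hat
  have h4 := hσ _ _ _ (by omega) (by omega) hat
  rcases lt_trichotomy s t with h | h | h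
  · have := count_lt_of_lt (fun s => x s = x t) h hx
    omega
  · exact h
  · have := count_lt_of_lt (fun s => x s = x t) h rfl
    omega

theorem rotor_euler {V A : Type*} [Fintype V] [DecidableEq V] [Fintype A] [DecidableEq A]
    (f : V → A → V) (σ : V → ℕ → A)
    (hσ : ∀ v i j, i < 3 → j < 3 → σ v i = σ v j → i = j) (r : V)
    (hin : ∀ v, (Finset.univ.filter (fun p : V × A => f p.1 p.2 = v)).card ≤ 3)
    (d : V → ℕ) (hd : ∀ u, u ≠ r → d (f u (σ u 2)) < d u)
    (x : ℕ → V) (a : ℕ → A) (hx0 : x 0 = r) (hx : ∀ t, x (t + 1) = f (x t) (a t))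
    (ha : ∀ t, a t = σ (x t) (Nat.count (fun s => x s = x t) t)) :
    ∀ v, Nat.count (fun s => x s = v) (3 * Fintype.card V) = 3 := by
  classical
  have hex : ∃ t, ¬ ∀ v, Nat.count (fun s => x s = v) t ≤ 3 := by
    refine ⟨3 * Fintype.card V + 1, fun h => ?_⟩
    have h1 := sum_count x (3 * Fintype.card V + 1)
    have h2 := Finset.sum_le_sum (fun v (_ : v ∈ Finset.univ) => h v)
    simp only [Finset.sum_const, Finset.card_univ, smul_eq_mul] at h2
    omega
  obtain ⟨T, hgood, hbad⟩ : ∃ T, (∀ v, Nat.count (fun s => x s = v) T ≤ 3) ∧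
      ¬ ∀ v, Nat.count (fun s => x s = v) (T + 1) ≤ 3 := by
    have h1 := Nat.find_spec hex
    have h2 : Nat.find hex ≠ 0 := by
      intro h; rw [h] at h1; simp at h1
    obtain ⟨T, hT⟩ := Nat.exists_eq_succ_of_ne_zero h2
    refine ⟨T, ?_, ?_⟩
    · have := Nat.find_min hex (m := T) (by omega)
      exact not_not.mp this
    · rw [hT] at h1; exact h1
  have hfull : Nat.count (fun s => x s = x T) T = 3 := by
    push Not at hbad
    obtain ⟨v, hv⟩ := hbad
    rw [Nat.count_succ] at hv
    have := hgood v
    by_cases h : x T = v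
    · subst h; simp at hv; omega
    · simp [h] at hv; omega
  have hent : ∀ v, Nat.count (fun s => x (s + 1) = v) T + (if r = v then 1 else 0) =
      Nat.count (fun s => x s = v) T + (if x T = v then 1 else 0) := by
    intro v
    rw [← hx0, ← Nat.count_succ' (p := fun s => x s = v), ← Nat.count_succ (p := fun s => x s = v)]
  have hsub : ∀ v, ((Finset.range T).filter (fun s => x (s + 1) = v)).image
      (fun s => (x s, a s)) ⊆ Finset.univ.filter (fun p : V × A => f p.1 p.2 = v) := by
    intro v p hp
    simp only [Finset.mem_image, Finset.mem_filter, Finset.mem_range] at hp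
    obtain ⟨s, ⟨_, hs⟩, rfl⟩ := hp
    simp [← hx, hs]
  have hcard : ∀ v, (((Finset.range T).filter (fun s => x (s + 1) = v)).image
      (fun s => (x s, a s))).card = Nat.count (fun s => x (s + 1) = v) T := by
    intro v
    rw [Nat.count_eq_card_filter_range, Finset.card_image_of_injOn]
    intro s hs t ht hst
    simp only [Finset.coe_filter, Finset.mem_range, Set.mem_ofPred_eq] at hs ht
    simp only [Prod.mk.injEq] at hst
    exact rotor_inj σ hσ x a ha T hgood hs.1 ht.1 hst.1 hst.2
  have hxT : x T = r := by
    by_contra h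
    have h1 := hent (x T)
    have h2 := Finset.card_le_card (hsub (x T))
    have h3 := hin (x T)
    rw [hcard] at h2
    rw [if_neg (fun h' => h h'.symm), if_pos rfl] at h1
    omega
  have hent' : ∀ v, Nat.count (fun s => x (s + 1) = v) T = Nat.count (fun s => x s = v) T := by
    intro v
    have := hent v
    rw [hxT] at this
    omega
  have hall : ∀ m v, d v ≤ m → Nat.count (fun s => x s = v) T = 3 := by
    intro m
    induction m with
    | zero =>
      intro v hv
      by_cases h : v = r
      · rw [h, ← hxT]; exact hfull
      · have := hd v h; omega
    | succ m ih =>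
      intro v hv
      by_cases h : v = r
      · rw [h, ← hxT]; exact hfull
      · have h1 := hd v h
        have h2 := ih (f v (σ v 2)) (by omega)
        rw [← hent', ← hcard] at h2
        have h3 := Finset.eq_of_subset_of_card_le (hsub (f v (σ v 2))) (by rw [h2]; exact hin _)
        have h4 : (v, σ v 2) ∈ Finset.univ.filter
            (fun p : V × A => f p.1 p.2 = f v (σ v 2)) := by simp
        rw [← h3] at h4
        simp only [Finset.mem_image, Finset.mem_filter, Finset.mem_range, Prod.mk.injEq] at h4
        obtain ⟨s, ⟨hs, _⟩, hxs, has⟩ := h4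
        have h5 := count_lt_of_lt (fun s => x s = v) hs hxs
        have h6 := hgood v
        rw [ha s, hxs] at has
        have h7 := hσ v _ _ (by omega) (by norm_num) has
        omega
  have hTN : T = 3 * Fintype.card V := by
    have h1 := sum_count x T
    rw [Finset.sum_congr rfl (fun v _ => hall _ v le_rfl)] at h1
    simp at h1; omega
  intro v
  rw [← hTN]; exact hall _ v le_rfl

/-- block inequality -/
theorem block_card {A : Type*} [Fintype A] [DecidableEq A] (hA : Fintype.card A = 3)
    (P Q : Finset A) (bad : A → A → Prop)
    (hbad : ∀ a b a' b', bad a b → bad a' b' → a = a' ∧ b = b')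
    (h : ∀ a b, b ∈ Q → ¬ bad a b → a ∈ P) :
    Q.card ≤ P.card ∧ (Q.card = P.card → ∀ a b, b ∈ Q ↔ a ∈ P) := by
  have hQ3 : Q.card ≤ 3 := hA ▸ Finset.card_le_univ Q
  rcases Nat.lt_or_ge 1 Q.card with h1 | h1
  · obtain ⟨b, hb, b', hb', hne⟩ := Finset.one_lt_card.mp h1
    have hP : P = Finset.univ := by
      ext a
      simp only [Finset.mem_univ, iff_true]
      by_cases hab : bad a b
      · by_cases hab' : bad a b'
        · exact absurd (hbad _ _ _ _ hab hab').2 hne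
        · exact h a b' hb' hab'
      · exact h a b hb hab
    rw [hP, Finset.card_univ, hA]
    refine ⟨hQ3, fun h3 => ?_⟩
    have : Q = Finset.univ := by
      apply Finset.eq_univ_of_card; rw [h3, hA]
    simp [this]
  · rcases Nat.eq_zero_or_pos Q.card with h0 | h0
    · rw [h0]
      refine ⟨Nat.zero_le _, fun h3 => ?_⟩
      have hP := Finset.card_eq_zero.mp h3.symm
      have hQ := Finset.card_eq_zero.mp h0
      simp [hP, hQ]
    · have hQ1 : Q.card = 1 := by omega
      obtain ⟨b, hb⟩ := Finset.card_pos.mp h0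
      have : 2 ≤ P.card := by
        by_cases hex : ∃ a, bad a b
        · obtain ⟨a, hab⟩ := hex
          have hs : Finset.univ.erase a ⊆ P := by
            intro a' ha'
            refine h a' b hb (fun hb' => ?_)
            exact (Finset.mem_erase.mp ha').1 (hbad _ _ _ _ hb' hab).1
          have := Finset.card_le_card hs
          rw [Finset.card_erase_of_mem (Finset.mem_univ _), Finset.card_univ, hA] at this
          exact this
        · push Not at hex
          have hs : Finset.univ ⊆ P := fun a _ => h a b hb (hex a)
          have := Finset.card_le_card hs
          rw [Finset.card_univ, hA] at this
          omega
      exact ⟨by omega, fun h3 => by omega⟩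

/-- shift -/
def shiftF {A : Type*} {k : ℕ} (v : Fin (k + 1) → A) (b : A) : Fin (k + 1) → A :=
  Fin.snoc (α := fun _ => A) (Fin.tail v) b

theorem shiftF_lt {A : Type*} {k : ℕ} (v : Fin (k + 1) → A) (b : A) (i : ℕ) (h : i < k) :
    shiftF v b ⟨i, by omega⟩ = v ⟨i + 1, by omega⟩ := by
  simp [shiftF, Fin.snoc, h, Fin.tail]

theorem shiftF_last {A : Type*} {k : ℕ} (v : Fin (k + 1) → A) (b : A) :
    shiftF v b ⟨k, by omega⟩ = b := by
  simp [shiftF, Fin.snoc]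

theorem card_pair {A : Type*} [Fintype A] [DecidableEq A] {k : ℕ}
    (S : Finset (Fin (k + 1) → A)) :
    (∑ w : Fin k → A, (Finset.univ.filter (fun a => (Fin.cons a w : Fin (k + 1) → A) ∈ S)).card
      = S.card) ∧
    (∑ w : Fin k → A, (Finset.univ.filter
      (fun b => (Fin.snoc (α := fun _ => A) w b : Fin (k + 1) → A) ∈ S)).card = S.card) := by
  constructor
  · rw [Finset.card_eq_sum_card_fiberwise (f := fun v : Fin (k + 1) → A => (Fin.tail v : Fin k → A))
      (t := Finset.univ) (by simp)]
    refine Finset.sum_congr rfl fun w _ => ?_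
    refine Finset.card_bij (fun a _ => (Fin.cons a w : Fin (k + 1) → A)) ?_ ?_ ?_
    · intro a ha; simpa using ha
    · intro a _ b _ hab; simpa using congrFun hab 0
    · intro v hv
      simp only [Finset.mem_filter] at hv
      refine ⟨v 0, ?_, ?_⟩
      · rw [← hv.2]; simpa using hv.1
      · rw [← hv.2]; simp
  · rw [Finset.card_eq_sum_card_fiberwise (f := fun v : Fin (k + 1) → A => (Fin.init v : Fin k → A))
      (t := Finset.univ) (by simp)]
    refine Finset.sum_congr rfl fun w _ => ?_
    refine Finset.card_bij (fun a _ => (Fin.snoc (α := fun _ => A) w a : Fin (k + 1) → A)) ?_ ?_ ?_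
    · intro a ha; simpa using ha
    · intro a _ b _ hab; simpa using congrFun hab (Fin.last k)
    · intro v hv
      simp only [Finset.mem_filter] at hv
      refine ⟨v (Fin.last k), ?_, ?_⟩
      · rw [← hv.2]; simpa using hv.1
      · rw [← hv.2]; simp

theorem connected_aux {A : Type*} [Fintype A] [DecidableEq A] (hA : Fintype.card A = 3) {k : ℕ}
    (bad : (Fin (k + 1) → A) → A → Prop)
    (hbad : ∀ u b u' b', Fin.tail u = Fin.tail u' → bad u b → bad u' b' → u = u' ∧ b = b')
    (S : Finset (Fin (k + 1) → A)) (r : Fin (k + 1) → A) (hr : r ∈ S)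
    (hS : ∀ u b, ¬ bad u b → shiftF u b ∈ S → u ∈ S) : ∀ v, v ∈ S := by
  have hblock : ∀ w : Fin k → A, _ := fun w => block_card hA
    (Finset.univ.filter (fun a => (Fin.cons a w : Fin (k + 1) → A) ∈ S))
    (Finset.univ.filter (fun b => (Fin.snoc (α := fun _ => A) w b : Fin (k + 1) → A) ∈ S))
    (fun a b => bad (Fin.cons a w) b)
    (by
      intro a b a' b' h h'
      have := hbad _ _ _ _ (by simp) h h'
      exact ⟨by simpa using congrFun this.1 0, this.2⟩)
    (by
      intro a b hb hab
      simp only [Finset.mem_filter, Finset.mem_univ, true_and] at hb ⊢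
      exact hS _ b hab (by simpa [shiftF] using hb))
  have heq := (Finset.sum_eq_sum_iff_of_le (fun w _ => (hblock w).1)).mp
    ((card_pair S).2.trans (card_pair S).1.symm)
  have hstep : ∀ v b, shiftF v b ∈ S ↔ v ∈ S := by
    intro v b
    have := (hblock (Fin.tail v)).2 (heq _ (Finset.mem_univ _)) (v 0) b
    simpa [shiftF] using this
  intro v
  let g : ℕ → Fin (k + 1) → A := fun t i =>
    if h : (i : ℕ) + t < k + 1 then v ⟨i + t, h⟩ else
      if h2 : (i : ℕ) + t - (k + 1) < k + 1 then r ⟨(i : ℕ) + t - (k + 1), h2⟩ else v i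
  have hg0 : g 0 = v := by
    funext i
    have hi : (i : ℕ) + 0 < k + 1 := by omega
    simp only [g, dif_pos hi]
    rfl
  have hgn : g (k + 1) = r := by
    funext i
    have hi : ¬ (i : ℕ) + (k + 1) < k + 1 := by omega
    have hi2 : (i : ℕ) + (k + 1) - (k + 1) < k + 1 := by omega
    simp only [g, dif_neg hi, dif_pos hi2]
    congr 1
    ext
    simp
  have hgs : ∀ t (ht : t < k + 1), g (t + 1) = shiftF (g t) (r ⟨t, ht⟩) := by
    intro t ht
    funext ⟨i, hi⟩
    by_cases h : i < k
    · rw [shiftF_lt _ _ i h]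
      simp only [g]
      have : i + (t + 1) = i + 1 + t := by ring
      simp only [this]
      split_ifs
      · rfl
      · rfl
      · omega
    · have : i = k := by omega
      subst this
      rw [shiftF_last]
      simp only [g]
      have : i + (t + 1) - (i + 1) = t := by omega
      simp [this, ht]
  have hmem : ∀ t, t ≤ k + 1 → (g t ∈ S ↔ v ∈ S) := by
    intro t
    induction t with
    | zero => intro _; rw [hg0]
    | succ t ih =>
      intro ht
      rw [hgs t (by omega), hstep, ih (by omega)]
  rw [← hmem (k + 1) le_rfl, hgn]
  exact hr

/-- reach in m steps -/
def ReachIn {V A : Type*} (f : V → A → V) (ok : V → A → Prop) (r : V) : ℕ → V → Prop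
  | 0, u => u = r
  | m + 1, u => ∃ a, ok u a ∧ ReachIn f ok r m (f u a)

theorem exists_tree {A : Type*} [Fintype A] [DecidableEq A] (hA : Fintype.card A = 3) {k : ℕ}
    (bad : (Fin (k + 1) → A) → A → Prop)
    (hbad : ∀ u b u' b', Fin.tail u = Fin.tail u' → bad u b → bad u' b' → u = u' ∧ b = b')
    (r : Fin (k + 1) → A) :
    ∃ d : (Fin (k + 1) → A) → ℕ, ∀ u, u ≠ r → ∃ a, ¬ bad u a ∧ d (shiftF u a) < d u := by
  classical
  have hall : ∀ u, ∃ m, ReachIn shiftF (fun u a => ¬ bad u a) r m u := by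
    have := connected_aux hA bad hbad
      (Finset.univ.filter (fun u => ∃ m, ReachIn shiftF (fun u a => ¬ bad u a) r m u)) r
      (by simpa using ⟨0, rfl⟩)
      (by
        intro u b hub h
        simp only [Finset.mem_filter, Finset.mem_univ, true_and] at h ⊢
        obtain ⟨m, hm⟩ := h
        exact ⟨m + 1, b, hub, hm⟩)
    intro u; simpa using this u
  refine ⟨fun u => Nat.find (hall u), fun u hu => ?_⟩
  have h1 := Nat.find_spec (hall u)
  obtain ⟨m, hm⟩ : ∃ m, Nat.find (hall u) = m + 1 := by
    rcases h : Nat.find (hall u) with _ | m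
    · rw [h] at h1; exact absurd h1 hu
    · exact ⟨m, rfl⟩
  rw [hm] at h1
  obtain ⟨a, ha, h2⟩ := h1
  refine ⟨a, ha, ?_⟩
  have := Nat.find_min' (hall (shiftF u a)) h2
  simp only [hm]; omega

theorem shiftF_indeg {A : Type*} [Fintype A] [DecidableEq A] (hA : Fintype.card A = 3) {k : ℕ}
    (v : Fin (k + 1) → A) :
    (Finset.univ.filter (fun p : (Fin (k + 1) → A) × A => shiftF p.1 p.2 = v)).card ≤ 3 := by
  rw [← hA, ← Finset.card_univ]
  refine Finset.card_le_card_of_injOn (fun p => p.1 0) (by simp) ?_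
  rintro ⟨u, a⟩ hu ⟨u', a'⟩ hu' h
  simp only [Finset.coe_filter, Finset.mem_univ, true_and, Set.mem_ofPred_eq] at hu hu' h
  rw [← hu'] at hu
  have h1 := Fin.snoc_injective2 hu
  have : u = u' := by
    rw [← Fin.cons_self_tail u, ← Fin.cons_self_tail u', h, h1.1]
  rw [this, h1.2]

theorem exists_third {A : Type*} [Fintype A] [DecidableEq A] (hA : Fintype.card A = 3) (a b : A) :
    ∃ c, c ≠ a ∧ c ≠ b := by
  by_contra h
  push Not at h
  have hs : (Finset.univ : Finset A) ⊆ {a, b} := by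
    intro c _
    by_cases hc : c = a
    · simp [hc]
    · simp [h c hc]
  have h1 := Finset.card_le_card hs
  have h2 : ({a, b} : Finset A).card ≤ 2 := Finset.card_le_two
  rw [Finset.card_univ, hA] at h1
  omega

/-- the exit order at a vertex -/
def exitOrder {A : Type*} (p q τ : A) (b : Bool) (j : ℕ) : A :=
  if j = 0 then (if b then q else p) else if j = 1 then (if b then p else q) else τ

theorem exitOrder_inj {A : Type*} {p q τ : A} (h1 : p ≠ q) (h2 : p ≠ τ) (h3 : q ≠ τ) (b : Bool)
    (i j : ℕ) (hi : i < 3) (hj : j < 3) (h : exitOrder p q τ b i = exitOrder p q τ b j) :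
    i = j := by
  have := h1.symm
  have := h2.symm
  have := h3.symm
  interval_cases i <;> interval_cases j <;> cases b <;> simp_all [exitOrder]

theorem exitOrder_zero_inj {A : Type*} {p q τ : A} (h1 : p ≠ q) {b b' : Bool}
    (h : exitOrder p q τ b 0 = exitOrder p q τ b' 0) : b = b' := by
  have := h1.symm
  cases b <;> cases b' <;> simp_all [exitOrder]

theorem walk_letters {A : Type*} {k : ℕ} (x : ℕ → Fin (k + 1) → A) (a : ℕ → A)
    (hx : ∀ t, x (t + 1) = shiftF (x t) (a t)) (i : ℕ) :
    ∀ (t : ℕ) (h : i < k + 1), x t ⟨i, h⟩ = x (t + i) 0 := by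
  induction i with
  | zero => intro t h; rfl
  | succ i ih =>
    intro t h
    rw [← shiftF_lt (x t) (a t) i (by omega), ← hx, ih,
      show t + 1 + i = t + (i + 1) by ring]

theorem walk_exit {A : Type*} {k : ℕ} (x : ℕ → Fin (k + 1) → A) (a : ℕ → A)
    (hx : ∀ t, x (t + 1) = shiftF (x t) (a t)) (t : ℕ) : a t = x (t + (k + 1)) 0 := by
  have := walk_letters x a hx k (t + 1) (by omega)
  rw [hx, shiftF_last] at this
  rw [this, show t + 1 + k = t + (k + 1) by ring]

set_option maxHeartbeats 1000000 in
theorem main_count (A : Type*) [Fintype A] (hA : Fintype.card A = 3) (k : ℕ) (hk : 1 ≤ k)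
    (L : ℕ) (hL : L = 3 ^ k + k - 1) (ω : Fin L → A) (hω : IsDeBruijnWord k L ω)
    (M : ℕ) (hM : M = 3 ^ (k + 2) + (k + 2) - 1) :
    4 ^ 3 ^ k ≤ Nat.card {w : Fin M → A // IsDeBruijnWord (k + 2) M w ∧
      ∀ (i : ℕ) (h1 : i < L) (h2 : i < M), w ⟨i, h2⟩ = ω ⟨i, h1⟩} := by
  classical
  have h3k : 3 ≤ 3 ^ k := by
    calc 3 = 3 ^ 1 := by norm_num
      _ ≤ 3 ^ k := Nat.pow_le_pow_right (by norm_num) hk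
  obtain ⟨m, hm⟩ : ∃ m, 3 ^ k = m + 2 := ⟨3 ^ k - 2, by omega⟩
  have hLm : L = k + 1 + m := by omega
  have hA0 : Nonempty A := Fintype.card_pos_iff.mp (by omega)
  obtain ⟨a0⟩ := hA0
  let ωn : ℕ → A := fun i => if h : i < L then ω ⟨i, h⟩ else a0
  have hωn : ∀ i (h : i < L), ωn i = ω ⟨i, h⟩ := fun i h => by simp [ωn, h]
  have huniq : ∀ i i', i + k ≤ L → i' + k ≤ L → (∀ j < k, ωn (i + j) = ωn (i' + j)) → i = i' := by
    intro i i' hi hi' h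
    refine (hω (fun j => ωn (i + j))).unique ⟨hi, fun j hj => ?_⟩ ⟨hi', fun j hj => ?_⟩
    · rw [← hωn]
    · rw [← hωn, h j j.2]
  let vv : ℕ → Fin (k + 1) → A := fun i j => ωn (i + j)
  have hvv : ∀ i i', i ≤ m → i' ≤ m → Fin.tail (vv i) = Fin.tail (vv i') → i = i' := by
    intro i i' hi hi' h
    have := huniq (i + 1) (i' + 1) (by omega) (by omega) (fun j hj => by
      have := congrFun h ⟨j, hj⟩
      simp only [Fin.tail, vv, Fin.val_succ] at this
      rw [show i + 1 + j = i + (j + 1) by ring, show i' + 1 + j = i' + (j + 1) by ring]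
      exact this)
    omega
  have hvs : ∀ i, vv (i + 1) = shiftF (vv i) (ωn (i + (k + 1))) := by
    intro i
    funext ⟨j, hj⟩
    by_cases h : j < k
    · rw [shiftF_lt _ _ j h]
      simp only [vv]
      congr 1
      ring
    · obtain rfl : j = k := by omega
      rw [shiftF_last]
      simp only [vv]
      congr 1
      ring
  obtain ⟨d, hd⟩ := exists_tree hA (fun u b => ∃ i < m, u = vv i ∧ b = ωn (i + (k + 1)))
    (by
      rintro u b u' b' ht ⟨i, hi, rfl, rfl⟩ ⟨i', hi', rfl, rfl⟩
      have := hvv i i' hi.le hi'.le ht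
      subst this
      exact ⟨rfl, rfl⟩) (vv 0)
  have hch : ∀ v, ∃ p q τ : A, p ≠ q ∧ p ≠ τ ∧ q ≠ τ ∧
      (∀ i < m, v = vv i → p = ωn (i + (k + 1))) ∧ (v ≠ vv 0 → d (shiftF v τ) < d v) := by
    intro v
    have hτ : ∃ τ, (∀ i < m, v = vv i → τ ≠ ωn (i + (k + 1))) ∧
        (v ≠ vv 0 → d (shiftF v τ) < d v) := by
      by_cases hv : v = vv 0
      · obtain ⟨c, hc, _⟩ := exists_third hA (ωn (0 + (k + 1))) (ωn (0 + (k + 1)))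
        refine ⟨c, fun i hi hvi => ?_, fun h => absurd hv h⟩
        have := hvv i 0 hi.le (Nat.zero_le _) (by rw [← hvi, hv])
        rw [this]; exact hc
      · obtain ⟨τ, h1, h2⟩ := hd v hv
        exact ⟨τ, fun i hi hvi h => h1 ⟨i, hi, hvi, h⟩, fun _ => h2⟩
    obtain ⟨τ, hτ1, hτ2⟩ := hτ
    obtain ⟨p, hp1, hp2⟩ : ∃ p, p ≠ τ ∧ ∀ i < m, v = vv i → p = ωn (i + (k + 1)) := by
      by_cases hv : ∃ i < m, v = vv i
      · obtain ⟨i, hi, hvi⟩ := hv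
        refine ⟨ωn (i + (k + 1)), (hτ1 i hi hvi).symm, fun i' hi' hvi' => ?_⟩
        rw [hvv i i' hi.le hi'.le (by rw [← hvi, ← hvi'])]
      · obtain ⟨c, hc, _⟩ := exists_third hA τ τ
        exact ⟨c, hc, fun i hi hvi => absurd ⟨i, hi, hvi⟩ hv⟩
    obtain ⟨q, hq1, hq2⟩ := exists_third hA p τ
    exact ⟨p, q, τ, hq1.symm, hp1, hq2, hp2, hτ2⟩
  choose p q τ hpq hpτ hqτ hp hτ using hch
  let F : Finset (Fin (k + 1) → A) := (Finset.range m).image vv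
  have hFcard : F.card ≤ m := by
    simpa using (Finset.card_image_le (s := Finset.range m) (f := vv))
  have hvF : ∀ i < m, vv i ∈ F := fun i hi =>
    Finset.mem_image_of_mem _ (Finset.mem_range.mpr hi)
  let U := {v : Fin (k + 1) → A // v ∉ F}
  let B : (U → Bool) → (Fin (k + 1) → A) → Bool := fun b v => if h : v ∉ F then b ⟨v, h⟩ else false
  let σ : (U → Bool) → (Fin (k + 1) → A) → ℕ → A := fun b v => exitOrder (p v) (q v) (τ v) (B b v)
  have hσ : ∀ b v i j, i < 3 → j < 3 → σ b v i = σ b v j → i = j := fun b v i j hi hj h =>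
    exitOrder_inj (hpq v) (hpτ v) (hqτ v) (B b v) i j hi hj h
  have hσ0 : ∀ b, ∀ i < m, σ b (vv i) 0 = ωn (i + (k + 1)) := by
    intro b i hi
    rw [← hp (vv i) i hi rfl]
    simp [σ, B, exitOrder, hvF i hi]
  choose x a hx0 hx ha using fun b => rotor_exists shiftF (σ b) (vv 0)
  have hcardV : Fintype.card (Fin (k + 1) → A) = 3 ^ (k + 1) := by
    simp [hA]
  have hN : 3 * Fintype.card (Fin (k + 1) → A) = 3 ^ (k + 2) := by
    rw [hcardV]; ring
  have heul : ∀ b v, Nat.count (fun s => x b s = v) (3 ^ (k + 2)) = 3 := by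
    intro b
    rw [← hN]
    exact rotor_euler shiftF (σ b) (hσ b) (vv 0) (shiftF_indeg hA) d
      (fun u hu => hτ u hu) (x b) (a b) (hx0 b) (hx b) (ha b)
  have hMN : M = 3 ^ (k + 2) + (k + 1) := by omega
  -- walk starts along ω
  have hstart : ∀ b i, i ≤ m → ∀ j ≤ i, x b j = vv j := by
    intro b i
    induction i with
    | zero =>
      intro _ j hj
      obtain rfl : j = 0 := by omega
      exact hx0 b
    | succ i ih =>
      intro hi j hj
      rcases Nat.lt_or_ge j (i + 1) with h | h
      · exact ih (by omega) j (by omega)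
      · obtain rfl : j = i + 1 := by omega
        have hi' := ih (by omega)
        have hc : Nat.count (fun s => x b s = x b i) i = 0 := by
          rw [Nat.count_eq_card_filter_range, Finset.card_eq_zero, Finset.filter_eq_empty_iff]
          intro s hs h
          rw [Finset.mem_range] at hs
          rw [hi' s hs.le, hi' i le_rfl] at h
          have := hvv s i (by omega) (by omega) (by rw [h])
          omega
        rw [hx, ha, hc, hi' i le_rfl, hσ0 b i (by omega), hvs]
  -- the words
  let W : (U → Bool) → Fin M → A := fun b i => x b i 0
  have hW1 : ∀ b, IsDeBruijnWord (k + 2) M (W b) := by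
    intro b v
    have hwin : ∀ j, (j + (k + 2) ≤ M ∧ ∀ (i : Fin (k + 2)) (h : j + (i : ℕ) < M),
        W b ⟨j + (i : ℕ), h⟩ = v i) ↔
        (j < 3 ^ (k + 2) ∧ x b j = Fin.init v ∧ a b j = v (Fin.last _)) := by
      intro j
      constructor
      · rintro ⟨h1, h2⟩
        refine ⟨by omega, ?_, ?_⟩
        · funext i
          have h3 := h2 i.castSucc (by simp; omega)
          rw [Fin.init, ← h3]
          exact walk_letters (x b) (a b) (hx b) i j i.2
        · have h3 := h2 (Fin.last _) (by simp; omega)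
          rw [← h3]
          exact walk_exit (x b) (a b) (hx b) j
      · rintro ⟨h1, h2, h3⟩
        refine ⟨by omega, fun i h => ?_⟩
        induction i using Fin.lastCases with
        | last => rw [← h3]; exact (walk_exit (x b) (a b) (hx b) j).symm
        | cast i =>
          have := congrFun h2 i
          rw [Fin.init] at this
          rw [← this]
          exact (walk_letters (x b) (a b) (hx b) i j i.2).symm
    simp only [hwin]
    have hsurj : ∃ i < 3, σ b (Fin.init v) i = v (Fin.last _) := by
      have hinj : Function.Injective (fun i : Fin 3 => σ b (Fin.init v) i) := by
        intro i j hij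
        exact Fin.ext (hσ b _ i j i.2 j.2 hij)
      have hbij := (Fintype.bijective_iff_injective_and_card _).mpr ⟨hinj, by simp [hA]⟩
      obtain ⟨i, hi⟩ := hbij.2 (v (Fin.last _))
      exact ⟨i, i.2, hi⟩
    obtain ⟨i, hi, hiv⟩ := hsurj
    obtain ⟨t, ht, hxt, hct⟩ := count_ivt (fun s => x b s = Fin.init v) i (3 ^ (k + 2))
      (by rw [heul]; exact hi)
    refine ⟨t, ⟨ht, hxt, ?_⟩, ?_⟩
    · rw [ha, hxt, hct, hiv]
    · rintro s ⟨hs, hxs, has⟩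
      refine rotor_inj (σ b) (hσ b) (x b) (a b) (ha b) (3 ^ (k + 2)) (fun v => (heul b v).le)
        hs ht (by rw [hxs, hxt]) ?_
      rw [has, ha b t, hxt, hct, hiv]
  have hW2 : ∀ b (i : ℕ) (h1 : i < L) (h2 : i < M), W b ⟨i, h2⟩ = ω ⟨i, h1⟩ := by
    intro b i h1 h2
    rw [← hωn]
    change x b i 0 = ωn i
    rcases Nat.le_total i m with h | h
    · rw [hstart b i h i le_rfl]
      simp [vv]
    · have h3 := walk_letters (x b) (a b) (hx b) (i - m) m (by omega)
      rw [hstart b m le_rfl m le_rfl, show m + (i - m) = i by omega] at h3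
      rw [← h3]
      simp only [vv]
      rw [show m + (i - m) = i by omega]
  have hinj : Function.Injective W := by
    intro b b' hbb
    have hw : ∀ t < M, x b t 0 = x b' t 0 := fun t ht => congrFun hbb ⟨t, ht⟩
    have hxx : ∀ t ≤ 3 ^ (k + 2), x b t = x b' t := by
      intro t ht
      funext ⟨i, hi⟩
      rw [walk_letters (x b) (a b) (hx b) i t hi, walk_letters (x b') (a b') (hx b') i t hi]
      exact hw _ (by omega)
    funext ⟨v, hv⟩
    obtain ⟨t, ht, hxt, hct⟩ := count_ivt (fun s => x b s = v) 0 (3 ^ (k + 2))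
      (by rw [heul]; norm_num)
    have hct' : Nat.count (fun s => x b' s = v) t = 0 := by
      rw [← hct, Nat.count_eq_card_filter_range, Nat.count_eq_card_filter_range]
      congr 1
      refine Finset.filter_congr fun s hs => ?_
      rw [Finset.mem_range] at hs
      rw [hxx s (by omega)]
    have hxt' : x b' t = v := by rw [← hxx t ht.le]; exact hxt
    have h1 : a b t = a b' t := by
      rw [walk_exit (x b) (a b) (hx b) t, walk_exit (x b') (a b') (hx b') t]
      exact hw _ (by omega)
    rw [ha, ha, hxt, hxt', hct, hct'] at h1
    have h2 := exitOrder_zero_inj (hpq v) h1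
    simp only [B, dif_pos hv] at h2
    exact h2
  have hcardU : 2 * 3 ^ k ≤ Fintype.card U := by
    have h1 : Fintype.card U = Fintype.card (Fin (k + 1) → A) - F.card := by
      simp only [U]
      rw [Fintype.card_subtype_compl]
      simp
    rw [h1, hcardV, pow_succ]
    omega
  calc 4 ^ 3 ^ k = 2 ^ (2 * 3 ^ k) := by rw [pow_mul]; norm_num
    _ ≤ 2 ^ Fintype.card U := Nat.pow_le_pow_right (by norm_num) hcardU
    _ = Nat.card (U → Bool) := by simp
    _ ≤ _ := Nat.card_le_card_of_injective
      (fun b => (⟨W b, hW1 b, hW2 b⟩ : {w : Fin M → A // IsDeBruijnWord (k + 2) M w ∧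
        ∀ (i : ℕ) (h1 : i < L) (h2 : i < M), w ⟨i, h2⟩ = ω ⟨i, h1⟩}))
      (fun b b' h => hinj (congrArg Subtype.val h))

/-- If `#A = 3`, `n ≥ 2` and `ω` is a de Bruijn sequence of order `n − 1` in `A`, then
the number of de Bruijn sequences of order `n + 1` in `A` that have `ω` as an initial
segment is at least `4^(3^(n−1))`. -/
theorem statement9 (A : Type*) [Fintype A] (hA : Fintype.card A = 3)
    (n : ℕ) (hn : 2 ≤ n)
    (ω : Fin (3 ^ (n - 1) + (n - 1) - 1) → A)
    (hω : IsDeBruijnWord (n - 1) (3 ^ (n - 1) + (n - 1) - 1) ω) :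
    4 ^ 3 ^ (n - 1) ≤
      Nat.card {w : Fin (3 ^ (n + 1) + (n + 1) - 1) → A //
        IsDeBruijnWord (n + 1) (3 ^ (n + 1) + (n + 1) - 1) w ∧
        ∀ (i : ℕ) (h1 : i < 3 ^ (n - 1) + (n - 1) - 1)
          (h2 : i < 3 ^ (n + 1) + (n + 1) - 1), w ⟨i, h2⟩ = ω ⟨i, h1⟩} := by
  obtain ⟨k, rfl⟩ : ∃ k, n = k + 1 := ⟨n - 1, by omega⟩
  exact main_count A hA k (by omega) _ rfl ω hω _ rfl
end

section
/- Suppose the base-b IFS defined by the alphabet A satisfies the strong separation condition. Then the set of badly symbolically approximable points of F has Hausdorff dimension at least α_k·δ > 0, where δ = log k / log b and α_k = 1/49 if k = 2, α_k = (8·(9·log_4(3) − 1))^{−1} if k = 3, and α_k = log((k−2)!)/(k·log k) if k ≥ 4. In particular, there exists a badly symbolically approximable point in F. -/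
/-- The real number in `[0,1]` whose base-`b` digit sequence is `ω` (so that
`ω 0` is the first digit after the point). -/
noncomputable def baseVal (b : ℕ) (ω : ℕ → ℕ) : ℝ :=
  ∑' i : ℕ, (ω i : ℝ) / (b : ℝ) ^ (i + 1)

/-- The initial segment of `ω` of length `A.card ^ n + n - 1` is a (non-cyclic)
de Bruijn sequence of order `n` in the alphabet `A`: every word of length `n`
over `A` occurs exactly once as a consecutive substring of that initial segment. -/
def dbPrefix (A : Finset ℕ) (n : ℕ) (ω : ℕ → ℕ) : Prop :=
  ∀ v : ℕ → ℕ, (∀ i < n, v i ∈ A) →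
    ∃! j : ℕ, j + n ≤ A.card ^ n + n - 1 ∧ ∀ i < n, ω (j + i) = v i

/-- `B_ω`, the set of orders `n ≥ 1` for which the corresponding initial segment of `ω`
is a de Bruijn sequence of order `n`. -/
def deBruijnSet (A : Finset ℕ) (ω : ℕ → ℕ) : Set ℕ :=
  {n | 0 < n ∧ dbPrefix A n ω}

/-- `ω` is uniformly de Bruijn: `B_ω` is infinite with bounded gap sizes. -/
def UniformlyDeBruijn (A : Finset ℕ) (ω : ℕ → ℕ) : Prop :=
  ∃ g : ℕ, ∀ N : ℕ, ∃ n ∈ deBruijnSet A ω, N < n ∧ n ≤ N + g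

/-- `ω` is infinitely de Bruijn: `B_ω` is infinite. -/
def InfinitelyDeBruijn (A : Finset ℕ) (ω : ℕ → ℕ) : Prop :=
  (deBruijnSet A ω).Infinite

/-- `ω` is totally de Bruijn: `B_ω` contains every `n ≥ 1`. -/
def TotallyDeBruijn (A : Finset ℕ) (ω : ℕ → ℕ) : Prop :=
  ∀ n : ℕ, 0 < n → dbPrefix A n ω

/-- The limit set `F` of the base-`b` IFS with digit alphabet `A`: all reals having at
least one base-`b` expansion with all digits in `A`. -/
def limitSet (b : ℕ) (A : Finset ℕ) : Set ℝ :=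
  {x | ∃ ω : ℕ → ℕ, (∀ i, ω i ∈ A) ∧ x = baseVal b ω}

/-- The base-`b` IFS `S_i(x) = (i+x)/b`, `i ∈ A`, satisfies the strong separation
condition: `S_i(F) ∩ S_j(F) = ∅` for all `i ≠ j` in `A`, where `F` is the limit set. -/
def StrongSep (b : ℕ) (A : Finset ℕ) : Prop :=
  ∀ i ∈ A, ∀ j ∈ A, i ≠ j →
    Disjoint ((fun x : ℝ => ((i : ℝ) + x) / (b : ℝ)) '' limitSet b A)
      ((fun x : ℝ => ((j : ℝ) + x) / (b : ℝ)) '' limitSet b A)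

/-- `x` is badly symbolically approximable (with respect to `ψ_*`): there is `κ > 0`
such that `|x − r| ≥ κ / (q_sym · (log_b q_sym)^(1/δ))` for every rational `r ∈ F ∩ ℚ`,
where `q_sym = H_sym(r)`. Here the symbolic height is encoded by quantifying over all
preperiod/period pairs `(i, p)` of expansions of `r` with digits in `A` (the bound for
the minimal such pair is equivalent to the bound for all of them, by monotonicity of
`q ↦ q(log_b q)^(1/δ)`). -/
noncomputable def BadlySymbolicallyApproximable (b : ℕ) (A : Finset ℕ) (δ : ℝ)
    (x : ℝ) : Prop :=
  ∃ κ : ℝ, 0 < κ ∧ ∀ (r : ℝ) (i p : ℕ), 0 < p →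
    (∃ τ : ℕ → ℕ, (∀ t, τ t ∈ A) ∧ r = baseVal b τ ∧ ∀ t, i ≤ t → τ (t + p) = τ t) →
    κ / (((b : ℝ) ^ i * ((b : ℝ) ^ p - 1)) *
        Real.logb b ((b : ℝ) ^ i * ((b : ℝ) ^ p - 1)) ^ (1 / δ)) ≤ |x - r|

set_option linter.unusedSectionVars false

namespace SBA

section Graph
variable {V E : Type*} [DecidableEq E] (src tgt : E → V)

/-- one-step relation along an edge of `U` -/
def Stp (U : Finset E) (x y : V) : Prop := ∃ e ∈ U, src e = x ∧ tgt e = y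

/-- reachability along edges of `U` -/
def Rch (U : Finset E) : V → V → Prop := Relation.ReflTransGen (Stp src tgt U)

open Classical in
/-- cut form of the balance condition for the edges not yet used by a trail from `s` to `v` -/
def Bal (U : Finset E) (s v : V) : Prop :=
  ∀ Y : V → Prop, (U.filter (fun e => Y (src e))).card + (if Y s then 1 else 0) =
    (U.filter (fun e => Y (tgt e))).card + (if Y v then 1 else 0)

/-- all remaining edges can still reach `s` -/
def Good (U : Finset E) (s : V) : Prop := ∀ e ∈ U, Rch src tgt U (src e) s

variable {src tgt}

theorem Bal.erase {U : Finset E} {s v : V} (h : Bal src tgt U s v) {e : E} (he : e ∈ U)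
    (hv : src e = v) : Bal src tgt (U.erase e) s (tgt e) := by
  classical
  intro Y
  have := h Y
  rw [Finset.filter_erase, Finset.filter_erase]
  have e1 : ((U.filter (fun e => Y (src e))).erase e).card + (if Y v then 1 else 0)
      = (U.filter (fun e => Y (src e))).card := by
    by_cases hY : Y v
    · rw [if_pos hY, Finset.card_erase_add_one]; simp [he, hv, hY]
    · rw [if_neg hY, Finset.erase_eq_of_notMem]
      · rfl
      · rw [Finset.mem_filter, hv]; exact fun hh => hY hh.2
  have e2 : ((U.filter (fun e => Y (tgt e))).erase e).card + (if Y (tgt e) then 1 else 0)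
      = (U.filter (fun e => Y (tgt e))).card := by
    by_cases hY : Y (tgt e)
    · rw [if_pos hY, Finset.card_erase_add_one]; simp [he, hY]
    · rw [if_neg hY, Finset.erase_eq_of_notMem]
      · rfl
      · rw [Finset.mem_filter]; exact fun hh => hY hh.2
  convert (show ((U.filter (fun e => Y (src e))).erase e).card + (if Y s then 1 else 0) =
    ((U.filter (fun e => Y (tgt e))).erase e).card + (if Y (tgt e) then 1 else 0) by
      have h' : (U.filter (fun e => Y (src e))).card + (if Y s then 1 else 0) =
    (U.filter (fun e => Y (tgt e))).card + (if Y v then 1 else 0) := by convert this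
      omega)

theorem Bal.exists_out {U : Finset E} {s v : V} (h : Bal src tgt U s v)
    (hg : Good src tgt U s) (hU : U.Nonempty) : ∃ e ∈ U, src e = v := by
  classical
  by_contra! hc
  have h0 := h (fun u => u = v)
  have h1 : (U.filter (fun e => src e = v)).card = 0 := by
    simp only [Finset.card_eq_zero, Finset.filter_eq_empty_iff]; intro e he; exact hc e he
  have h2 : s = v ∧ (U.filter (fun e => tgt e = v)).card = 0 := by
    have h0' : (U.filter (fun e => src e = v)).card + (if s = v then 1 else 0) =
      (U.filter (fun e => tgt e = v)).card + (if v = v then 1 else 0) := by convert h0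
    rw [h1, if_pos rfl] at h0'
    split_ifs at h0' with h3
    · exact ⟨h3, by omega⟩
    · omega
  obtain ⟨rfl, h3⟩ := h2
  obtain ⟨f, hf⟩ := hU
  rcases (Relation.ReflTransGen.cases_tail_iff _ _ _).1 (hg f hf) with h4 | ⟨c, -, e, he, -, h5⟩
  · exact hc f hf h4.symm
  · simp only [Finset.card_eq_zero, Finset.filter_eq_empty_iff] at h3
    exact h3 he h5

/-- If a set of vertices is left by no edge, then it contains neither entry edges nor `v`. -/
theorem Bal.no_entry {U : Finset E} {s v : V} (h : Bal src tgt U s v) (Y : V → Prop)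
    (hs : ¬ Y s) (hcl : ∀ e ∈ U, Y (src e) → Y (tgt e)) :
    ¬ Y v ∧ ∀ e ∈ U, Y (tgt e) → Y (src e) := by
  classical
  have h0 : (U.filter (fun e => Y (src e))).card + (if Y s then 1 else 0) =
    (U.filter (fun e => Y (tgt e))).card + (if Y v then 1 else 0) := by convert h Y
  rw [if_neg hs] at h0
  have hsub : U.filter (fun e => Y (src e)) ⊆ U.filter (fun e => Y (tgt e)) := by
    intro e he
    simp only [Finset.mem_filter] at he ⊢
    exact ⟨he.1, hcl e he.1 he.2⟩
  have hc := Finset.card_le_card hsub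
  have hv : ¬ Y v := by
    intro hv; rw [if_pos hv] at h0; omega
  rw [if_neg hv] at h0
  have heq := Finset.eq_of_subset_of_card_le hsub (by omega)
  refine ⟨hv, fun e he hy => ?_⟩
  have : e ∈ U.filter (fun e => Y (src e)) := by rw [heq]; simp [he, hy]
  simpa [he] using this

theorem Rch.exit {U : Finset E} {x s : V} (h : Rch src tgt U x s) (Y : V → Prop) (hx : Y x)
    (hs : ¬ Y s) : ∃ e ∈ U, Y (src e) ∧ ¬ Y (tgt e) := by
  by_contra! hc
  apply hs
  induction h with
  | refl => exact hx
  | tail _ h2 ih =>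
    obtain ⟨e, he, rfl, rfl⟩ := h2
    by_cases hys : Y (src e)
    · exact hc e he hys
    · exact absurd (ih hys) hys

/-- Structure of a bad edge. -/
theorem bad_edge {U : Finset E} {s v : V} (h : Bal src tgt U s v)
    (hg : Good src tgt U s) {e : E} (he : e ∈ U) (hv : src e = v)
    (hbad : ¬ Good src tgt (U.erase e) s) :
    ∃ Y : V → Prop, Y v ∧ ¬ Y (tgt e) ∧ ¬ Y s ∧ (∀ f ∈ U, f ≠ e → Y (src f) → Y (tgt f)) ∧
      (∀ f ∈ U, Y (tgt f) → Y (src f)) ∧ ∀ x, Y x ↔ ¬ Rch src tgt (U.erase e) x s := by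
  classical
  let Y : V → Prop := fun u => ¬ Rch src tgt (U.erase e) u s
  have hYs : ¬ Y s := fun hh => hh Relation.ReflTransGen.refl
  have hcl : ∀ f ∈ U, f ≠ e → Y (src f) → Y (tgt f) := by
    intro f hf hfe h1 h2
    exact h1 (Relation.ReflTransGen.head ⟨f, Finset.mem_erase.2 ⟨hfe, hf⟩, rfl, rfl⟩ h2)
  have hne := h.erase he hv
  have h2 := hne.no_entry Y hYs (fun f hf => hcl f (Finset.mem_of_mem_erase hf)
    (Finset.ne_of_mem_erase hf))
  unfold Good at hbad
  push Not at hbad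
  obtain ⟨f, hf, hfY⟩ := hbad
  have hvY : Y v := by
    by_contra hvY'
    obtain ⟨e', he', h3, h4⟩ := (hg f (Finset.mem_of_mem_erase hf)).exit Y hfY hYs
    by_cases hee : e' = e
    · subst hee; rw [hv] at h3; exact h3 hvY'
    · exact h4 (hcl e' he' hee h3)
  refine ⟨Y, hvY, h2.1, hYs, hcl, ?_, fun x => Iff.rfl⟩
  intro f hf hfY
  by_cases hfe : f = e
  · subst hfe; rw [hv]; exact hvY
  · exact h2.2 f (Finset.mem_erase.2 ⟨hfe, hf⟩) hfY

theorem bad_unique {U : Finset E} {s v : V} (h : Bal src tgt U s v)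
    (hg : Good src tgt U s) {e e' : E} (he : e ∈ U) (hv : src e = v) (he' : e' ∈ U)
    (hv' : src e' = v)
    (hbad : ¬ Good src tgt (U.erase e) s) (hbad' : ¬ Good src tgt (U.erase e') s) : e = e' := by
  by_contra hne
  obtain ⟨Y, hvY, hY2, hYs, hcl, hent, hYiff⟩ := bad_edge h hg he hv hbad
  obtain ⟨Y', hvY', hY2', hYs', hcl', hent', hYiff'⟩ := bad_edge h hg he' hv' hbad'
  have h1 : Y (tgt e') := hcl e' he' (Ne.symm hne) (by rw [hv']; exact hvY)
  have h2 : Rch src tgt (U.erase e') (tgt e') s := by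
    by_contra h3; exact hY2' ((hYiff' _).2 h3)
  obtain ⟨f, hf, h3, h4⟩ := h2.exit (fun x => Y x ∧ ¬ Y' x) ⟨h1, hY2'⟩ (fun hh => hYs hh.1)
  have hfU := Finset.mem_of_mem_erase hf
  by_cases hfe : f = e
  · subst hfe; rw [hv] at h3; exact h3.2 hvY'
  · exact h4 ⟨hcl f hfU hfe h3.1, fun h5 => h3.2 (hent' f hfU h5)⟩

theorem fresh_good {U : Finset E} {s v : V} (h : Bal src tgt U s v)
    (hg : Good src tgt U s) {e f g k : E} (he : e ∈ U) (hv : src e = v)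
    (hf : f ∈ U) (hfv : src f = v) (hfe : f ≠ e)
    (hgU : g ∈ U) (hk : k ∈ U) (hgk : src g = src k) (hgv : src g ≠ v)
    (hgt : tgt g = tgt e) (hkt : tgt k = tgt f) : Good src tgt (U.erase e) s := by
  by_contra hbad
  obtain ⟨Y, hvY, hY2, hYs, hcl, hent, -⟩ := bad_edge h hg he hv hbad
  have h1 : Y (tgt f) := hcl f hf hfe (by rw [hfv]; exact hvY)
  have h2 : Y (src k) := hent k hk (by rw [hkt]; exact h1)
  have h3 := hcl g hgU (by rintro rfl; exact hgv hv) (by rw [hgk]; exact h2)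
  rw [hgt] at h3
  exact hY2 h3

theorem single_good {U : Finset E} {s v : V} (h : Bal src tgt U s v)
    (hg : Good src tgt U s) {e : E} (he : e ∈ U) (hv : src e = v)
    (huniq : ∀ f ∈ U, src f = v → f = e) : Good src tgt (U.erase e) s := by
  classical
  by_contra hbad
  obtain ⟨Y, hvY, hY2, hYs, hcl, hent, hiff⟩ := bad_edge h hg he hv hbad
  have hvs : s ≠ v := by rintro rfl; exact hYs hvY
  have h0 : (U.filter (fun e => src e = v)).card + (if s = v then 1 else 0) =
      (U.filter (fun e => tgt e = v)).card + (if v = v then 1 else 0) := by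
    convert h (fun u => u = v)
  rw [if_neg hvs, if_pos rfl] at h0
  have h1 : (U.filter (fun e => src e = v)).card ≤ 1 := by
    rw [Finset.card_le_one]
    intro a ha b hb
    rw [Finset.mem_filter] at ha hb
    rw [huniq a ha.1 ha.2, huniq b hb.1 hb.2]
  have h2 : (U.filter (fun e => tgt e = v)).card = 0 := by omega
  rw [Finset.card_eq_zero, Finset.filter_eq_empty_iff] at h2
  unfold Good at hbad
  push Not at hbad
  obtain ⟨f, hf, hfY⟩ := hbad
  have hfv : src f ≠ v := fun hh => Finset.ne_of_mem_erase hf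
    (huniq f (Finset.mem_of_mem_erase hf) hh)
  obtain ⟨g, hgU, h3, h4⟩ := (hg f (Finset.mem_of_mem_erase hf)).exit (fun x => Y x ∧ x ≠ v)
    ⟨(hiff _).2 hfY, hfv⟩ (fun hh => hYs hh.1)
  exact h4 ⟨hcl g hgU (by rintro rfl; exact h3.2 hv) h3.1, h2 hgU⟩

/-- Goodness at the beginning of a phase. -/
theorem start_good {U G : Finset E} {s v : V} (h : Bal src tgt U s v)
    (hG : ∀ e ∈ G, Rch src tgt G (src e) s) (hUG : U ⊆ G)
    (hsq : ∀ e ∈ G, e ∉ U → ∃ f ∈ U, ∃ g ∈ U, ∃ k ∈ U, src f = src e ∧ tgt f = tgt k ∧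
      src k = src g ∧ tgt g = tgt e) : Good src tgt U s := by
  intro e0 he0
  by_contra hn
  let Y : V → Prop := fun u => ¬ Rch src tgt U u s
  have hYs : ¬ Y s := fun hh => hh Relation.ReflTransGen.refl
  have hcl : ∀ f ∈ U, Y (src f) → Y (tgt f) := by
    intro f hf h1 h2
    exact h1 (Relation.ReflTransGen.head ⟨f, hf, rfl, rfl⟩ h2)
  have h2 := (h.no_entry Y hYs hcl).2
  obtain ⟨e, he, h3, h4⟩ := (hG e0 (hUG he0)).exit Y hn hYs
  by_cases heU : e ∈ U
  · exact h4 (hcl e heU h3)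
  · obtain ⟨f, hf, g, hgU, k, hk, a1, a2, a3, a4⟩ := hsq e he heU
    apply h4
    rw [← a4]
    apply hcl g hgU
    rw [← a3]
    apply h2 k hk
    rw [← a2]
    apply hcl f hf
    rw [a1]; exact h3

end Graph
end SBA

namespace SBA

section Words
variable {α : Type*} [Fintype α] [DecidableEq α]

/-- words of length `r` -/
def words (α : Type*) [Fintype α] [DecidableEq α] (r : ℕ) : Finset (List α) :=
  Finset.univ.image (List.ofFn : (Fin r → α) → List α)

theorem mem_words {r : ℕ} {l : List α} : l ∈ words α r ↔ l.length = r := by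
  constructor
  · intro h
    obtain ⟨f, -, rfl⟩ := Finset.mem_image.1 h
    simp
  · rintro rfl
    exact Finset.mem_image.2 ⟨l.get, Finset.mem_univ _, List.ofFn_get l⟩

theorem card_words (r : ℕ) : (words α r).card = Fintype.card α ^ r := by
  rw [words, Finset.card_image_of_injective _ List.ofFn_injective]
  simp

/-- words of length `ℓ+1` that do not occur in `h` -/
def unused (ℓ : ℕ) (h : List α) : Finset (List α) :=
  (words α (ℓ + 1)).filter (fun e => ¬ e <:+: h)

theorem mem_unused {ℓ : ℕ} {h e : List α} :
    e ∈ unused ℓ h ↔ e.length = ℓ + 1 ∧ ¬ e <:+: h := by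
  rw [unused, Finset.mem_filter, mem_words]

/-- no word of length `r` occurs twice -/
def NoRep (r : ℕ) : List α → Prop
  | [] => True
  | a :: h => NoRep r h ∧ ¬ (a :: h).take r <:+: h

/-- the initial vertex (histories are stored with the newest letter first) -/
def sv (ℓ : ℕ) (h : List α) : List α := h.drop (h.length - ℓ)

theorem sv_cons {ℓ : ℕ} {h : List α} (hl : ℓ ≤ h.length) (a : α) : sv ℓ (a :: h) = sv ℓ h := by
  unfold sv
  rw [List.length_cons, show h.length + 1 - ℓ = (h.length - ℓ) + 1 by omega, List.drop_succ_cons]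

theorem unused_cons {ℓ : ℕ} {h : List α} (hl : ℓ ≤ h.length) (a : α) :
    unused ℓ (a :: h) = (unused ℓ h).erase (a :: h.take ℓ) := by
  ext e
  rw [Finset.mem_erase, mem_unused, mem_unused, List.infix_cons_iff]
  constructor
  · rintro ⟨h1, h2⟩
    push Not at h2
    refine ⟨?_, h1, h2.2⟩
    rintro rfl
    exact h2.1 (List.cons_prefix_cons.2 ⟨rfl, List.take_prefix _ _⟩)
  · rintro ⟨h1, h2, h3⟩
    refine ⟨h2, ?_⟩
    rintro (h4 | h4)
    · apply h1
      rw [List.prefix_iff_eq_take] at h4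
      rw [h4, h2, List.take_succ_cons]
    · exact h3 h4

theorem NoRep.eq_prefix {r : ℕ} {h : List α} (hn : NoRep r h) {p q w p' q' : List α}
    (hw : r ≤ w.length) (h1 : h = p ++ w ++ q) (h2 : h = p' ++ w ++ q') : p = p' := by
  induction h generalizing p p' with
  | nil =>
    have := congrArg List.length h1
    have h2 := congrArg List.length h2
    simp at this h2
    rw [List.length_eq_zero_iff.1 (show p.length = 0 by omega),
      List.length_eq_zero_iff.1 (show p'.length = 0 by omega)]
  | cons a h ih =>
    have key : ∀ (q p'' q' : List α), a :: h = w ++ q → h = p'' ++ w ++ q' → False := by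
      intro q p'' q' e1 e2
      apply hn.2
      have : (a :: h).take r <+: w := by
        rw [e1, List.take_append_of_le_length hw]
        exact List.take_prefix _ _
      exact this.isInfix.trans ⟨p'', q', e2.symm⟩
    cases p with
    | nil =>
      cases p' with
      | nil => rfl
      | cons b p' =>
        exfalso
        simp only [List.cons_append, List.cons.injEq] at h2
        exact key q p' q' (by simpa using h1) h2.2
    | cons b p =>
      simp only [List.cons_append, List.cons.injEq] at h1
      cases p' with
      | nil =>
        exfalso
        exact key q' p q (by simpa using h2) h1.2
      | cons c p' =>
        simp only [List.cons_append, List.cons.injEq] at h2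
        rw [ih hn.1 h1.2 h2.2, ← h1.1, ← h2.1]

theorem NoRep.uniq_block {r : ℕ} {h : List α} (hn : NoRep r h) {w : List α} {x y x' y' : α}
    (hw : r ≤ w.length) (h1 : (x :: (w ++ [y])) <:+: h) (h2 : (x' :: (w ++ [y'])) <:+: h) :
    x = x' ∧ y = y' := by
  obtain ⟨p, q, e1⟩ := h1
  obtain ⟨p', q', e2⟩ := h2
  have a1 : h = (p ++ [x]) ++ w ++ (y :: q) := by rw [← e1]; simp
  have a2 : h = (p' ++ [x']) ++ w ++ (y' :: q') := by rw [← e2]; simp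
  have h3 := hn.eq_prefix hw a1 a2
  have h4 := List.append_inj h3 (by have := congrArg List.length h3; simpa using this)
  rw [a1, h3] at a2
  have h5 := List.append_cancel_left a2
  simp only [List.cons.injEq] at h5 h4
  exact ⟨h4.2.1, h5.1⟩

theorem NoRep.uniq_src {r : ℕ} {h : List α} (hn : NoRep r h) {w : List α} {x x' : α}
    (hw : r ≤ w.length) (h1 : (x :: w) <:+: h) (h2 : (x' :: w) <:+: h) :
    x = x' := by
  obtain ⟨p, q, e1⟩ := h1
  obtain ⟨p', q', e2⟩ := h2
  have a1 : h = (p ++ [x]) ++ w ++ q := by rw [← e1]; simp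
  have a2 : h = (p' ++ [x']) ++ w ++ q' := by rw [← e2]; simp
  have h3 := hn.eq_prefix hw a1 a2
  have h4 := List.append_inj h3 (by have := congrArg List.length h3; simpa using this)
  simpa using h4.2

theorem NoRep.mono {r r' : ℕ} (hr : r ≤ r') {h : List α} (hn : NoRep r h) : NoRep r' h := by
  induction h with
  | nil => trivial
  | cons a h ih =>
    refine ⟨ih hn.1, fun h1 => hn.2 (List.IsInfix.trans ?_ h1)⟩
    exact (List.take_prefix_take_left hr).isInfix

theorem NoRep.not_used {ℓ : ℕ} {a : α} {h : List α} (hn : NoRep (ℓ + 1) (a :: h)) 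
    (hl : ℓ ≤ h.length) : (a :: h.take ℓ) ∈ unused ℓ h := by
  rw [mem_unused]
  refine ⟨by simp [hl], ?_⟩
  have := hn.2
  rwa [List.take_succ_cons] at this

theorem unused_base {ℓ : ℕ} {h : List α} (hl : h.length = ℓ) : unused ℓ h = words α (ℓ + 1) := by
  ext e
  rw [mem_unused, mem_words]
  constructor
  · exact fun h => h.1
  · intro h1
    refine ⟨h1, fun h2 => ?_⟩
    have := h2.length_le
    omega

theorem bal_words {ℓ : ℕ} (s : List α) :
    Bal List.tail List.dropLast (words α (ℓ + 1)) s s := by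
  classical
  intro Y
  congr 1
  apply Finset.card_nbij' (fun e => e.rotate 1) (fun e => e.rotate ℓ)
  · intro e he
    simp only [Finset.coe_filter, Set.mem_ofPred_eq, mem_words] at he ⊢
    cases e with
    | nil => simp at he
    | cons a e => simpa using he
  · intro e he
    simp only [Finset.coe_filter, Set.mem_ofPred_eq, mem_words] at he ⊢
    refine ⟨by simp [he.1], ?_⟩
    rcases List.eq_nil_or_concat e with rfl | ⟨L, b, rfl⟩
    · simp at he
    · have hL : L.length = ℓ := by simpa using he.1
      rw [List.concat_eq_append] at he ⊢
      rw [← hL, List.rotate_append_length_eq]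
      simpa using he.2
  · intro e he
    simp only [Finset.coe_filter, Set.mem_ofPred_eq, mem_words] at he
    simp only [List.rotate_rotate]
    rw [show 1 + ℓ = e.length by omega, List.rotate_length]
  · intro e he
    simp only [Finset.coe_filter, Set.mem_ofPred_eq, mem_words] at he
    simp only [List.rotate_rotate]
    rw [show ℓ + 1 = e.length by omega, List.rotate_length]

theorem bal_unused {ℓ : ℕ} {h : List α} (hl : ℓ ≤ h.length) (hn : NoRep (ℓ + 1) h) :
    Bal List.tail List.dropLast (unused ℓ h) (sv ℓ h) (h.take ℓ) := by
  induction h with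
  | nil =>
    have : ℓ = 0 := by simpa using hl
    subst this
    rw [unused_base (by simp)]
    exact bal_words _
  | cons a h ih =>
    rcases Nat.lt_or_ge h.length ℓ with h1 | h1
    · have h2 : (a :: h).length = ℓ := by simp at hl ⊢; omega
      rw [unused_base h2, List.take_of_length_le h2.le, sv, h2, Nat.sub_self, List.drop_zero]
      exact bal_words _
    · rw [sv_cons h1, unused_cons h1]
      have := (ih h1 hn.1).erase (e := a :: h.take ℓ) (hn.not_used h1) rfl
      convert this using 1
      rw [List.dropLast_eq_take]
      simp only [List.length_cons, List.length_take]
      rw [show min ℓ h.length + 1 - 1 = ℓ by omega]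
      rw [← List.take_succ_cons, List.take_take]
      congr 1; omega

theorem card_unused {ℓ : ℕ} {h : List α} (hl : ℓ ≤ h.length) (hn : NoRep (ℓ + 1) h) :
    (unused ℓ h).card + h.length = Fintype.card α ^ (ℓ + 1) + ℓ := by
  induction h with
  | nil =>
    have : ℓ = 0 := by simpa using hl
    subst this
    rw [unused_base (by simp), card_words]
    rfl
  | cons a h ih =>
    rcases Nat.lt_or_ge h.length ℓ with h1 | h1
    · have h2 : (a :: h).length = ℓ := by simp at hl ⊢; omega
      rw [unused_base h2, card_words, h2]
    · rw [unused_cons h1, ← ih h1 hn.1]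
      have := Finset.card_erase_add_one (hn.not_used h1)
      rw [List.length_cons]; omega

theorem rch_words {ℓ : ℕ} (u t : List α) (hu : u.length = ℓ) :
    Rch List.tail List.dropLast (words α (ℓ + 1)) u ((t ++ u).take ℓ) := by
  induction t with
  | nil => rw [List.nil_append, List.take_of_length_le hu.le]; exact Relation.ReflTransGen.refl
  | cons a t ih =>
    refine ih.tail ⟨a :: (t ++ u).take ℓ, ?_, rfl, ?_⟩
    · rw [mem_words]; simp; omega
    · rw [List.dropLast_eq_take]
      simp only [List.length_cons, List.length_take, List.length_append]
      rw [show min ℓ (t.length + u.length) + 1 - 1 = ℓ by omega]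
      rw [← List.take_succ_cons, List.take_take, List.cons_append]
      congr 1; omega

theorem good_start {ℓ r : ℕ} {h : List α} (hk : 2 ≤ Fintype.card α) (hl : ℓ ≤ h.length)
    (hl1 : 1 ≤ ℓ) (hr : r + 1 ≤ ℓ) (hn : NoRep r h) :
    Good List.tail List.dropLast (unused ℓ h) (sv ℓ h) := by
  have hn' : NoRep (ℓ + 1) h := hn.mono (by omega)
  refine start_good (G := words α (ℓ + 1)) (bal_unused hl hn') ?_ (Finset.filter_subset _ _) ?_
  · intro e he
    rw [mem_words] at he
    have hs : (sv ℓ h).length = ℓ := by simp [sv]; omega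
    have := rch_words (ℓ := ℓ) e.tail (sv ℓ h) (by simp [he])
    rwa [List.take_append_of_le_length hs.ge, List.take_of_length_le hs.le] at this
  · intro e he heu
    rw [mem_words] at he
    have hinf : e <:+: h := by
      by_contra hc; exact heu (mem_unused.2 ⟨he, hc⟩)
    obtain ⟨a, w, z, rfl⟩ : ∃ a w z, e = a :: (w ++ [z]) := by
      cases e with
      | nil => simp at he
      | cons a e =>
        rcases List.eq_nil_or_concat e with rfl | ⟨L, b, rfl⟩
        · simp at he; omega
        · exact ⟨a, L, b, by simp⟩
    have hw : w.length + 2 = ℓ + 1 := by simpa using he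
    have : Nontrivial α := Fintype.one_lt_card_iff_nontrivial.1 (by omega)
    obtain ⟨a', ha'⟩ := exists_ne a
    obtain ⟨z', hz'⟩ := exists_ne z
    have hmem : ∀ x y, (x ≠ a ∨ y ≠ z) → x :: (w ++ [y]) ∈ unused ℓ h := by
      intro x y hxy
      rw [mem_unused]
      refine ⟨by simpa using hw, fun hc => ?_⟩
      have := hn.uniq_block (by omega) hc hinf
      tauto
    have hdl : ∀ x y, List.dropLast (x :: (w ++ [y])) = x :: w := by
      intro x y
      rw [← List.cons_append, List.dropLast_concat]
    refine ⟨a' :: (w ++ [z]), hmem _ _ (Or.inl ha'), a :: (w ++ [z']), hmem _ _ (Or.inr hz'),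
      a' :: (w ++ [z']), hmem _ _ (Or.inl ha'), rfl, ?_, rfl, ?_⟩
    · rw [hdl, hdl]
    · rw [hdl, hdl]

/-- The invariant kept during a phase. -/
structure Inv (ℓ : ℕ) (h : List α) : Prop where
  len : ℓ ≤ h.length
  norep : NoRep (ℓ + 1) h
  good : Good List.tail List.dropLast (unused ℓ h) (sv ℓ h)

theorem Inv.bal {ℓ : ℕ} {h : List α} (hI : Inv ℓ h) :
    Bal List.tail List.dropLast (unused ℓ h) (sv ℓ h) (h.take ℓ) := bal_unused hI.len hI.norep

open Classical in
/-- The admissible next letters. -/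
noncomputable def opts (ℓ : ℕ) (h : List α) : Finset α :=
  Finset.univ.filter (fun a => (a :: h.take ℓ) ∈ unused ℓ h ∧
    Good List.tail List.dropLast ((unused ℓ h).erase (a :: h.take ℓ)) (sv ℓ h))

theorem mem_opts {ℓ : ℕ} {h : List α} {a : α} : a ∈ opts ℓ h ↔ (a :: h.take ℓ) ∈ unused ℓ h ∧
    Good List.tail List.dropLast ((unused ℓ h).erase (a :: h.take ℓ)) (sv ℓ h) := by
  simp [opts]

theorem Inv.step {ℓ : ℕ} {h : List α} (hI : Inv ℓ h) {a : α} (ha : a ∈ opts ℓ h) :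
    Inv ℓ (a :: h) := by
  rw [mem_opts] at ha
  refine ⟨by have := hI.len; rw [List.length_cons]; omega, ⟨hI.norep, ?_⟩, ?_⟩
  · rw [List.take_succ_cons]
    exact (mem_unused.1 ha.1).2
  · rw [unused_cons hI.len, sv_cons hI.len]
    exact ha.2

theorem Inv.next {ℓ : ℕ} {h : List α} (hk : 2 ≤ Fintype.card α) (hI : Inv ℓ h)
    (hl : ℓ + 3 ≤ h.length) : Inv (ℓ + 3) h :=
  ⟨hl, hI.norep.mono (by omega), good_start (r := ℓ + 1) hk hl (by omega) (by omega) hI.norep⟩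

/-- number of unused edges out of `u` -/
def deg (ℓ : ℕ) (h u : List α) : ℕ :=
  (Finset.univ.filter (fun a => (a :: u) ∈ unused ℓ h)).card

theorem Inv.deg_le {ℓ : ℕ} {h : List α} (hI : Inv ℓ h) :
    deg ℓ h (h.take ℓ) ≤ (opts ℓ h).card + 1 := by
  classical
  unfold deg
  set S := Finset.univ.filter (fun a => (a :: h.take ℓ) ∈ unused ℓ h) with hS
  have hsub : opts ℓ h ⊆ S := by
    intro a ha
    rw [mem_opts] at ha
    simp [hS, ha.1]
  have h1 : (S \ opts ℓ h).card ≤ 1 := by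
    rw [Finset.card_le_one]
    intro a ha b hb
    simp only [hS, Finset.mem_sdiff, Finset.mem_filter, Finset.mem_univ, true_and, mem_opts,
      not_and] at ha hb
    have := bad_unique hI.bal hI.good ha.1 rfl hb.1 rfl (ha.2 ha.1) (hb.2 hb.1)
    simpa using this
  have := Finset.card_sdiff_add_card_eq_card hsub
  omega

theorem Inv.deg_pos {ℓ : ℕ} {h : List α} (hI : Inv ℓ h)
    (hlen : h.length < Fintype.card α ^ (ℓ + 1)) : 0 < deg ℓ h (h.take ℓ) := by
  have hc := card_unused hI.len hI.norep
  obtain ⟨e, he, hv⟩ := hI.bal.exists_out hI.good (Finset.card_pos.1 (by omega))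
  unfold deg
  rw [Finset.card_pos]
  cases e with
  | nil => rw [mem_unused] at he; simp at he
  | cons a e =>
    refine ⟨a, ?_⟩
    simp only [List.tail_cons] at hv
    simp only [Finset.mem_filter, Finset.mem_univ, true_and]
    rw [← hv]; exact he

theorem Inv.opts_nonempty {ℓ : ℕ} {h : List α} (hI : Inv ℓ h)
    (hlen : h.length < Fintype.card α ^ (ℓ + 1)) : (opts ℓ h).Nonempty := by
  have h1 := hI.deg_le
  have h2 := hI.deg_pos hlen
  rw [← Finset.card_pos]
  by_contra hc
  have h3 : deg ℓ h (h.take ℓ) = 1 := by omega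
  unfold deg at h3
  obtain ⟨a, ha⟩ := Finset.card_eq_one.1 h3
  have hmem : ∀ b, (b :: h.take ℓ) ∈ unused ℓ h ↔ b = a := by
    intro b
    have := congrArg (fun s => b ∈ s) ha
    simpa using this
  have : a ∈ opts ℓ h := by
    rw [mem_opts]
    refine ⟨(hmem a).2 rfl, single_good hI.bal hI.good ((hmem a).2 rfl) rfl ?_⟩
    intro f hf hfv
    cases f with
    | nil => rw [mem_unused] at hf; simp at hf
    | cons b e =>
      simp only [List.tail_cons] at hfv
      subst hfv
      rw [(hmem b).1 hf]
  have := Finset.card_pos.2 ⟨a, this⟩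
  omega

end Words
end SBA

namespace SBA

section Pot
variable {α : Type*} [Fintype α] [DecidableEq α]

theorem inv_single (hk : 2 ≤ Fintype.card α) (a : α) : Inv 1 [a] := by
  have hn : NoRep (1 + 1) [a] := ⟨trivial, by simp⟩
  refine ⟨by simp, hn, ?_⟩
  intro e he
  rw [unused_base (by simp)] at he ⊢
  rw [mem_words] at he
  have hs : (sv 1 [a]).length = 1 := by simp [sv]
  have := rch_words (ℓ := 1) e.tail (sv 1 [a]) (by simp [he])
  rwa [List.take_append_of_le_length hs.ge, List.take_of_length_le hs.le] at this

/-- the block `w` has no used extension -/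
def Fresh (ℓ : ℕ) (h w : List α) : Prop := ∀ a z, (a :: (w ++ [z])) ∈ unused ℓ h

theorem Inv.opts_fresh {ℓ : ℕ} {h : List α} (hk : 2 ≤ Fintype.card α) (hI : Inv (ℓ + 1) h)
    (hf : Fresh (ℓ + 1) h (h.take ℓ)) : opts (ℓ + 1) h = Finset.univ := by
  ext a
  simp only [Finset.mem_univ, iff_true]
  have hl := hI.len
  obtain ⟨z, hz⟩ : ∃ z, h.take (ℓ + 1) = h.take ℓ ++ [z] :=
    ⟨h[ℓ], by rw [List.take_append_getElem]⟩
  have : Nontrivial α := Fintype.one_lt_card_iff_nontrivial.1 (by omega)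
  obtain ⟨a', ha'⟩ := exists_ne a
  obtain ⟨z', hz'⟩ := exists_ne z
  have hdl : ∀ (w : List α) x y, List.dropLast (x :: (w ++ [y])) = x :: w := by
    intro w x y
    rw [← List.cons_append, List.dropLast_concat]
  rw [mem_opts, hz]
  refine ⟨hf a z, ?_⟩
  refine fresh_good (v := h.take (ℓ + 1)) (f := a' :: (h.take ℓ ++ [z]))
    (g := a :: (h.take ℓ ++ [z'])) (k := a' :: (h.take ℓ ++ [z'])) hI.bal hI.good (hf _ _)
    hz.symm (hf _ _) hz.symm ?_ (hf _ _) (hf _ _) rfl ?_ ?_ ?_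
  · simpa using ha'
  · rw [hz]; simpa using hz'
  · rw [hdl, hdl]
  · rw [hdl, hdl]

open Classical in
/-- number of fresh blocks -/
noncomputable def nfresh (ℓ : ℕ) (h : List α) : ℕ :=
  ((words α ℓ).filter (fun w => Fresh (ℓ + 1) h w)).card

theorem Inv.nfresh_step {ℓ : ℕ} {h : List α} (hk : Fintype.card α = 2) (hI : Inv (ℓ + 1) h)
    (hne : (opts (ℓ + 1) h).Nonempty) (a : α) :
    (2 : ℕ) ^ nfresh ℓ h ≤ (opts (ℓ + 1) h).card * 2 ^ nfresh ℓ (a :: h) := by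
  classical
  have hl := hI.len
  have hz : h.take (ℓ + 1) = h.take ℓ ++ [h[ℓ]] := by rw [List.take_append_getElem]
  have key : ∀ w, Fresh (ℓ + 1) h w → w ≠ h.take ℓ → Fresh (ℓ + 1) (a :: h) w := by
    intro w hw hne x y
    rw [unused_cons hl, Finset.mem_erase]
    refine ⟨?_, hw x y⟩
    rw [hz]
    intro hc
    rw [List.cons.injEq] at hc
    exact hne (List.append_inj' hc.2 rfl).1
  have hpos := Finset.card_pos.2 hne
  by_cases hf : Fresh (ℓ + 1) h (h.take ℓ)
  · rw [hI.opts_fresh (by omega) hf, Finset.card_univ, hk, ← pow_succ']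
    refine Nat.pow_le_pow_right (by norm_num) ?_
    unfold nfresh
    have hsub : (words α ℓ).filter (fun w => Fresh (ℓ + 1) h w) ⊆
        insert (h.take ℓ) ((words α ℓ).filter (fun w => Fresh (ℓ + 1) (a :: h) w)) := by
      intro w hw
      rw [Finset.mem_filter] at hw
      rw [Finset.mem_insert, Finset.mem_filter]
      by_cases hc : w = h.take ℓ
      · exact Or.inl hc
      · exact Or.inr ⟨hw.1, key w hw.2 hc⟩
    exact (Finset.card_le_card hsub).trans (Finset.card_insert_le _ _)
  · have : nfresh ℓ h ≤ nfresh ℓ (a :: h) := by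
      refine Finset.card_le_card ?_
      intro w hw
      rw [Finset.mem_filter] at hw ⊢
      refine ⟨hw.1, key w hw.2 ?_⟩
      rintro rfl
      exact hf hw.2
    have := Nat.pow_le_pow_right (n := 2) (by norm_num) this
    exact this.trans (Nat.le_mul_of_pos_left _ hpos)

theorem nfresh_le {ℓ : ℕ} {h : List α} (hk : Fintype.card α = 2) :
    4 * nfresh ℓ h ≤ (unused (ℓ + 1) h).card := by
  classical
  unfold nfresh
  set S := (words α ℓ).filter (fun w => Fresh (ℓ + 1) h w) with hS
  have : (S ×ˢ (Finset.univ : Finset (α × α))).card ≤ (unused (ℓ + 1) h).card := by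
    refine Finset.card_le_card_of_injOn (fun t => t.2.1 :: (t.1 ++ [t.2.2])) ?_ ?_
    · rintro ⟨w, a, z⟩ ht
      simp only [Finset.coe_product, Set.mem_prod, Finset.mem_coe, hS, Finset.mem_filter] at ht
      exact ht.1.2 a z
    · rintro ⟨w, a, z⟩ - ⟨w', a', z'⟩ - hh
      simp only [List.cons.injEq] at hh
      have := List.append_inj' hh.2 rfl
      simp_all
  rw [Finset.card_product, Finset.card_univ, Fintype.card_prod, hk] at this
  omega

theorem nfresh_ge {ℓ : ℕ} {h : List α} (hI : Inv (ℓ + 1) h) :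
    Fintype.card α ^ ℓ + (ℓ + 1) ≤ nfresh ℓ h + h.length := by
  classical
  have h1 := card_unused hI.len hI.norep
  have h2 : ((words α (ℓ + 2)).filter (fun e => e <:+: h)).card + (unused (ℓ + 1) h).card
      = Fintype.card α ^ (ℓ + 2) := by
    rw [← card_words, unused, Finset.card_filter_add_card_filter_not]
  have h3 : ((words α ℓ).filter (fun w => ¬ Fresh (ℓ + 1) h w)).card ≤
      ((words α (ℓ + 2)).filter (fun e => e <:+: h)).card := by
    have : (words α ℓ).filter (fun w => ¬ Fresh (ℓ + 1) h w) ⊆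
      ((words α (ℓ + 2)).filter (fun e => e <:+: h)).image (fun e => e.tail.dropLast) := by
      intro w hw
      rw [Finset.mem_filter, mem_words] at hw
      unfold Fresh at hw
      push Not at hw
      obtain ⟨hw1, a, z, haz⟩ := hw
      rw [mem_unused] at haz
      rw [Finset.mem_image]
      refine ⟨a :: (w ++ [z]), ?_, by simp⟩
      rw [Finset.mem_filter, mem_words]
      refine ⟨by simp [hw1], ?_⟩
      by_contra hc
      exact haz ⟨by simp [hw1], hc⟩
    exact (Finset.card_le_card this).trans Finset.card_image_le
  have h4 : nfresh ℓ h + ((words α ℓ).filter (fun w => ¬ Fresh (ℓ + 1) h w)).card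
     = Fintype.card α ^ ℓ := by
    rw [← card_words, nfresh, Finset.card_filter_add_card_filter_not]
  rw [show ℓ + 1 + 1 = ℓ + 2 by ring] at h1
  omega

/-! ### Potential for alphabets with at least three letters -/

/-- product of factorials -/
def fpot (ℓ : ℕ) (h : List α) : ℕ := ∏ u ∈ words α ℓ, (deg ℓ h u - 1).factorial

theorem deg_cons_self {ℓ : ℕ} {h : List α} (hl : ℓ ≤ h.length) {a : α}
    (ha : (a :: h.take ℓ) ∈ unused ℓ h) :
    deg ℓ (a :: h) (h.take ℓ) + 1 = deg ℓ h (h.take ℓ) := by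
  unfold deg
  rw [unused_cons hl]
  have : (Finset.univ.filter (fun b => (b :: h.take ℓ) ∈ (unused ℓ h).erase (a :: h.take ℓ)))
     = (Finset.univ.filter (fun b => (b :: h.take ℓ) ∈ unused ℓ h)).erase a := by
    ext b; simp
  rw [this, Finset.card_erase_add_one]
  simpa using ha

theorem deg_cons_ne {ℓ : ℕ} {h : List α} (hl : ℓ ≤ h.length) {a : α} {u : List α}
    (hu : u ≠ h.take ℓ) : deg ℓ (a :: h) u = deg ℓ h u := by
  unfold deg
  rw [unused_cons hl]
  congr 1
  ext b; simp [hu]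

theorem Inv.fpot_step {ℓ : ℕ} {h : List α} (hI : Inv ℓ h) {a : α} (ha : a ∈ opts ℓ h) :
    fpot ℓ h ≤ (opts ℓ h).card * fpot ℓ (a :: h) := by
  have hmem : h.take ℓ ∈ words α ℓ := by rw [mem_words]; simp [hI.len]
  unfold fpot
  rw [← Finset.mul_prod_erase _ _ hmem, ← Finset.mul_prod_erase _ _ hmem, ← mul_assoc]
  have h1 : ∏ u ∈ (words α ℓ).erase (h.take ℓ), (deg ℓ h u - 1).factorial =
      ∏ u ∈ (words α ℓ).erase (h.take ℓ), (deg ℓ (a :: h) u - 1).factorial := by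
    refine Finset.prod_congr rfl ?_
    intro u hu
    rw [deg_cons_ne hI.len (Finset.ne_of_mem_erase hu)]
  rw [h1]
  refine Nat.mul_le_mul_right _ ?_
  have h2 := deg_cons_self hI.len (mem_opts.1 ha).1
  have h3 := hI.deg_le
  have h4 := Finset.card_pos.2 ⟨a, ha⟩
  rw [← h2] at h3 ⊢
  rw [Nat.add_sub_cancel]
  cases hd : deg ℓ (a :: h) (h.take ℓ) with
  | zero => simpa using h4
  | succ d =>
    rw [Nat.add_sub_cancel, Nat.factorial_succ]
    exact Nat.mul_le_mul_right _ (by omega)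

theorem sum_deg {ℓ : ℕ} {h : List α} : ∑ u ∈ words α ℓ, deg ℓ h u = (unused ℓ h).card := by
  rw [Finset.card_eq_sum_card_fiberwise (f := List.tail) (t := words α ℓ)]
  · refine Finset.sum_congr rfl ?_
    intro u hu
    unfold deg
    refine Finset.card_nbij (fun a => a :: u) ?_ ?_ ?_
    · intro a ha
      simpa using ha
    · intro a _ b _ hab
      simpa using hab
    · intro e he
      simp only [Finset.coe_filter, Set.mem_ofPred_eq] at he
      cases e with
      | nil => have := (mem_unused.1 he.1).1; simp at this
      | cons a e =>
        refine ⟨a, ?_, ?_⟩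
        · have : e = u := he.2
          subst this
          simpa using he.1
        · have : e = u := he.2
          simp [this]
  · intro e he
    have := (mem_unused.1 he).1
    simp [mem_words, this]

theorem deg_le_card {ℓ : ℕ} {h u : List α} : deg ℓ h u ≤ Fintype.card α := by
  unfold deg; exact Finset.card_le_univ _

theorem deg_ge {ℓ r : ℕ} {h u : List α} (hn : NoRep r h) (hu : u.length = ℓ) (hr : r ≤ ℓ) :
    Fintype.card α ≤ deg ℓ h u + 1 := by
  unfold deg
  have h1 : (Finset.univ.filter (fun a : α => ¬ (a :: u) ∈ unused ℓ h)).card ≤ 1 := by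
    rw [Finset.card_le_one]
    intro a ha b hb
    simp only [Finset.mem_filter, Finset.mem_univ, true_and, mem_unused, List.length_cons, hu,
      not_not] at ha hb
    exact hn.uniq_src (by omega) ha hb
  have h2 := Finset.card_filter_add_card_filter_not (s := (Finset.univ : Finset α))
    (fun a : α => (a :: u) ∈ unused ℓ h)
  rw [Finset.card_univ] at h2
  omega

theorem deg_mono {ℓ : ℕ} {h h' u : List α} (hh : h <:+: h') : deg ℓ h' u ≤ deg ℓ h u := by
  unfold deg
  refine Finset.card_le_card ?_
  intro a ha
  simp only [Finset.mem_filter, Finset.mem_univ, true_and, mem_unused] at ha ⊢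
  exact ⟨ha.1, fun hc => ha.2 (hc.trans hh)⟩

theorem fact_ineq {c s : ℝ} (hc : 0 ≤ c) (hs : 0 ≤ s) {d d' : ℕ} (hd : d' ≤ d)
    (h : c * d - s ≤ Real.log ((d - 1).factorial : ℕ)) :
    c * ((d : ℝ) - d') - s ≤ Real.log ((d - 1).factorial : ℕ) - Real.log ((d' - 1).factorial : ℕ) := by
  cases d' with
  | zero => simpa using h
  | succ m =>
    cases d with
    | zero => omega
    | succ n =>
      simp only [Nat.add_sub_cancel] at h ⊢
      push_cast at h ⊢
      have hm : m ≤ n := by omega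
      have hmn : (m : ℝ) ≤ n := by exact_mod_cast hm
      rcases le_total c (Real.log (m + 1)) with h1 | h1
      · have h2 := Nat.factorial_mul_pow_le_factorial (m := m) (n := n - m)
        rw [Nat.add_sub_cancel' hm] at h2
        have h3 : Real.log ((m.factorial : ℝ) * (m + 1) ^ (n - m)) ≤ Real.log (n.factorial) := by
          apply Real.log_le_log
          · positivity
          · exact_mod_cast h2
        rw [Real.log_mul (by positivity) (by positivity), Real.log_pow, Nat.cast_sub hm] at h3
        nlinarith [mul_le_mul_of_nonneg_left h1 (sub_nonneg.2 hmn)]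
      · have h2 : (m.factorial : ℝ) ≤ (m + 1) ^ m := by
          have := (Nat.factorial_le_pow m).trans (Nat.pow_le_pow_left (Nat.le_succ m) m)
          exact_mod_cast this
        have h3 := Real.log_le_log (by positivity) h2
        rw [Real.log_pow] at h3
        have : (0 : ℝ) ≤ m := by positivity
        nlinarith

theorem fpot_diff {ℓ r : ℕ} {h h' : List α} (hn : NoRep r h) (hr : r ≤ ℓ) (hh : h <:+: h')
    (hI : Inv ℓ h) (hI' : Inv ℓ h') {c R : ℝ} (hc : 0 ≤ c) (hR : 1 ≤ R)
    (hk1 : c * Fintype.card α ≤ Real.log ((Fintype.card α - 1).factorial : ℕ))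
    (hk2 : c * (Fintype.card α - 1 : ℕ) - (R - 1) * c ≤
      Real.log ((Fintype.card α - 1 - 1).factorial : ℕ)) :
    c * (h'.length - R * h.length) ≤ Real.log (fpot ℓ h) - Real.log (fpot ℓ h') := by
  have hlog : ∀ g : List α, Real.log (fpot ℓ g) =
      ∑ u ∈ words α ℓ, Real.log ((deg ℓ g u - 1).factorial : ℕ) := by
    intro g
    unfold fpot
    push_cast
    rw [Real.log_prod]
    intro u _
    positivity
  have hterm : ∀ u ∈ words α ℓ,
      c * ((deg ℓ h u : ℝ) - deg ℓ h' u) - (R - 1) * c * (Fintype.card α - deg ℓ h u) ≤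
      Real.log ((deg ℓ h u - 1).factorial : ℕ) - Real.log ((deg ℓ h' u - 1).factorial : ℕ) := by
    intro u hu
    rw [mem_words] at hu
    have h1 := deg_ge hn hu hr
    have h2 := deg_le_card (ℓ := ℓ) (h := h) (u := u)
    have hp : 0 ≤ (R - 1) * c := mul_nonneg (by linarith) hc
    have h2' : (deg ℓ h u : ℝ) ≤ Fintype.card α := by exact_mod_cast h2
    refine fact_ineq hc (mul_nonneg hp (by linarith)) (deg_mono hh) ?_
    have h3 : deg ℓ h u = Fintype.card α ∨ (deg ℓ h u = Fintype.card α - 1 ∧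
      deg ℓ h u + 1 = Fintype.card α) := by omega
    rcases h3 with h3 | ⟨h3, h4⟩
    · rw [h3]; linarith
    · rw [← h3] at hk2
      have h5 : (Fintype.card α : ℝ) = deg ℓ h u + 1 := by exact_mod_cast h4.symm
      rw [h5]; linarith
  have hsum := Finset.sum_le_sum hterm
  rw [Finset.sum_sub_distrib, Finset.sum_sub_distrib, ← Finset.mul_sum, ← Finset.mul_sum,
    Finset.sum_sub_distrib, Finset.sum_sub_distrib, Finset.sum_const, card_words,
    ← hlog, ← hlog] at hsum
  have e1 : ∀ g : List α, ∑ u ∈ words α ℓ, (deg ℓ g u : ℝ) = (unused ℓ g).card := by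
    intro g; rw [← sum_deg]; push_cast; rfl
  rw [e1, e1] at hsum
  have c1 := card_unused hI.len hI.norep
  have c2 := card_unused hI'.len hI'.norep
  have c1' : ((unused ℓ h).card : ℝ) + h.length = (Fintype.card α : ℝ) ^ (ℓ + 1) + ℓ := by
    exact_mod_cast c1
  have c2' : ((unused ℓ h').card : ℝ) + h'.length = (Fintype.card α : ℝ) ^ (ℓ + 1) + ℓ := by
    exact_mod_cast c2
  refine le_trans ?_ hsum
  rw [nsmul_eq_mul, Nat.cast_pow, ← pow_succ]
  have e2 : ((unused ℓ h).card : ℝ) = (Fintype.card α : ℝ) ^ (ℓ + 1) + ℓ - h.length := by linarith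
  have e3 : ((unused ℓ h').card : ℝ) = (Fintype.card α : ℝ) ^ (ℓ + 1) + ℓ - h'.length := by linarith
  rw [e2, e3]
  have : 0 ≤ (R - 1) * c * ℓ := by
    have : 0 ≤ R - 1 := by linarith
    positivity
  nlinarith

/-- potential functions -/
structure IsPot (c R : ℝ) (P : ℕ → List α → ℝ) : Prop where
  step : ∀ ℓ h, Inv (ℓ + 1) h → ∀ a ∈ opts (ℓ + 1) h,
    P ℓ h ≤ Real.log (opts (ℓ + 1) h).card + P ℓ (a :: h)
  diff : ∀ ℓ r h h', NoRep r h → r ≤ ℓ + 1 → h <:+: h' → Inv (ℓ + 1) h → Inv (ℓ + 1) h' →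
    c * (h'.length - R * h.length) ≤ P ℓ h - P ℓ h'

theorem isPot_fpot {c R : ℝ} (hc : 0 ≤ c) (hR : 1 ≤ R)
    (hk1 : c * Fintype.card α ≤ Real.log ((Fintype.card α - 1).factorial : ℕ))
    (hk2 : c * (Fintype.card α - 1 : ℕ) - (R - 1) * c ≤
      Real.log ((Fintype.card α - 1 - 1).factorial : ℕ)) :
    IsPot (α := α) c R (fun ℓ h => Real.log (fpot (ℓ + 1) h)) where
  step := by
    intro ℓ h hI a ha
    have h1 := hI.fpot_step ha
    have hp : ∀ g : List α, 0 < fpot (ℓ + 1) g := fun g =>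
      Finset.prod_pos (fun u _ => Nat.factorial_pos _)
    have h0 := hp h
    have h2 := hp (a :: h)
    have h3 := Finset.card_pos.2 ⟨a, ha⟩
    rw [← Real.log_mul (by positivity) (by positivity)]
    exact Real.log_le_log (by positivity) (by exact_mod_cast h1)
  diff := by
    intro ℓ r h h' hn hr hh hI hI'
    exact fpot_diff hn hr hh hI hI' hc hR hk1 hk2

theorem isPot_fresh (hk : Fintype.card α = 2) :
    IsPot (α := α) (Real.log 2 / 4) 4 (fun ℓ h => Real.log 2 * nfresh ℓ h) where
  step := by
    intro ℓ h hI a ha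
    have h1 := hI.nfresh_step hk ⟨a, ha⟩ a
    have h3 := Finset.card_pos.2 ⟨a, ha⟩
    have h4 : Real.log ((2 : ℝ) ^ nfresh ℓ h) ≤
        Real.log (((opts (ℓ + 1) h).card : ℝ) * 2 ^ nfresh ℓ (a :: h)) :=
      Real.log_le_log (by positivity) (by exact_mod_cast h1)
    rw [Real.log_mul (by positivity) (by positivity), Real.log_pow, Real.log_pow] at h4
    linarith
  diff := by
    intro ℓ r h h' hn hr hh hI hI'
    have h1 := nfresh_ge hI
    have h2 := nfresh_le (ℓ := ℓ) (h := h') hk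
    have h3 := card_unused hI'.len hI'.norep
    rw [hk] at h1 h3
    rw [show ℓ + 1 + 1 = ℓ + 2 by ring, pow_add] at h3
    have h4 : h'.length + 4 * nfresh ℓ h' ≤ 4 * nfresh ℓ h + 4 * h.length := by omega
    have h5 : (h'.length : ℝ) + 4 * nfresh ℓ h' ≤ 4 * nfresh ℓ h + 4 * h.length := by
      exact_mod_cast h4
    have h6 : 0 < Real.log 2 := Real.log_pos (by norm_num)
    nlinarith

end Pot
end SBA

namespace SBA

section Tree
variable {α : Type*} [Fintype α] [DecidableEq α]

/-- history, newest letter first -/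
def hist (ω : ℕ → α) : ℕ → List α
  | 0 => []
  | n + 1 => ω n :: hist ω n

theorem length_hist (ω : ℕ → α) (n : ℕ) : (hist ω n).length = n := by
  induction n with
  | zero => rfl
  | succ n ih => simp [hist, ih]

theorem hist_add (ω : ℕ → α) (a x : ℕ) :
    hist ω (a + x) = hist (fun t => ω (a + t)) x ++ hist ω a := by
  induction x with
  | zero => simp [hist]
  | succ x ih => rw [← add_assoc, hist, hist, ih]; rfl

theorem hist_congr {ω ω' : ℕ → α} {n : ℕ} (h : ∀ i < n, ω i = ω' i) : hist ω n = hist ω' n := by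
  induction n with
  | zero => rfl
  | succ n ih => rw [hist, hist, ih (fun i hi => h i (by omega)), h n (by omega)]

theorem hist_infix (ω : ℕ → α) {m n : ℕ} (h : m ≤ n) : hist ω m <:+: hist ω n := by
  obtain ⟨x, rfl⟩ := Nat.exists_eq_add_of_le h
  rw [hist_add]
  exact (List.suffix_append _ _).isInfix

theorem NoRep.of_hist {r : ℕ} {ω : ℕ → α} {m n : ℕ} (h : m ≤ n) (hn : NoRep r (hist ω n)) :
    NoRep r (hist ω m) := by
  induction n with
  | zero => have : m = 0 := by omega
            subst this; exact hn
  | succ n ih =>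
    rcases Nat.lt_or_ge n m with h1 | h1
    · have : m = n + 1 := by omega
      subst this; exact hn
    · exact ih h1 hn.1

theorem NoRep.hist_ne {x n i p : ℕ} {ω : ℕ → α} (hn : NoRep x (hist ω n)) (hx : 0 < x) (hp : 0 < p)
    (hl : i + p + x ≤ n) : ∃ j < x, ω (i + p + j) ≠ ω (i + j) := by
  by_contra! hc
  have h1 := hn.of_hist hl
  obtain ⟨y, rfl⟩ : ∃ y, x = y + 1 := ⟨x - 1, by omega⟩
  have h2 : NoRep (y + 1) (ω (i + p + y) :: hist ω (i + p + y)) := h1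
  apply h2.2
  have h3 : ω (i + p + y) :: hist ω (i + p + y) = hist ω (i + p + (y + 1)) := rfl
  rw [h3, hist_add, List.take_append_of_le_length (by rw [length_hist]),
    List.take_of_length_le (by rw [length_hist])]
  have h4 : hist (fun t => ω (i + p + t)) (y + 1) = hist (fun t => ω (i + t)) (y + 1) :=
    hist_congr hc
  rw [h4]
  refine List.IsInfix.trans ?_ (hist_infix ω (show i + (y + 1) ≤ i + p + y by omega))
  rw [hist_add ω i (y + 1)]
  exact (List.prefix_append _ _).isInfix

/-- phase index -/
def ph (k n : ℕ) : ℕ := (Nat.log k n + 1) / 3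

theorem lt_ph {k n : ℕ} (hk : 2 ≤ k) : n < k ^ (3 * ph k n + 1 + 1) := by
  have h1 := Nat.lt_pow_succ_log_self (b := k) (by omega) n
  refine h1.trans_le (Nat.pow_le_pow_right (by omega) ?_)
  unfold ph; omega

theorem ph_succ {k n : ℕ} (hk : 2 ≤ k) :
    ph k (n + 1) = ph k n ∨ (ph k (n + 1) = ph k n + 1 ∧ 3 * ph k n + 1 + 3 ≤ n + 1) := by
  have h1 : Nat.log k n ≤ Nat.log k (n + 1) := Nat.log_mono_right (by omega)
  have h2 : Nat.log k (n + 1) < Nat.log k n + 2 := by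
    apply Nat.log_lt_of_lt_pow (by omega)
    have := Nat.lt_pow_succ_log_self (b := k) (by omega) n
    have h3 : 1 ≤ k ^ (Nat.log k n + 1) := Nat.one_le_pow _ _ (by omega)
    rw [pow_succ k (Nat.log k n + 1)]
    have h4 := Nat.mul_le_mul_left (k ^ (Nat.log k n + 1)) hk
    rw [Nat.succ_eq_add_one] at this
    omega
  unfold ph
  by_cases h : (Nat.log k (n + 1) + 1) / 3 = (Nat.log k n + 1) / 3
  · exact Or.inl h
  · right
    refine ⟨by omega, ?_⟩
    have h3 : 2 ≤ Nat.log k (n + 1) := by omega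
    have h4 := Nat.pow_log_le_self k (x := n + 1) (by omega)
    have h5 : ∀ L, 2 ≤ L → L + 2 ≤ 2 ^ L := by
      intro L hL
      induction L, hL using Nat.le_induction with
      | base => norm_num
      | succ L hL ih => rw [pow_succ]; omega
    have h6 := h5 _ h3
    have h7 : 2 ^ Nat.log k (n + 1) ≤ k ^ Nat.log k (n + 1) := Nat.pow_le_pow_left hk _
    omega

theorem ph_eq {k n m : ℕ} (hk : 2 ≤ k) (h1 : k ^ (3 * m + 2) ≤ n) (h2 : n < k ^ (3 * m + 5)) :
    ph k n = m + 1 := by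
  have h0 : 0 < k ^ (3 * m + 2) := Nat.pow_pos (by omega)
  have h3 : 3 * m + 2 ≤ Nat.log k n := Nat.le_log_of_pow_le (by omega) h1
  have h4 : Nat.log k n < 3 * m + 5 := Nat.log_lt_of_lt_pow (by omega) h2
  unfold ph; omega

open Classical in
/-- the tree of admissible letters -/
noncomputable def tree (h : List α) : Finset α :=
  if (h ≠ [] ∧ (opts (3 * ph (Fintype.card α) h.length + 1) h).Nonempty) then
    opts (3 * ph (Fintype.card α) h.length + 1) h else Finset.univ

theorem tree_nonempty [Nonempty α] (h : List α) : (tree h).Nonempty := by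
  unfold tree
  split_ifs with h1
  · exact h1.2
  · exact Finset.univ_nonempty

theorem tree_inv {ω : ℕ → α} (hk : 2 ≤ Fintype.card α) (hω : ∀ n, ω n ∈ tree (hist ω n)) (n : ℕ) :
    Inv (3 * ph (Fintype.card α) (n + 1) + 1) (hist ω (n + 1)) ∧
    tree (hist ω (n + 1)) = opts (3 * ph (Fintype.card α) (n + 1) + 1) (hist ω (n + 1)) ∧
    Inv (3 * ph (Fintype.card α) (n + 1) + 1) (hist ω (n + 2)) := by
  have key : ∀ n, Inv (3 * ph (Fintype.card α) (n + 1) + 1) (hist ω (n + 1)) →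
    tree (hist ω (n + 1)) = opts (3 * ph (Fintype.card α) (n + 1) + 1) (hist ω (n + 1)) ∧
    Inv (3 * ph (Fintype.card α) (n + 1) + 1) (hist ω (n + 2)) := by
    intro n hI
    have hne := hI.opts_nonempty (by rw [length_hist]; exact lt_ph hk)
    have ht : tree (hist ω (n + 1)) =
        opts (3 * ph (Fintype.card α) (n + 1) + 1) (hist ω (n + 1)) := by
      unfold tree
      rw [length_hist, if_pos ⟨by simp [hist], hne⟩]
    refine ⟨ht, ?_⟩
    have := hω (n + 1)
    rw [ht] at this
    exact hI.step this
  have base : Inv (3 * ph (Fintype.card α) (n + 1) + 1) (hist ω (n + 1)) := by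
    induction n with
    | zero =>
      have : ph (Fintype.card α) (0 + 1) = 0 := by simp [ph]
      rw [this]
      exact inv_single hk _
    | succ n ih =>
      have h1 := (key n ih).2
      rcases ph_succ (n := n + 1) hk with h2 | ⟨h2, h3⟩
      · rw [h2]; exact h1
      · rw [h2]
        exact h1.next hk (by rw [length_hist]; exact h3)
  exact ⟨base, key n base⟩

/-- log of the number of choices -/
noncomputable def logD (O : List α → Finset α) (ω : ℕ → α) (n : ℕ) : ℝ :=
  ∑ i ∈ Finset.range n, Real.log (O (hist ω i)).card

theorem logD_mono {O : List α → Finset α} {ω : ℕ → α} {m n : ℕ} (h : m ≤ n) :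
    logD O ω m ≤ logD O ω n := by
  unfold logD
  refine Finset.sum_le_sum_of_subset_of_nonneg (Finset.range_subset_range.2 h) ?_
  intro i _ _
  exact Real.log_natCast_nonneg _

theorem phase_bound {ω : ℕ → α} (hk : 2 ≤ Fintype.card α) (hω : ∀ n, ω n ∈ tree (hist ω n))
    {c R : ℝ} {P : ℕ → List α → ℝ} (hP : IsPot c R P) {m n : ℕ}
    (h1 : Fintype.card α ^ (3 * m + 2) ≤ n) (h2 : n ≤ Fintype.card α ^ (3 * m + 5)) :
    c * (n - R * (Fintype.card α : ℝ) ^ (3 * m + 2)) ≤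
      logD tree ω n - logD tree ω (Fintype.card α ^ (3 * m + 2)) := by
  set k := Fintype.card α with hkdef
  set T := k ^ (3 * m + 2) with hT
  have hT0 : 0 < T := Nat.pow_pos (by omega)
  have hT5 : T < k ^ (3 * m + 5) := Nat.pow_lt_pow_right (by omega) (by omega)
  have hphT : ph k T = m + 1 := ph_eq hk le_rfl hT5
  have tel : ∀ n, T ≤ n → n ≤ k ^ (3 * m + 5) → Inv (3 * (m + 1) + 1) (hist ω n) ∧
      P (3 * (m + 1)) (hist ω T) ≤ logD tree ω n - logD tree ω T + P (3 * (m + 1)) (hist ω n) := by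
    intro n hn
    induction n, hn using Nat.le_induction with
    | base =>
      intro _
      obtain ⟨t, ht⟩ : ∃ t, T = t + 1 := ⟨T - 1, by omega⟩
      have := (tree_inv hk hω t).1
      rw [← hkdef, ← ht, hphT] at this
      exact ⟨this, by simp⟩
    | succ n hn ih =>
      intro hle
      obtain ⟨hI, hb⟩ := ih (by omega)
      obtain ⟨t, ht⟩ : ∃ t, n = t + 1 := ⟨n - 1, by omega⟩
      obtain ⟨-, h4, h5⟩ := tree_inv hk hω t
      rw [show t + 2 = n + 1 by omega, ← ht, ← hkdef, ph_eq hk hn (by omega)] at h5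
      rw [← ht, ← hkdef, ph_eq hk hn (by omega)] at h4
      refine ⟨h5, ?_⟩
      have h6 := hω n
      rw [h4] at h6
      have h7 := hP.step _ _ hI _ h6
      have h8 : logD tree ω (n + 1) = logD tree ω n +
          Real.log (opts (3 * (m + 1) + 1) (hist ω n)).card := by
        unfold logD
        rw [Finset.sum_range_succ, h4]
      have h9 : hist ω (n + 1) = ω n :: hist ω n := rfl
      rw [h9, h8]
      linarith
  obtain ⟨hI1, -⟩ := tel T le_rfl hT5.le
  obtain ⟨hI2, hb⟩ := tel n h1 h2
  have hnr : NoRep (3 * m + 1 + 1) (hist ω T) := by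
    obtain ⟨t, ht⟩ : ∃ t, T = t + 2 := ⟨T - 2, by
      have : 2 ≤ k ^ (3 * m + 2) := hk.trans (Nat.le_self_pow (by omega) k)
      omega⟩
    have := (tree_inv hk hω t).2.2.norep
    rw [← ht] at this
    refine this.mono ?_
    have h3 : t + 1 < k ^ (3 * m + 2) := by omega
    have h4 : Nat.log k (t + 1) < 3 * m + 2 := Nat.log_lt_of_lt_pow (by omega) h3
    rw [← hkdef]
    unfold ph; omega
  have h3 := hP.diff _ _ _ _ hnr (by omega) (hist_infix ω h1) hI1 hI2
  rw [length_hist, length_hist] at h3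
  have h4 : (T : ℝ) = (k : ℝ) ^ (3 * m + 2) := by rw [hT]; push_cast; rfl
  rw [← h4]
  linarith

theorem entropy_bound {ω : ℕ → α} (hk : 2 ≤ Fintype.card α) (hω : ∀ n, ω n ∈ tree (hist ω n))
    {c R e : ℝ} {P : ℕ → List α → ℝ} (hP : IsPot c R P) (hR : 1 ≤ R) (he : 0 ≤ e)
    (hec : e ≤ c * R) (hcon : e * ((Fintype.card α : ℝ) ^ 3 - 1) ≤ c * ((Fintype.card α : ℝ) ^ 3 - R))
    (n : ℕ) : e / R * n - e * (Fintype.card α : ℝ) ^ 2 ≤ logD tree ω n := by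
  set k := Fintype.card α with hkdef
  have hL0 : ∀ n, 0 ≤ logD tree ω n := by
    intro n
    have := logD_mono (O := tree) (ω := ω) (Nat.zero_le n)
    simpa [logD] using this
  have hm : ∀ m, e * (k : ℝ) ^ (3 * m + 2) - e * (k : ℝ) ^ 2 ≤ logD tree ω (k ^ (3 * m + 2)) := by
    intro m
    induction m with
    | zero => simpa using hL0 _
    | succ m ih =>
      have h1 := phase_bound hk hω hP (m := m) (n := k ^ (3 * m + 5))
        (Nat.pow_le_pow_right (by omega) (by omega)) le_rfl
      rw [← hkdef] at h1
      rw [show 3 * (m + 1) + 2 = 3 * m + 5 by ring]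
      have h2 : (k : ℝ) ^ (3 * m + 5) = k ^ 3 * k ^ (3 * m + 2) := by ring
      push_cast at h1
      rw [h2] at h1 ⊢
      have h3 : (0 : ℝ) ≤ (k : ℝ) ^ (3 * m + 2) := by positivity
      nlinarith [mul_le_mul_of_nonneg_right hcon h3]
  have hR0 : 0 < R := by linarith
  rcases Nat.lt_or_ge n (k ^ 2) with h1 | h1
  · have h2 : (n : ℝ) ≤ (k : ℝ) ^ 2 := by exact_mod_cast h1.le
    have h3 : e / R * n ≤ e * k ^ 2 := by
      have : e / R ≤ e := div_le_self he hR
      gcongr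
    linarith [hL0 n]
  · obtain ⟨m, h2, h3⟩ : ∃ m, k ^ (3 * m + 2) ≤ n ∧ n < k ^ (3 * m + 5) := by
      have h2 : 2 ≤ Nat.log k n := Nat.le_log_of_pow_le (by omega) h1
      have hn : n ≠ 0 := by
        have : 0 < k ^ 2 := Nat.pow_pos (by omega)
        omega
      refine ⟨(Nat.log k n - 2) / 3, ?_, ?_⟩
      · exact (Nat.pow_le_pow_right (by omega) (by omega)).trans (Nat.pow_log_le_self k hn)
      · exact (Nat.lt_pow_succ_log_self (by omega) n).trans_le
          (Nat.pow_le_pow_right (by omega) (by omega))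
    have h4 := phase_bound hk hω hP h2 h3.le
    have h5 := hm m
    have h6 := logD_mono (O := tree) (ω := ω) h2
    rw [← hkdef] at h4
    set Tm : ℝ := (k : ℝ) ^ (3 * m + 2) with hTm
    have h7 : e / R ≤ c := by rw [div_le_iff₀ hR0]; exact hec
    have h8 : e / R * (R * Tm) = e * Tm := by field_simp
    rcases le_total (n : ℝ) (R * Tm) with h9 | h9
    · have : e / R * n ≤ e / R * (R * Tm) := by gcongr
      linarith
    · have := mul_le_mul_of_nonneg_right h7 (sub_nonneg.2 h9)
      nlinarith

/-- quantitative aperiodicity -/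
theorem tree_aper {ω : ℕ → α} (hk : 2 ≤ Fintype.card α) (hω : ∀ n, ω n ∈ tree (hist ω n))
    (i p : ℕ) (hp : 0 < p) : ∃ x, Fintype.card α ^ x ≤ Fintype.card α ^ 3 * (16 * (i + p)) ∧
      ∃ j < x, ω (i + p + j) ≠ ω (i + j) := by
  set k := Fintype.card α with hkdef
  obtain ⟨t, ht⟩ : ∃ t, 16 * (i + p) = t + 1 := ⟨16 * (i + p) - 1, by omega⟩
  have hn := (tree_inv hk hω t).1.norep
  rw [← ht, ← hkdef] at hn
  have hlog : Nat.log k (16 * (i + p)) < i + p + 4 := by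
    apply Nat.log_lt_of_lt_pow (by omega)
    have h1 : i + p < 2 ^ (i + p) := Nat.lt_two_pow_self
    calc 16 * (i + p) < 2 ^ (i + p + 4) := by rw [pow_add]; omega
      _ ≤ k ^ (i + p + 4) := Nat.pow_le_pow_left hk _
  have hx : 3 * ph k (16 * (i + p)) + 1 + 1 ≤ Nat.log k (16 * (i + p)) + 3 := by unfold ph; omega
  refine ⟨_, ?_, hn.hist_ne (by omega) hp (by omega)⟩
  calc k ^ (3 * ph k (16 * (i + p)) + 1 + 1) ≤ k ^ (Nat.log k (16 * (i + p)) + 3) :=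
        Nat.pow_le_pow_right (by omega) hx
    _ = k ^ 3 * k ^ Nat.log k (16 * (i + p)) := by rw [pow_add, mul_comm]
    _ ≤ _ := Nat.mul_le_mul_left _ (Nat.pow_log_le_self k (by omega))

end Tree
end SBA

namespace SBA

section Dim
variable {α : Type*} [Fintype α] [DecidableEq α] [Nonempty α]

open Classical in
/-- the `j`-th element of a finite set -/
noncomputable def pick (s : Finset α) (j : ℕ) : α :=
  if h : j < s.card then (s.equivFin.symm ⟨j, h⟩ : s) else Classical.arbitrary α

theorem pick_mem {s : Finset α} {j : ℕ} (h : j < s.card) : pick s j ∈ s := by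
  unfold pick
  rw [dif_pos h]
  exact Subtype.property _

theorem pick_inj {s : Finset α} {i j : ℕ} (hi : i < s.card) (hj : j < s.card)
    (h : pick s i = pick s j) : i = j := by
  unfold pick at h
  rw [dif_pos hi, dif_pos hj] at h
  simpa using h

/-- state of the greedy digit expansion -/
noncomputable def gst (O : List α → Finset α) (y : ℝ) : ℕ → List α × ℝ
  | 0 => ([], y)
  | n + 1 =>
    (pick (O (gst O y n).1) ⌊((O (gst O y n).1).card : ℝ) * (gst O y n).2⌋₊ :: (gst O y n).1,
      ((O (gst O y n).1).card : ℝ) * (gst O y n).2 -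
        ⌊((O (gst O y n).1).card : ℝ) * (gst O y n).2⌋₊)

/-- greedy digits -/
noncomputable def gw (O : List α → Finset α) (y : ℝ) (n : ℕ) : α :=
  pick (O (gst O y n).1) ⌊((O (gst O y n).1).card : ℝ) * (gst O y n).2⌋₊

theorem hist_gw (O : List α → Finset α) (y : ℝ) (n : ℕ) : hist (gw O y) n = (gst O y n).1 := by
  induction n with
  | zero => rfl
  | succ n ih => rw [hist, ih, gst, gw]

theorem gst_mem {O : List α → Finset α} (hO : ∀ h, (O h).Nonempty) {y : ℝ} (hy : y ∈ Set.Ico (0 : ℝ) 1)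
    (n : ℕ) : (gst O y n).2 ∈ Set.Ico (0 : ℝ) 1 := by
  induction n with
  | zero => exact hy
  | succ n ih =>
    rw [gst]
    have h0 : 0 ≤ ((O (gst O y n).1).card : ℝ) * (gst O y n).2 := mul_nonneg (by positivity) ih.1
    have h1 := Nat.floor_le h0
    have h2 := Nat.lt_floor_add_one (((O (gst O y n).1).card : ℝ) * (gst O y n).2)
    constructor
    · simp only; linarith
    · simp only; linarith

theorem floor_lt' {O : List α → Finset α} (hO : ∀ h, (O h).Nonempty) {y : ℝ} (hy : y ∈ Set.Ico (0 : ℝ) 1)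
    (n : ℕ) : ⌊((O (gst O y n).1).card : ℝ) * (gst O y n).2⌋₊ < (O (gst O y n).1).card := by
  have h := gst_mem hO hy n
  have h1 : (0 : ℝ) < (O (gst O y n).1).card := by
    exact_mod_cast Finset.card_pos.2 (hO _)
  rw [Nat.floor_lt (mul_nonneg h1.le h.1)]
  nlinarith [h.2]

theorem gw_mem {O : List α → Finset α} (hO : ∀ h, (O h).Nonempty) {y : ℝ} (hy : y ∈ Set.Ico (0 : ℝ) 1)
    (n : ℕ) : gw O y n ∈ O (hist (gw O y) n) := by
  rw [hist_gw]
  exact pick_mem (floor_lt' hO hy n)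

theorem gst_diff {O : List α → Finset α} (hO : ∀ h, (O h).Nonempty) {y y' : ℝ}
    (hy : y ∈ Set.Ico (0 : ℝ) 1) (hy' : y' ∈ Set.Ico (0 : ℝ) 1) (n : ℕ)
    (h : ∀ i < n, gw O y i = gw O y' i) :
    (gst O y n).2 - (gst O y' n).2 = Real.exp (logD O (gw O y) n) * (y - y') := by
  induction n with
  | zero => simp [gst, logD]
  | succ n ih =>
    have ih := ih (fun i hi => h i (by omega))
    have h1 : (gst O y n).1 = (gst O y' n).1 := by
      rw [← hist_gw, ← hist_gw]
      exact hist_congr (fun i hi => h i (by omega))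
    have h2 := h n (by omega)
    unfold gw at h2
    have h3 := floor_lt' hO hy n
    have h4 := floor_lt' hO hy' n
    rw [h1] at h2 h3
    have h5 := pick_inj h3 h4 h2
    have h6 : logD O (gw O y) (n + 1) = logD O (gw O y) n + Real.log (O (gst O y' n).1).card := by
      unfold logD
      rw [Finset.sum_range_succ, hist_gw, h1]
    have h7 : (0 : ℝ) < (O (gst O y' n).1).card := by
      exact_mod_cast Finset.card_pos.2 (hO _)
    rw [gst, gst]
    simp only
    rw [h1, h5, h6, Real.exp_add, Real.exp_log h7]
    linear_combination (O (gst O y' n).1).card * ih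

theorem gw_close {O : List α → Finset α} (hO : ∀ h, (O h).Nonempty) {y y' : ℝ}
    (hy : y ∈ Set.Ico (0 : ℝ) 1) (hy' : y' ∈ Set.Ico (0 : ℝ) 1) (n : ℕ)
    (h : ∀ i < n, gw O y i = gw O y' i) : |y - y'| ≤ Real.exp (- logD O (gw O y) n) := by
  have h1 := gst_diff hO hy hy' n h
  have h2 := gst_mem hO hy n
  have h3 := gst_mem hO hy' n
  have h4 : |(gst O y n).2 - (gst O y' n).2| ≤ 1 := by
    rw [abs_le]; constructor <;> linarith [h2.1, h2.2, h3.1, h3.2]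
  rw [h1, abs_mul, abs_of_pos (Real.exp_pos _)] at h4
  rw [Real.exp_neg, ← one_div, le_div_iff₀ (Real.exp_pos _)]
  linarith

theorem dim_bound {O : List α → Finset α} (hO : ∀ h, (O h).Nonempty) {F : (ℕ → α) → ℝ}
    {B s c₂ K : ℝ} (hB : 1 < B) (hs : 0 < s) (hc₂ : 0 < c₂)
    (hF : ∀ ω ω' : ℕ → α, ∀ n, (∀ i < n, ω i = ω' i) → ω n ≠ ω' n → c₂ * (B ^ n)⁻¹ ≤ |F ω - F ω'|)
    (hD : ∀ ω : ℕ → α, (∀ n, ω n ∈ O (hist ω n)) → ∀ n : ℕ, s * Real.log B * n - K ≤ logD O ω n) :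
    ENNReal.ofReal s ≤ dimH (F '' {ω | ∀ n, ω n ∈ O (hist ω n)}) := by
  classical
  set I : Set ℝ := Set.Ico 0 1 with hI
  have hB0 : 0 < B := by linarith
  have hlB : 0 < Real.log B := Real.log_pos hB
  -- main inequality
  have main : ∀ y ∈ I, ∀ y' ∈ I, |y - y'| ≤
      Real.exp K / c₂ ^ s * |F (gw O y) - F (gw O y')| ^ s := by
    intro y hy y' hy'
    have hup : ∀ n : ℕ, (∀ i < n, gw O y i = gw O y' i) →
        |y - y'| ≤ Real.exp K * Real.exp (-(s * Real.log B) * n) := by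
      intro n hn
      refine (gw_close hO hy hy' n hn).trans ?_
      rw [← Real.exp_add]
      apply Real.exp_le_exp.2
      have := hD (gw O y) (fun n => gw_mem hO hy n) n
      linarith
    by_cases hne : ∃ n, gw O y n ≠ gw O y' n
    · have h1 := Nat.find_spec hne
      have h2 : ∀ i < Nat.find hne, gw O y i = gw O y' i := by
        intro i hi
        have := Nat.find_min hne hi
        tauto
      set n := Nat.find hne
      have h3 := hup n h2
      have h4 := hF _ _ n h2 h1
      have h5 : (c₂ * (B ^ n)⁻¹) ^ s ≤ |F (gw O y) - F (gw O y')| ^ s :=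
        Real.rpow_le_rpow (by positivity) h4 hs.le
      rw [Real.mul_rpow hc₂.le (by positivity)] at h5
      have h6 : ((B ^ n)⁻¹) ^ s = Real.exp (-(s * Real.log B) * n) := by
        rw [Real.rpow_def_of_pos (by positivity), Real.log_inv, Real.log_pow]
        congr 1; ring
      rw [h6] at h5
      have h7 : 0 < c₂ ^ s := Real.rpow_pos_of_pos hc₂ s
      refine h3.trans ?_
      rw [div_mul_eq_mul_div, le_div_iff₀ h7]
      nlinarith [mul_le_mul_of_nonneg_left h5 (Real.exp_pos K).le]
    · push Not at hne
      have h0 : |y - y'| ≤ 0 := by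
        have ht : Filter.Tendsto (fun n : ℕ => Real.exp K * Real.exp (-(s * Real.log B) * n))
            Filter.atTop (nhds (Real.exp K * 0)) := by
          refine Filter.Tendsto.const_mul _ (Real.tendsto_exp_atBot.comp ?_)
          refine Filter.Tendsto.const_mul_atTop_of_neg ?_ tendsto_natCast_atTop_atTop
          have := mul_pos hs hlB
          linarith
        rw [mul_zero] at ht
        exact ge_of_tendsto' ht (fun n => hup n (fun i _ => hne i))
      refine h0.trans ?_
      have : 0 < c₂ ^ s := Real.rpow_pos_of_pos hc₂ s
      positivity
  set f : ℝ → ℝ := fun y => F (gw O y) with hf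
  have hinj : Set.InjOn f I := by
    intro y hy y' hy' h
    have h1 := main y hy y' hy'
    have h2 : F (gw O y) - F (gw O y') = 0 := sub_eq_zero.2 h
    rw [h2, abs_zero, Real.zero_rpow hs.ne', mul_zero] at h1
    have := abs_nonneg (y - y')
    exact sub_eq_zero.1 (abs_eq_zero.1 (le_antisymm h1 this))
  set g := Function.invFunOn f I with hg
  have hgl : ∀ y ∈ I, g (f y) = y := fun y hy => hinj.leftInvOn_invFunOn hy
  have hC0 : 0 ≤ Real.exp K / c₂ ^ s := by
    have : 0 < c₂ ^ s := Real.rpow_pos_of_pos hc₂ s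
    positivity
  have hH : HolderOnWith (Real.exp K / c₂ ^ s).toNNReal s.toNNReal g (f '' I) := by
    rintro _ ⟨y, hy, rfl⟩ _ ⟨y', hy', rfl⟩
    rw [hgl y hy, hgl y' hy', edist_dist, edist_dist, Real.dist_eq, Real.dist_eq,
      Real.coe_toNNReal s hs.le, ENNReal.ofReal_rpow_of_nonneg (abs_nonneg _) hs.le]
    change _ ≤ ENNReal.ofReal _ * _
    rw [← ENNReal.ofReal_mul hC0]
    exact ENNReal.ofReal_le_ofReal (main y hy y' hy')
  have hs' : 0 < s.toNNReal := Real.toNNReal_pos.2 hs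
  have h1 := hH.dimH_image_le hs'
  have h2 : g '' (f '' I) = I := by
    rw [Set.image_image]
    ext z
    constructor
    · rintro ⟨y, hy, rfl⟩
      simp only [hgl y hy]; exact hy
    · intro hz
      exact ⟨z, hz, hgl z hz⟩
  have h3 : dimH I = 1 := by
    have := Real.dimH_of_nonempty_interior (E := ℝ) (s := I) (by
      rw [hI, interior_Ico]; exact Set.nonempty_Ioo.2 one_pos)
    simpa using this
  rw [h2, h3] at h1
  have h4 : f '' I ⊆ F '' {ω | ∀ n, ω n ∈ O (hist ω n)} := by
    rintro _ ⟨y, hy, rfl⟩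
    exact ⟨_, fun n => gw_mem hO hy n, rfl⟩
  refine le_trans ?_ (dimH_mono h4)
  have h5 := (ENNReal.le_div_iff_mul_le (Or.inl (by exact_mod_cast hs'.ne')) (Or.inl (by simp))).1 h1
  rw [one_mul] at h5
  exact h5

end Dim
end SBA

namespace SBA

section Sep
variable {b : ℕ} {A : Finset ℕ}

/-- value of a sequence of digits in `A` -/
noncomputable def val (b : ℕ) (A : Finset ℕ) (ω : ℕ → A) : ℝ := baseVal b (fun i => (ω i : ℕ))

theorem term_le (hb : 2 ≤ b) (hAb : A ⊆ Finset.range b) (a : A) (i : ℕ) :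
    ‖((a : ℕ) : ℝ) / (b : ℝ) ^ (i + 1)‖ ≤ ((b : ℝ)⁻¹) ^ i := by
  have h1 : (a : ℕ) < b := Finset.mem_range.1 (hAb a.2)
  have h2 : ((a : ℕ) : ℝ) ≤ b := by exact_mod_cast h1.le
  have hb0 : (0 : ℝ) < b := by positivity
  rw [Real.norm_of_nonneg (by positivity), inv_pow, div_le_iff₀ (by positivity), pow_succ]
  rw [← mul_assoc, inv_mul_cancel₀ (by positivity), one_mul]
  exact h2

theorem summable_geo (hb : 2 ≤ b) : Summable (fun i : ℕ => ((b : ℝ)⁻¹) ^ i) := by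
  have h2 : (2 : ℝ) ≤ b := by exact_mod_cast hb
  apply summable_geometric_of_lt_one (by positivity)
  exact inv_lt_one_of_one_lt₀ (by linarith)

theorem val_cons (hb : 2 ≤ b) (hAb : A ⊆ Finset.range b) (ω : ℕ → A) :
    val b A ω = (((ω 0 : ℕ) : ℝ) + val b A (fun i => ω (i + 1))) / b := by
  have hs : Summable (fun i : ℕ => (((ω i : ℕ)) : ℝ) / (b : ℝ) ^ (i + 1)) :=
    Summable.of_norm_bounded (summable_geo hb) (fun i => term_le hb hAb _ i)
  unfold val baseVal
  rw [hs.tsum_eq_zero_add, add_div, ← tsum_div_const]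
  congr 1
  · simp
  · apply tsum_congr
    intro i
    rw [div_div, ← pow_succ]

theorem continuous_val (hb : 2 ≤ b) (hAb : A ⊆ Finset.range b) : Continuous (val b A) := by
  unfold val baseVal
  refine continuous_tsum (u := fun i : ℕ => ((b : ℝ)⁻¹) ^ i) ?_ (summable_geo hb) ?_
  · intro i
    have : Continuous (fun a : A => ((a : ℕ) : ℝ) / (b : ℝ) ^ (i + 1)) :=
      continuous_of_discreteTopology
    exact this.comp (continuous_apply i)
  · intro i ω
    exact term_le hb hAb _ i

theorem exists_sep (hb : 2 ≤ b) (hAb : A ⊆ Finset.range b) (hsep : StrongSep b A) :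
    ∃ η : ℝ, 0 < η ∧ ∀ ω ω' : ℕ → A, ω 0 ≠ ω' 0 → η ≤ |val b A ω - val b A ω'| := by
  set K : Set ((ℕ → A) × (ℕ → A)) := {t | t.1 0 ≠ t.2 0} with hK
  have hKc : IsCompact K := by
    apply IsClosed.isCompact
    have h1 : Continuous (fun t : (ℕ → A) × (ℕ → A) => (t.1 0, t.2 0)) := by fun_prop
    have h2 : IsClosed {t : A × A | t.1 ≠ t.2} := isClosed_discrete _
    exact h2.preimage h1
  have hcv := continuous_val hb hAb
  have hf : Continuous (fun t : (ℕ → A) × (ℕ → A) => |val b A t.1 - val b A t.2|) := by fun_prop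
  have hlim : ∀ ω : ℕ → A, val b A ω ∈ limitSet b A := fun ω => ⟨_, fun i => (ω i).2, rfl⟩
  have hpos : ∀ t ∈ K, 0 < |val b A t.1 - val b A t.2| := by
    rintro ⟨ω, ω'⟩ ht
    rw [abs_pos, sub_ne_zero]
    intro heq
    have hd := hsep (ω 0) (ω 0).2 (ω' 0) (ω' 0).2 (fun h => ht (Subtype.ext h))
    refine Set.disjoint_left.1 hd ⟨_, hlim (fun i => ω (i + 1)), rfl⟩
      ⟨_, hlim (fun i => ω' (i + 1)), ?_⟩
    change (((ω' 0 : ℕ) : ℝ) + val b A (fun i => ω' (i + 1))) / b =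
      (((ω 0 : ℕ) : ℝ) + val b A (fun i => ω (i + 1))) / b
    rw [← val_cons hb hAb, ← val_cons hb hAb]
    exact heq.symm
  rcases K.eq_empty_or_nonempty with he | hne
  · refine ⟨1, one_pos, fun ω ω' h => ?_⟩
    have : (ω, ω') ∈ K := h
    rw [he] at this
    exact this.elim
  · obtain ⟨t, ht, hmin⟩ := hKc.exists_isMinOn hne hf.continuousOn
    exact ⟨_, hpos t ht, fun ω ω' h => hmin (show (ω, ω') ∈ K from h)⟩

theorem sep_n (hb : 2 ≤ b) (hAb : A ⊆ Finset.range b) {η : ℝ}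
    (hη : ∀ ω ω' : ℕ → A, ω 0 ≠ ω' 0 → η ≤ |val b A ω - val b A ω'|) (ω ω' : ℕ → A) (n : ℕ)
    (h : ∀ i < n, ω i = ω' i) (hn : ω n ≠ ω' n) :
    η * ((b : ℝ) ^ n)⁻¹ ≤ |val b A ω - val b A ω'| := by
  induction n generalizing ω ω' with
  | zero => simpa using hη ω ω' hn
  | succ n ih =>
    have h1 := ih (fun i => ω (i + 1)) (fun i => ω' (i + 1)) (fun i hi => h (i + 1) (by omega)) hn
    have hb0 : (0 : ℝ) < b := by positivity
    rw [val_cons hb hAb ω, val_cons hb hAb ω', h 0 (by omega), ← sub_div, add_sub_add_left_eq_sub,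
      abs_div, abs_of_pos hb0, le_div_iff₀ hb0, pow_succ, mul_inv, ← mul_assoc,
      inv_mul_cancel_right₀ hb0.ne']
    exact h1

theorem bad_of_aper (hb : 2 ≤ b) (hAb : A ⊆ Finset.range b) (hk : 2 ≤ A.card) {η : ℝ} (hη0 : 0 < η)
    (hη : ∀ ω ω' : ℕ → A, ω 0 ≠ ω' 0 → η ≤ |val b A ω - val b A ω'|) (ω : ℕ → A)
    (hω : ∀ i p : ℕ, 0 < p → ∃ x, A.card ^ x ≤ A.card ^ 3 * (16 * (i + p)) ∧
      ∃ j < x, ω (i + p + j) ≠ ω (i + j))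
    {δ : ℝ} (hδ : δ = Real.log A.card / Real.log b) :
    BadlySymbolicallyApproximable b A δ (val b A ω) := by
  classical
  set k := A.card with hkdef
  have hb2 : (2 : ℝ) ≤ b := by exact_mod_cast hb
  have hb0 : (0 : ℝ) < b := by linarith
  have hb1 : (1 : ℝ) < b := by linarith
  have hk2 : (2 : ℝ) ≤ k := by exact_mod_cast hk
  have hlb : 0 < Real.log b := Real.log_pos hb1
  have hlk : 0 < Real.log k := Real.log_pos (by linarith)
  have hδ0 : 0 < δ := by rw [hδ]; positivity
  set s := 1 / δ with hs
  have hs0 : 0 < s := by positivity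
  have hks : (k : ℝ) ^ s = b := by
    rw [Real.rpow_def_of_pos (by linarith), hs, hδ, one_div_div, mul_div_cancel₀ _ hlk.ne',
      Real.exp_log hb0]
  obtain ⟨c₃, hc₃, hc₃'⟩ : ∃ c₃ : ℝ, 0 < c₃ ∧ ∀ i p : ℕ, 0 < p →
      Real.logb b ((b : ℝ) ^ i * ((b : ℝ) ^ p - 1)) = 0 ∨
      c₃ * ((i + p : ℕ) : ℝ) ≤ Real.logb b ((b : ℝ) ^ i * ((b : ℝ) ^ p - 1)) := by
    have hL0 : 0 ≤ Real.logb b ((b : ℝ) - 1) := Real.logb_nonneg hb1 (by linarith)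
    have key : ∀ c₃ : ℝ, c₃ ≤ 1 / 2 → (Real.logb b ((b : ℝ) - 1) = 0 ∨
        c₃ ≤ Real.logb b ((b : ℝ) - 1)) → ∀ i p : ℕ, 0 < p →
      Real.logb b ((b : ℝ) ^ i * ((b : ℝ) ^ p - 1)) = 0 ∨
      c₃ * ((i + p : ℕ) : ℝ) ≤ Real.logb b ((b : ℝ) ^ i * ((b : ℝ) ^ p - 1)) := by
      intro c₃ hc hor i p hp
      by_cases hq : i + p = 1
      · have hi : i = 0 := by omega
        have hp1 : p = 1 := by omega
        subst hi; subst hp1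
        simpa using hor
      · right
        obtain ⟨p', rfl⟩ : ∃ p', p = p' + 1 := ⟨p - 1, by omega⟩
        have h1 : (b : ℝ) ^ (i + p') ≤ (b : ℝ) ^ i * ((b : ℝ) ^ (p' + 1) - 1) := by
          rw [pow_add]
          refine mul_le_mul_of_nonneg_left ?_ (by positivity)
          have h2 : (1 : ℝ) ≤ (b : ℝ) ^ p' := one_le_pow₀ hb1.le
          rw [pow_succ]; nlinarith
        have h2 : Real.logb b ((b : ℝ) ^ (i + p')) ≤
            Real.logb b ((b : ℝ) ^ i * ((b : ℝ) ^ (p' + 1) - 1)) :=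
          Real.logb_le_logb_of_le hb1 (by positivity) h1
        rw [Real.logb_pow, Real.logb_self_eq_one hb1, mul_one] at h2
        refine le_trans ?_ h2
        have h3 : (1 : ℝ) ≤ ((i + p' : ℕ) : ℝ) := by
          have : 1 ≤ i + p' := by omega
          exact_mod_cast this
        have h4 : ((i + (p' + 1) : ℕ) : ℝ) = ((i + p' : ℕ) : ℝ) + 1 := by push_cast; ring
        rw [h4]
        nlinarith
    by_cases h0 : Real.logb b ((b : ℝ) - 1) = 0
    · exact ⟨1 / 2, by norm_num, key _ le_rfl (Or.inl h0)⟩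
    · have h1 : 0 < Real.logb b ((b : ℝ) - 1) := lt_of_le_of_ne hL0 (Ne.symm h0)
      exact ⟨min (1 / 2) (Real.logb b ((b : ℝ) - 1)), lt_min (by norm_num) h1,
        key _ (min_le_left _ _) (Or.inr (min_le_right _ _))⟩
  have hk3 : (0 : ℝ) < 16 * (k : ℝ) ^ 3 := by positivity
  refine ⟨η / 2 * (c₃ / (16 * (k : ℝ) ^ 3)) ^ s, ?_, ?_⟩
  · have : 0 < (c₃ / (16 * (k : ℝ) ^ 3)) ^ s := Real.rpow_pos_of_pos (by positivity) _
    positivity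
  intro r i p hp ⟨τ, hτA, hr, hτ⟩
  have hr' : r = val b A (fun t => ⟨τ t, hτA t⟩) := hr
  rw [hr']
  set σ : ℕ → A := fun t => ⟨τ t, hτA t⟩ with hσ
  have hσp : ∀ t, i ≤ t → σ (t + p) = σ t := fun t ht => Subtype.ext (hτ t ht)
  rcases hc₃' i p hp with h0 | hL
  · rw [h0, Real.zero_rpow hs0.ne', mul_zero, div_zero]
    exact abs_nonneg _
  set L := Real.logb b ((b : ℝ) ^ i * ((b : ℝ) ^ p - 1)) with hLdef
  obtain ⟨x, hx, j, hj, hne⟩ := hω i p hp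
  set q : ℕ := i + p with hq
  have hq0 : (0 : ℝ) < (q : ℝ) := by
    have : 0 < q := by omega
    exact_mod_cast this
  -- the two sequences differ early
  have hdiff : ∃ N, ω N ≠ σ N ∧ N < q + x := by
    by_contra! hc
    have hc' : ∀ N, N < q + x → ω N = σ N := by
      intro N hN
      by_contra hh
      have := hc N hh
      omega
    apply hne
    rw [hc' (q + j) (by omega), hc' (i + j) (by omega), ← hσp (i + j) (by omega)]
    congr 1; omega
  have hex : ∃ N, ω N ≠ σ N := ⟨_, hdiff.choose_spec.1⟩
  have hN1 := Nat.find_spec hex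
  have hN2 : ∀ t < Nat.find hex, ω t = σ t := by
    intro t ht
    have := Nat.find_min hex ht
    tauto
  have hN3 : Nat.find hex < q + x := by
    obtain ⟨M, h1, h2⟩ := hdiff
    exact (Nat.find_min' hex h1).trans_lt h2
  set N := Nat.find hex
  have hlow := sep_n hb hAb hη ω σ N hN2 hN1
  refine le_trans ?_ hlow
  -- numerics
  have hbx : (b : ℝ) ^ x ≤ (16 * (k : ℝ) ^ 3 * q) ^ s := by
    have h1 : ((k : ℝ) ^ x) ^ s = (b : ℝ) ^ x := by
      rw [← Real.rpow_natCast, ← Real.rpow_mul (by positivity), mul_comm, Real.rpow_mul (by positivity),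
        hks, Real.rpow_natCast]
    rw [← h1]
    apply Real.rpow_le_rpow (by positivity) _ hs0.le
    have h2 : (k : ℝ) ^ x ≤ (k : ℝ) ^ 3 * (16 * q) := by exact_mod_cast hx
    linarith
  have hbN : (b : ℝ) ^ N ≤ (b : ℝ) ^ q * (16 * (k : ℝ) ^ 3 * q) ^ s := by
    calc (b : ℝ) ^ N ≤ (b : ℝ) ^ (q + x) := pow_le_pow_right₀ hb1.le hN3.le
      _ = (b : ℝ) ^ q * (b : ℝ) ^ x := pow_add _ _ _
      _ ≤ _ := mul_le_mul_of_nonneg_left hbx (by positivity)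
  have hH : (b : ℝ) ^ q / 2 ≤ (b : ℝ) ^ i * ((b : ℝ) ^ p - 1) := by
    rw [hq, pow_add, mul_div_assoc]
    refine mul_le_mul_of_nonneg_left ?_ (by positivity)
    have : (b : ℝ) ≤ (b : ℝ) ^ p := le_self_pow₀ hb1.le (by omega)
    linarith
  have hLs : (c₃ * q) ^ s ≤ L ^ s := Real.rpow_le_rpow (by positivity) hL hs0.le
  have e1 : (16 * (k : ℝ) ^ 3 * q) ^ s = (16 * (k : ℝ) ^ 3) ^ s * (q : ℝ) ^ s :=
    Real.mul_rpow hk3.le hq0.le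
  have e2 : (c₃ * q) ^ s = c₃ ^ s * (q : ℝ) ^ s := Real.mul_rpow hc₃.le hq0.le
  have e3 : (c₃ / (16 * (k : ℝ) ^ 3)) ^ s = c₃ ^ s / (16 * (k : ℝ) ^ 3) ^ s :=
    Real.div_rpow hc₃.le hk3.le _
  have p1 : 0 < c₃ ^ s := Real.rpow_pos_of_pos hc₃ _
  have p2 : 0 < (q : ℝ) ^ s := Real.rpow_pos_of_pos hq0 _
  have p3 : 0 < (16 * (k : ℝ) ^ 3) ^ s := Real.rpow_pos_of_pos hk3 _
  have p4 : 0 < (b : ℝ) ^ q := by positivity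
  rw [e3]
  rw [e1] at hbN
  rw [e2] at hLs
  have hden : (b : ℝ) ^ q / 2 * (c₃ ^ s * (q : ℝ) ^ s) ≤
      (b : ℝ) ^ i * ((b : ℝ) ^ p - 1) * L ^ s :=
    mul_le_mul hH hLs (by positivity) (le_trans (by positivity) hH)
  calc η / 2 * (c₃ ^ s / (16 * (k : ℝ) ^ 3) ^ s) / ((b : ℝ) ^ i * ((b : ℝ) ^ p - 1) * L ^ s)
      ≤ η / 2 * (c₃ ^ s / (16 * (k : ℝ) ^ 3) ^ s) / ((b : ℝ) ^ q / 2 * (c₃ ^ s * (q : ℝ) ^ s)) :=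
        div_le_div_of_nonneg_left (by positivity) (by positivity) hden
    _ = η * ((b : ℝ) ^ q * ((16 * (k : ℝ) ^ 3) ^ s * (q : ℝ) ^ s))⁻¹ := by
        field_simp
    _ ≤ η * ((b : ℝ) ^ N)⁻¹ := by
        refine mul_le_mul_of_nonneg_left ?_ hη0.le
        exact inv_anti₀ (by positivity) hbN

end Sep

section Consts
variable {α : Type*} [Fintype α] [DecidableEq α]

theorem alpha_facts {k : ℕ} (hk2 : 2 ≤ k) (hcard : Fintype.card α = k) {a : ℝ}
    (ha : a = if k = 2 then 1 / 49
      else if k = 3 then (8 * (9 * Real.logb 4 3 - 1))⁻¹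
      else Real.log (Nat.factorial (k - 2)) / (k * Real.log k)) :
    0 < a ∧ ∃ K : ℝ, ∀ ω : ℕ → α, (∀ n, ω n ∈ tree (hist ω n)) → ∀ n : ℕ,
      a * Real.log k * n - K ≤ logD tree ω n := by
  have hc2 : 2 ≤ Fintype.card α := by omega
  have hlk : 0 < Real.log k := Real.log_pos (by exact_mod_cast hk2)
  have hl2 : 0 < Real.log 2 := Real.log_pos (by norm_num)
  have fin : ∀ {c R e : ℝ} {P : ℕ → List α → ℝ}, IsPot c R P → 1 ≤ R → 0 ≤ e → e ≤ c * R →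
      e * ((k : ℝ) ^ 3 - 1) ≤ c * ((k : ℝ) ^ 3 - R) → a * Real.log k ≤ e / R →
      ∃ K : ℝ, ∀ ω : ℕ → α, (∀ n, ω n ∈ tree (hist ω n)) → ∀ n : ℕ,
        a * Real.log k * n - K ≤ logD tree ω n := by
    intro c R e P hP hR he hec hcon hle
    refine ⟨e * (k : ℝ) ^ 2, fun ω hω n => ?_⟩
    have h1 := entropy_bound hc2 hω hP hR he hec (by rw [hcard]; exact hcon) n
    rw [hcard] at h1
    have : a * Real.log k * n ≤ e / R * n := by gcongr
    linarith
  by_cases h2 : k = 2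
  · rw [if_pos h2] at ha
    subst h2
    refine ⟨by rw [ha]; norm_num, ?_⟩
    refine fin (e := Real.log 2 / 7) (isPot_fresh hcard) (by norm_num) (by positivity) ?_ ?_ ?_
    · linarith
    · norm_num
    · rw [ha]; push_cast; linarith
  rw [if_neg h2] at ha
  by_cases h3 : k = 3
  · rw [if_pos h3] at ha
    subst h3
    have hlog : 3 / 4 ≤ Real.logb 4 3 := by
      rw [Real.le_logb_iff_rpow_le (by norm_num) (by norm_num)]
      have : ((4 : ℝ) ^ ((3 : ℝ) / 4)) ^ (4 : ℕ) ≤ 3 ^ (4 : ℕ) := by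
        rw [← Real.rpow_natCast, ← Real.rpow_mul (by norm_num)]
        norm_num
      exact le_of_pow_le_pow_left₀ (by norm_num) (by norm_num) this
    have ha1 : a ≤ 1 / 46 := by
      rw [ha, ← one_div]
      apply one_div_le_one_div_of_le (by norm_num)
      linarith
    have ha0 : 0 < a := by rw [ha]; apply inv_pos.2; linarith
    refine ⟨ha0, ?_⟩
    have hl3 : Real.log 3 ≤ 2 * Real.log 2 := by
      have : Real.log 3 ≤ Real.log (2 ^ 2) := Real.log_le_log (by norm_num) (by norm_num)
      rw [Real.log_pow] at this
      exact_mod_cast this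
    refine fin (c := Real.log 2 / 3) (R := 3) (e := 4 * Real.log 2 / 13)
      (isPot_fpot (by positivity) (by norm_num) ?_ ?_) (by norm_num) (by positivity) ?_ ?_ ?_
    · rw [hcard]; norm_num [Nat.factorial]
    · rw [hcard]; norm_num [Nat.factorial]; linarith
    · linarith
    · norm_num; linarith
    · push_cast
      push_cast at hlk
      have : a * Real.log 3 ≤ 1 / 46 * (2 * Real.log 2) := by gcongr
      linarith
  · rw [if_neg h3] at ha
    have hk4 : 4 ≤ k := by omega
    have hf : 2 ≤ (k - 2).factorial := by
      calc 2 = Nat.factorial 2 := rfl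
        _ ≤ _ := Nat.factorial_le (by omega)
    have hlf : 0 < Real.log ((k - 2).factorial : ℕ) := Real.log_pos (by exact_mod_cast hf)
    have hk0 : (0 : ℝ) < k := by positivity
    refine ⟨by rw [ha]; positivity, ?_⟩
    set c := Real.log ((k - 2).factorial : ℕ) / k with hc
    have hc0 : 0 < c := by positivity
    have hck : c * k = Real.log ((k - 2).factorial : ℕ) := by rw [hc]; field_simp
    refine fin (c := c) (R := 1) (e := c)
      (isPot_fpot hc0.le le_rfl ?_ ?_) le_rfl hc0.le ?_ le_rfl ?_
    · rw [hcard, hck]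
      apply Real.log_le_log (by positivity)
      exact_mod_cast Nat.factorial_le (by omega)
    · rw [hcard, show k - 1 - 1 = k - 2 by omega, ← hck]
      have : ((k - 1 : ℕ) : ℝ) ≤ k := by exact_mod_cast Nat.sub_le _ _
      nlinarith
    · linarith
    · rw [ha, hc]
      apply le_of_eq
      field_simp

end Consts
end SBA

/-- Corollary: if the base-`b` IFS defined by `A` satisfies the strong separation
condition, then the set of badly symbolically approximable points of `F` has Hausdorff
dimension at least `α_k·δ > 0`; in particular it is nonempty. -/
theorem statement15 (b : ℕ) (hb : 2 ≤ b) (A : Finset ℕ) (hAb : A ⊆ Finset.range b)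
    (k : ℕ) (hk : k = A.card) (hk2 : 2 ≤ k)
    (hsep : StrongSep b A)
    (δ : ℝ) (hδ : δ = Real.log k / Real.log b)
    (α : ℝ)
    (hα : α = if k = 2 then 1 / 49
      else if k = 3 then (8 * (9 * Real.logb 4 3 - 1))⁻¹
      else Real.log (Nat.factorial (k - 2)) / (k * Real.log k)) :
    ENNReal.ofReal (α * δ) ≤
        dimH {x ∈ limitSet b A | BadlySymbolicallyApproximable b A δ x} ∧
      0 < α * δ ∧
      ∃ x ∈ limitSet b A, BadlySymbolicallyApproximable b A δ x := by
  have hcard : Fintype.card A = k := by rw [Fintype.card_coe, hk]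
  have : Nonempty A := Fintype.card_pos_iff.1 (by omega)
  obtain ⟨hα0, K, hK⟩ := SBA.alpha_facts (α := A) hk2 hcard hα
  have hb1 : (1 : ℝ) < b := by exact_mod_cast (show 1 < b by omega)
  have hlb : 0 < Real.log b := Real.log_pos hb1
  have hlk : 0 < Real.log k := Real.log_pos (by exact_mod_cast (show 1 < k by omega))
  have hδ0 : 0 < δ := by rw [hδ]; positivity
  have hs : 0 < α * δ := mul_pos hα0 hδ0
  obtain ⟨η, hη0, hη⟩ := SBA.exists_sep hb hAb hsep
  have hbad : ∀ ω : ℕ → A, (∀ n, ω n ∈ SBA.tree (SBA.hist ω n)) →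
      SBA.val b A ω ∈ {x ∈ limitSet b A | BadlySymbolicallyApproximable b A δ x} := by
    intro ω hω
    refine ⟨⟨_, fun i => (ω i).2, rfl⟩, ?_⟩
    refine SBA.bad_of_aper hb hAb (by omega) hη0 hη ω ?_ (by rw [hδ, hk])
    intro i p hp
    have := SBA.tree_aper (by omega) hω i p hp
    rwa [Fintype.card_coe] at this
  refine ⟨?_, hs, ?_⟩
  · have hd := SBA.dim_bound (O := SBA.tree) (F := SBA.val b A) (B := b) (s := α * δ) (K := K)
      SBA.tree_nonempty hb1 hs hη0 (SBA.sep_n hb hAb hη) (by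
        intro ω hω n
        have h1 := hK ω hω n
        have h2 : α * δ * Real.log b = α * Real.log k := by rw [hδ]; field_simp
        rw [h2]; exact h1)
    refine hd.trans (dimH_mono ?_)
    rintro _ ⟨ω, hω, rfl⟩
    exact hbad ω hω
  · have h := hbad (SBA.gw SBA.tree 0)
      (fun n => SBA.gw_mem SBA.tree_nonempty ⟨le_rfl, one_pos⟩ n)
    exact ⟨_, h.1, h.2⟩
end

section
/- The base-b IFS defined by the alphabet A ⊆ {0,…,b−1} satisfies the strong separation condition if and only if at least one of the following holds: (1) 0 ∉ A; (2) b − 1 ∉ A; (3) A contains no pair of consecutive integers. -/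
lemma hasSum_top (b : ℕ) (hb : 2 ≤ b) :
    HasSum (fun i : ℕ => ((b : ℝ) - 1) / (b : ℝ) ^ (i + 1)) 1 := by
  have hb' : (2 : ℝ) ≤ b := by exact_mod_cast hb
  have h := hasSum_geometric_of_lt_one (r := (b : ℝ)⁻¹) (by positivity)
    (inv_lt_one_of_one_lt₀ (by linarith))
  have h2 := h.mul_left (((b : ℝ) - 1) / b)
  have e : ((b : ℝ) - 1) / b * (1 - (b : ℝ)⁻¹)⁻¹ = 1 := by
    have h1 : (b : ℝ) - 1 ≠ 0 := by linarith
    have h0 : (b : ℝ) ≠ 0 := by linarith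
    have : 1 - (b : ℝ)⁻¹ = ((b : ℝ) - 1) / b := by field_simp
    rw [this]
    exact mul_inv_cancel₀ (div_ne_zero h1 h0)
  rw [e] at h2
  have hf : (fun i : ℕ => ((b : ℝ) - 1) / (b : ℝ) ^ (i + 1)) =
      fun i : ℕ => ((b : ℝ) - 1) / b * (b : ℝ)⁻¹ ^ i := by
    funext i
    rw [pow_succ, inv_pow]
    field_simp
  rw [hf]
  exact h2

lemma term_le (b : ℕ) (hb : 2 ≤ b) (ω : ℕ → ℕ) (hω : ∀ i, ω i < b) (i : ℕ) :
    (ω i : ℝ) / (b : ℝ) ^ (i + 1) ≤ ((b : ℝ) - 1) / (b : ℝ) ^ (i + 1) := by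
  have : (ω i : ℝ) + 1 ≤ b := by exact_mod_cast hω i
  have h : (ω i : ℝ) ≤ (b : ℝ) - 1 := by linarith
  gcongr

lemma summable_base (b : ℕ) (hb : 2 ≤ b) (ω : ℕ → ℕ) (hω : ∀ i, ω i < b) :
    Summable (fun i : ℕ => (ω i : ℝ) / (b : ℝ) ^ (i + 1)) :=
  Summable.of_nonneg_of_le (fun i => by positivity) (term_le b hb ω hω) (hasSum_top b hb).summable

lemma baseVal_nonneg' (b : ℕ) (ω : ℕ → ℕ) : 0 ≤ baseVal b ω :=
  tsum_nonneg fun i => by positivity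

lemma baseVal_le_one' (b : ℕ) (hb : 2 ≤ b) (ω : ℕ → ℕ) (hω : ∀ i, ω i < b) :
    baseVal b ω ≤ 1 :=
  hasSum_le (term_le b hb ω hω) (summable_base b hb ω hω).hasSum (hasSum_top b hb)

lemma first_eq_zero (b : ℕ) (hb : 2 ≤ b) (ω : ℕ → ℕ) (hω : ∀ i, ω i < b)
    (h : baseVal b ω ≤ 0) : ω 0 = 0 := by
  by_contra h0
  have hpos : 0 < (ω 0 : ℝ) / (b : ℝ) ^ (0 + 1) := by
    have : 0 < ω 0 := Nat.pos_of_ne_zero h0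
    positivity
  have := (summable_base b hb ω hω).tsum_pos (fun i => by positivity) 0 hpos
  exact absurd h (not_le.mpr this)

lemma first_eq_top (b : ℕ) (hb : 2 ≤ b) (ω : ℕ → ℕ) (hω : ∀ i, ω i < b)
    (h : 1 ≤ baseVal b ω) : ω 0 = b - 1 := by
  by_contra h0
  have h1 := hω 0
  have h2 : (ω 0 : ℝ) + 1 < b := by
    have : ω 0 + 1 < b := by omega
    exact_mod_cast this
  have hlt : (ω 0 : ℝ) / (b : ℝ) ^ (0 + 1) < ((b : ℝ) - 1) / (b : ℝ) ^ (0 + 1) := by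
    have h : (ω 0 : ℝ) < (b : ℝ) - 1 := by linarith
    gcongr
  have := hasSum_lt (term_le b hb ω hω) hlt (summable_base b hb ω hω).hasSum (hasSum_top b hb)
  exact absurd h (not_le.mpr this)

lemma key_lt (b : ℕ) (hb : 2 ≤ b) (A : Finset ℕ) (hAb : A ⊆ Finset.range b)
    (h : 0 ∉ A ∨ (b - 1) ∉ A ∨ ∀ i ∈ A, i + 1 ∉ A) (i j : ℕ) (hi : i ∈ A) (hj : j ∈ A)
    (hij : i < j) (ω η : ℕ → ℕ) (hω : ∀ k, ω k ∈ A) (hη : ∀ k, η k ∈ A)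
    (e : (i : ℝ) + baseVal b ω = j + baseVal b η) : False := by
  have hω' : ∀ k, ω k < b := fun k => Finset.mem_range.mp (hAb (hω k))
  have hη' : ∀ k, η k < b := fun k => Finset.mem_range.mp (hAb (hη k))
  have a1 := baseVal_le_one' b hb ω hω'
  have a2 := baseVal_nonneg' b η
  have c : (i : ℝ) + 1 ≤ j := by exact_mod_cast hij
  have z := first_eq_zero b hb η hη' (by linarith)
  have t := first_eq_top b hb ω hω' (by linarith)
  have d : (j : ℝ) ≤ i + 1 := by linarith
  have d' : j ≤ i + 1 := by exact_mod_cast d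
  have ej : j = i + 1 := by omega
  rcases h with h | h | h
  · exact h (z ▸ hη 0)
  · exact h (t ▸ hω 0)
  · exact h i hi (ej ▸ hj)

/-- Observation: the base-`b` IFS defined by `A ⊆ {0,…,b−1}` satisfies the strong
separation condition iff `0 ∉ A`, or `b − 1 ∉ A`, or `A` contains no pair of
consecutive integers. -/
theorem statement16 (b : ℕ) (hb : 2 ≤ b) (A : Finset ℕ) (hAb : A ⊆ Finset.range b)
    (hA2 : 2 ≤ A.card) :
    StrongSep b A ↔ (0 ∉ A ∨ (b - 1) ∉ A ∨ ∀ i ∈ A, i + 1 ∉ A) := by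
  have hb0 : (b : ℝ) ≠ 0 := by
    have : b ≠ 0 := by omega
    exact_mod_cast this
  constructor
  · intro hS
    by_contra! hc
    obtain ⟨h0, h1, i, hi, hi1⟩ := hc
    have := Set.disjoint_left.mp (hS i hi (i + 1) hi1 (by omega))
    refine @this (((i : ℝ) + 1) / b) ⟨1, ⟨fun _ => b - 1, fun _ => h1, ?_⟩, rfl⟩
      ⟨0, ⟨fun _ => 0, fun _ => h0, ?_⟩, ?_⟩
    · have e := (hasSum_top b hb).tsum_eq
      rw [baseVal, ← e]
      have : ((b - 1 : ℕ) : ℝ) = (b : ℝ) - 1 := by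
        rw [Nat.cast_sub (by omega)]; simp
      simp only [this]
    · simp [baseVal]
    · simp
  · intro h i hi j hj hij
    rw [Set.disjoint_left]
    rintro _ ⟨_, ⟨ω, hω, rfl⟩, rfl⟩ ⟨_, ⟨η, hη, rfl⟩, e⟩
    have e' : (j : ℝ) + baseVal b η = i + baseVal b ω := by
      have e2 : ((j : ℝ) + baseVal b η) / b = ((i : ℝ) + baseVal b ω) / b := e
      field_simp at e2
      exact e2
    rcases lt_or_gt_of_ne hij with hl | hl
    · exact key_lt b hb A hAb h i j hi hj hl ω η hω hη e'.symm
    · exact key_lt b hb A hAb h j i hj hi hl η ω hη hω e'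
end
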